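/- arXiv:1401.4689 — 2 statements merged into one kernel-verified Lean document; each statement's English description precedes it below -/
import Mathlib

section
/- Let S = {a, a', b, b'} be a four-letter alphabet with the complementation a ↦ a', b ↦ b', and let V, W ⊆ S^d be disjoint equivalent polybox codes without twin pairs. Assume there are i ∈ {1,…,d} and distinct letters l, p ∈ S such that V^{i,l} ≠ ∅ and V^{i,p} ≠ ∅. If there exists x ∈ ES such that the polybox code {(v)_i : v ∈ V, x ∈ E(v_i)} ⊆ S^{d−1} does not contain a twin pair, then |V| > 12. -/
variable {S : Type}

/-- Two words are dichotomous: at some position they carry complementary letters. -/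
def Dicho {d : ℕ} (c : S → S) (u v : Fin d → S) : Prop := ∃ j, v j = c (u j)

/-- Two words form a twin pair. -/
def TwinPair {d : ℕ} (c : S → S) (u v : Fin d → S) : Prop :=
  ∃ j, v j = c (u j) ∧ ∀ i, i ≠ j → v i = u i

/-- A polybox code: a set of pairwise dichotomous words. -/
def PolyboxCode {d : ℕ} (c : S → S) (V : Set (Fin d → S)) : Prop :=
  ∀ u ∈ V, ∀ v ∈ V, u ≠ v → Dicho c u v

/-- The code contains no twin pair. -/
def NoTwinPair {d : ℕ} (c : S → S) (V : Set (Fin d → S)) : Prop :=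
  ∀ u ∈ V, ∀ v ∈ V, ¬ TwinPair c u v

/-- `ES`: sets containing exactly one of `s`, `s'` for every letter `s`. -/
def ESet (c : S → S) : Set (Set S) := {B | ∀ s, Xor' (s ∈ B) (c s ∈ B)}

/-- `Es`: members of `ES` containing the letter `s`. -/
def ELetter (c : S → S) (s : S) : Set (Set S) := {B | B ∈ ESet c ∧ s ∈ B}

/-- The equicomplementary realization `v̌ ⊆ (ES)^d` of a word `v`. -/
def Realize {d : ℕ} (c : S → S) (v : Fin d → S) : Set (Fin d → Set S) :=
  {x | ∀ i, x i ∈ ELetter c (v i)}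

/-- The union `⋃_{v ∈ V} v̌`. -/
def RealizeSet {d : ℕ} (c : S → S) (V : Set (Fin d → S)) : Set (Fin d → Set S) :=
  ⋃ v ∈ V, Realize c v

/-- Two codes are equivalent if their realizations coincide. -/
def EquivCodes {d : ℕ} (c : S → S) (V W : Set (Fin d → S)) : Prop :=
  RealizeSet c V = RealizeSet c W

/-- A partition code: a polybox code whose realization is the whole box `(ES)^d`. -/
def PartitionCode {d : ℕ} (c : S → S) (U : Set (Fin d → S)) : Prop :=
  PolyboxCode c U ∧ RealizeSet c U = {x | ∀ i, x i ∈ ESet c}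

/-- `V^{i,l}`: the words of `V` with letter `l` at position `i`. -/
def Subcode {d : ℕ} (V : Set (Fin d → S)) (i : Fin d) (l : S) : Set (Fin d → S) :=
  {v | v ∈ V ∧ v i = l}

/-- The words obtained from `u` and `v` by deleting the `i`-th coordinate form
a twin pair. -/
def TwinPairIgnoring {d : ℕ} (c : S → S) (i : Fin d) (u v : Fin d → S) : Prop :=
  ∃ j, j ≠ i ∧ v j = c (u j) ∧ ∀ k, k ≠ i → k ≠ j → v k = u k

namespace Polybox

/-- A letter of the four-letter alphabet: its kind (`a` or `b`) and its sign. -/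
abbrev Letter := Bool × Bool

/-- A coordinate of a point: the sign that it selects in each of the two kinds. -/
abbrev Coord := Bool × Bool

/-- The complementary letter. -/
def neg (l : Letter) : Letter := (l.1, !l.2)

/-- The coordinate `q` selects the letter `l`. -/
def Hits (q : Coord) (l : Letter) : Prop := cond l.1 q.2 q.1 = l.2

instance (q : Coord) (l : Letter) : Decidable (Hits q l) :=
  inferInstanceAs (Decidable (_ = _))

theorem neg_neg (l : Letter) : neg (neg l) = l := by revert l; decide

theorem neg_ne (l : Letter) : neg l ≠ l := by revert l; decide

theorem neg_fst (l : Letter) : (neg l).1 = l.1 := rfl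

theorem eq_or_eq_neg {l m : Letter} (h : l.1 = m.1) : l = m ∨ l = neg m := by
  revert l m; decide

theorem hits_neg {q : Coord} {l : Letter} : Hits q (neg l) ↔ ¬ Hits q l := by
  revert q l; decide

theorem exists_hits_both {l m : Letter} (h : m ≠ neg l) : ∃ q, Hits q l ∧ Hits q m := by
  revert l m; decide

theorem exists_hits_not {l m : Letter} (h : l ≠ m) : ∃ q, Hits q l ∧ ¬ Hits q m := by
  revert l m; decide

set_option linter.unusedSectionVars false

variable {ι : Type} [DecidableEq ι]

/-- The point `x` lies in the box of the word `v`, as far as coordinates in `T` see it. -/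
def In (T : Finset ι) (x : ι → Coord) (v : ι → Letter) : Prop := ∀ k ∈ T, Hits (x k) (v k)

/-- Two words are dichotomous on `T`. -/
def Apart (T : Finset ι) (u v : ι → Letter) : Prop := ∃ k ∈ T, v k = neg (u k)

/-- Two words form a twin pair on `T`. -/
def Twin (T : Finset ι) (u v : ι → Letter) : Prop :=
  ∃ k ∈ T, v k = neg (u k) ∧ ∀ j ∈ T, j ≠ k → v j = u j

/-- Two words agree on `T`. -/
def Same (T : Finset ι) (u v : ι → Letter) : Prop := ∀ k ∈ T, u k = v k

/-- The words of `V` are pairwise dichotomous on `T`. -/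
def Code (T : Finset ι) (V : Finset (ι → Letter)) : Prop :=
  ∀ u ∈ V, ∀ v ∈ V, u ≠ v → Apart T u v

/-- No two words of `V` form a twin pair on `T`. -/
def TwinFree (T : Finset ι) (V : Finset (ι → Letter)) : Prop :=
  ∀ u ∈ V, ∀ v ∈ V, ¬ Twin T u v

/-- Some word of `V` contains the point `x` on `T`. -/
def Cov (T : Finset ι) (V : Finset (ι → Letter)) (x : ι → Coord) : Prop := ∃ v ∈ V, In T x v

/-- The words of `V` with letter `l` at position `i`. -/
def slice (V : Finset (ι → Letter)) (i : ι) (l : Letter) : Finset (ι → Letter) :=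
  V.filter fun v => v i = l

variable {T : Finset ι} {U V W : Finset (ι → Letter)} {u v w : ι → Letter} {x : ι → Coord}
  {i k : ι} {l m z : Letter}

theorem mem_slice : v ∈ slice V i l ↔ v ∈ V ∧ v i = l := by simp [slice]

theorem in_iff (hi : i ∈ T) : In T x v ↔ In (T.erase i) x v ∧ Hits (x i) (v i) := by
  refine ⟨fun h => ⟨fun k hk => h k (Finset.mem_of_mem_erase hk), h i hi⟩, fun h k hk => ?_⟩
  by_cases hki : k = i
  · exact hki ▸ h.2
  · exact h.1 k (Finset.mem_erase.2 ⟨hki, hk⟩)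

theorem In.erase (h : In T x v) : In (T.erase i) x v :=
  fun k hk => h k (Finset.mem_of_mem_erase hk)

theorem in_erase_update {q : Coord} :
    In (T.erase i) (Function.update x i q) v ↔ In (T.erase i) x v := by
  refine forall₂_congr fun k hk => ?_
  rw [Function.update_of_ne (Finset.ne_of_mem_erase hk)]

theorem in_update (hi : i ∈ T) {q : Coord} :
    In T (Function.update x i q) v ↔ In (T.erase i) x v ∧ Hits q (v i) := by
  rw [in_iff hi, in_erase_update, Function.update_self]

theorem Apart.symm (h : Apart T u v) : Apart T v u := by
  obtain ⟨k, hk, h⟩ := h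
  exact ⟨k, hk, by rw [h, neg_neg]⟩

theorem Twin.symm (h : Twin T u v) : Twin T v u := by
  obtain ⟨k, hk, h, h'⟩ := h
  exact ⟨k, hk, by rw [h, neg_neg], fun j hj hjk => (h' j hj hjk).symm⟩

theorem Same.symm (h : Same T u v) : Same T v u := fun k hk => (h k hk).symm

theorem Same.trans (h : Same T u v) (h' : Same T v w) : Same T u w :=
  fun k hk => (h k hk).trans (h' k hk)

theorem Same.in_iff (h : Same T u v) : In T x u ↔ In T x v :=
  forall₂_congr fun k hk => by rw [h k hk]

theorem Apart.not_in (h : Apart T u v) (hx : In T x u) : ¬ In T x v := by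
  obtain ⟨k, hk, h⟩ := h
  intro hv
  have := hv k hk
  rw [h, hits_neg] at this
  exact this (hx k hk)

theorem exists_in_both (h : ¬ Apart T u v) : ∃ x, In T x u ∧ In T x v := by
  have : ∀ k, ∃ q, k ∈ T → Hits q (u k) ∧ Hits q (v k) := by
    intro k
    by_cases hk : k ∈ T
    · obtain ⟨q, hq⟩ := exists_hits_both (l := u k) (m := v k) fun e => h ⟨k, hk, e⟩
      exact ⟨q, fun _ => hq⟩
    · exact ⟨(true, true), fun h => absurd h hk⟩
  choose x hx using this
  exact ⟨x, fun k hk => (hx k hk).1, fun k hk => (hx k hk).2⟩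

theorem not_apart_of_in (hu : In T x u) (hv : In T x v) : ¬ Apart T u v :=
  fun h => h.not_in hu hv

theorem apart_of_not_in (h : ∀ x, In T x u → ¬ In T x v) : Apart T u v := by
  by_contra hn
  obtain ⟨x, hu, hv⟩ := exists_in_both hn
  exact h x hu hv

theorem not_apart_self : ¬ Apart T v v := fun ⟨_, _, h⟩ => neg_ne _ h.symm

theorem exists_in (T : Finset ι) (v : ι → Letter) : ∃ x, In T x v := by
  obtain ⟨x, hx, -⟩ := exists_in_both (not_apart_self (T := T) (v := v))
  exact ⟨x, hx⟩

theorem Code.eq_of_in (hU : Code T U) (hu : u ∈ U) (hv : v ∈ U) (hxu : In T x u)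
    (hxv : In T x v) : u = v := by
  by_contra hne
  exact (hU u hu v hv hne).not_in hxu hxv

theorem Apart.erase (h : Apart T u v) (hi : v i ≠ neg (u i)) : Apart (T.erase i) u v := by
  obtain ⟨k, hk, h⟩ := h
  exact ⟨k, Finset.mem_erase.2 ⟨fun e => hi (e ▸ h), hk⟩, h⟩

theorem Apart.of_erase (h : Apart (T.erase i) u v) : Apart T u v := by
  obtain ⟨k, hk, h⟩ := h
  exact ⟨k, Finset.mem_of_mem_erase hk, h⟩

theorem Same.of_erase (h : Same (T.erase i) u v) (hi : u i = v i) : Same T u v := by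
  intro k hk
  by_cases hki : k = i
  · rw [hki, hi]
  · exact h k (Finset.mem_erase.2 ⟨hki, hk⟩)

theorem Same.twin (h : Same (T.erase i) u v) (hiT : i ∈ T) (hi : v i = neg (u i)) : Twin T u v :=
  ⟨i, hiT, hi, fun j hj hji => (h j (Finset.mem_erase.2 ⟨hji, hj⟩)).symm⟩

theorem Twin.of_erase (h : Twin (T.erase i) u v) (hi : u i = v i) : Twin T u v := by
  obtain ⟨k, hk, h, h'⟩ := h
  refine ⟨k, Finset.mem_of_mem_erase hk, h, fun j hj hjk => ?_⟩
  by_cases hji : j = i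
  · rw [hji, hi]
  · exact h' j (Finset.mem_erase.2 ⟨hji, hj⟩) hjk

theorem Code.mono (hV : Code T V) (h : U ⊆ V) : Code T U :=
  fun u hu v hv => hV u (h hu) v (h hv)

theorem TwinFree.mono (hV : TwinFree T V) (h : U ⊆ V) : TwinFree T U :=
  fun u hu v hv => hV u (h hu) v (h hv)

theorem Code.erase (hV : Code T V) (h : ∀ u ∈ V, u k = l) : Code (T.erase k) V :=
  fun u hu v hv hne => (hV u hu v hv hne).erase (by
    rw [h u hu, h v hv]; exact (neg_ne l).symm)

theorem TwinFree.erase (hV : TwinFree T V) (h : ∀ u ∈ V, u k = l) : TwinFree (T.erase k) V :=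
  fun u hu v hv ht => hV u hu v hv (ht.of_erase (by rw [h u hu, h v hv]))

theorem slice_subset : slice V i l ⊆ V := Finset.filter_subset _ _

protected theorem Code.slice (hV : Code T V) : Code (T.erase k) (slice V k l) :=
  (hV.mono slice_subset).erase (l := l) fun _ hu => (mem_slice.1 hu).2

protected theorem TwinFree.slice (hV : TwinFree T V) : TwinFree (T.erase k) (slice V k l) :=
  (hV.mono slice_subset).erase (l := l) fun _ hu => (mem_slice.1 hu).2

/-- If a box is contained in another one, the two words agree. -/
theorem same_of_subset (h : ∀ x, In T x u → In T x v) : Same T u v := by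
  intro k hk
  by_contra hne
  obtain ⟨q, hq, hq'⟩ := exists_hits_not hne
  obtain ⟨x, hx⟩ := exists_in T u
  have := h (Function.update x k q) ((in_update hk).2 ⟨hx.erase, hq⟩)
  exact hq' ((in_update hk).1 this).2

/-- Two slices with letters of different kinds have disjoint shadows. -/
theorem Code.cross (hV : Code T V) (hlm : l.1 ≠ m.1) (hl : Cov (T.erase k) (slice V k l) x) :
    ¬ Cov (T.erase k) (slice V k m) x := by
  rintro ⟨v, hv, hxv⟩
  obtain ⟨u, hu, hxu⟩ := hl
  rw [mem_slice] at hu hv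
  have hne : u ≠ v := fun e => hlm (by rw [← hu.2, ← hv.2, e])
  refine ((hV u hu.1 v hv.1 hne).erase (i := k) ?_).not_in hxu hxv
  rw [hu.2, hv.2]
  intro e
  exact hlm (by rw [e, neg_fst])

theorem card_slice_add_le {l₁ l₂ : Letter} (h : l₁ ≠ l₂) :
    (slice V k l₁).card + (slice V k l₂).card ≤ V.card := by
  classical
  rw [← Finset.card_union_of_disjoint]
  · exact Finset.card_le_card (Finset.union_subset slice_subset slice_subset)
  · rw [Finset.disjoint_left]
    intro v h₁ h₂
    exact h ((mem_slice.1 h₁).2.symm.trans (mem_slice.1 h₂).2)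

theorem card_slices (hlm : l.1 ≠ m.1) :
    (slice V k l).card + (slice V k (neg l)).card + (slice V k m).card +
      (slice V k (neg m)).card = V.card := by
  classical
  have key : ∀ l m n : Letter, l.1 ≠ m.1 →
      (if n = l then 1 else 0) + (if n = neg l then 1 else 0) + (if n = m then 1 else 0) +
      (if n = neg m then 1 else 0) = 1 := by decide
  simp only [slice, Finset.card_filter, ← Finset.sum_add_distrib]
  rw [Finset.card_eq_sum_ones]
  exact Finset.sum_congr rfl fun v _ => key l m (v k) hlm

/-- A twin-free cover of a box by fewer than five boxes is trivial, locally inside a box `w`. -/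
def CoverProp (T : Finset ι) : Prop :=
  ∀ (U : Finset (ι → Letter)) (v w : ι → Letter), Code T U → TwinFree T U →
    (∀ u ∈ U, ¬ Apart T w u) → ¬ Apart T w v → (∀ x, In T x w → (In T x v ↔ Cov T U x)) →
    (∃ u ∈ U, Same T u v) ∨ 5 ≤ U.card

theorem letter_cross_eq {l m n : Letter} (h : l.1 ≠ n.1) (hm : m ≠ neg n) :
    m = l ∨ m = neg l ∨ m = n := by revert l m n; decide

theorem cover_cases (hk : k ∈ T) (hvk : v k = w k) (hUw : ∀ u ∈ U, ¬ Apart T w u)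
    (hcov : ∀ x, In T x w → (In T x v ↔ Cov T U x)) (hz : z.1 ≠ (w k).1)
    (hx : In (T.erase k) x w) :
    In (T.erase k) x v ↔
      Cov (T.erase k) (slice U k z) x ∨ Cov (T.erase k) (slice U k (w k)) x := by
  have hq : ∀ z n : Letter, z.1 ≠ n.1 → ∃ q, Hits q n ∧ Hits q z := by decide
  obtain ⟨q, hqw, hqz⟩ := hq z (w k) hz
  have h := hcov (Function.update x k q) ((in_update hk).2 ⟨hx, hqw⟩)
  rw [in_update hk, hvk] at h
  constructor
  · intro hv
    obtain ⟨u, hu, hxu⟩ := h.1 ⟨hv, hqw⟩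
    rw [in_update hk] at hxu
    rcases letter_cross_eq hz (fun e => hUw u hu ⟨k, hk, e⟩) with e | e | e
    · exact Or.inl ⟨u, mem_slice.2 ⟨hu, e⟩, hxu.1⟩
    · have := hxu.2
      rw [e, hits_neg] at this
      exact absurd hqz this
    · exact Or.inr ⟨u, mem_slice.2 ⟨hu, e⟩, hxu.1⟩
  · rintro (⟨u, hu, hxu⟩ | ⟨u, hu, hxu⟩) <;> rw [mem_slice] at hu <;>
      exact (h.2 ⟨u, hu.1, (in_update hk).2 ⟨hxu, by rw [hu.2]; assumption⟩⟩).1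

theorem not_apart_erase (h : ¬ Apart T u v) : ¬ Apart (T.erase k) u v := fun h' => h h'.of_erase

theorem cover_split (IH : CoverProp (T.erase k)) (hk : k ∈ T) (hU : Code T U)
    (hUt : TwinFree T U) (hUw : ∀ u ∈ U, ¬ Apart T w u) (hvw : ¬ Apart T w v)
    (hcov : ∀ x, In T x w → (In T x v ↔ Cov T U x)) (hvk : v k = w k)
    (hu : u ∈ U) (huk : u k ≠ w k) :
    6 ≤ U.card ∨ ((slice U k (w k)).Nonempty ∧
      ∀ z : Letter, z.1 ≠ (w k).1 → 2 ≤ (slice U k z).card) := by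
  have hUw' : ∀ z, ∀ u ∈ slice U k z, ¬ Apart (T.erase k) w u :=
    fun z u hu => not_apart_erase (hUw u (mem_slice.1 hu).1)
  have hcase := fun z hz x hx => cover_cases (x := x) (z := z) hk hvk hUw hcov hz hx
  have hflip : ∀ z : Letter, z.1 ≠ (w k).1 → ∀ x, In (T.erase k) x w →
      (Cov (T.erase k) (slice U k z) x ↔ Cov (T.erase k) (slice U k (neg z)) x) := by
    intro z hz x hx
    have h₁ := hcase z hz x hx
    have h₂ := hcase (neg z) hz x hx
    have h₃ := hU.cross (k := k) (x := x) hz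
    have h₄ := hU.cross (k := k) (x := x) (l := neg z) hz
    tauto
  have hne : ∀ z : Letter, z.1 ≠ (w k).1 → (slice U k z).Nonempty →
      (slice U k (neg z)).Nonempty := by
    rintro z hz ⟨p, hp⟩
    obtain ⟨x, hxw, hxp⟩ := exists_in_both (hUw' z p hp)
    obtain ⟨p', hp', -⟩ := (hflip z hz x hxw).1 ⟨p, hp, hxp⟩
    exact ⟨p', hp'⟩
  have hz₀ : (u k).1 ≠ (w k).1 := by
    intro e
    rcases eq_or_eq_neg e with e | e
    · exact huk e
    · exact hUw u hu ⟨k, hk, e⟩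
  have hnon : ∀ z : Letter, z.1 ≠ (w k).1 → (slice U k z).Nonempty := by
    have h₀ : (slice U k (u k)).Nonempty := ⟨u, mem_slice.2 ⟨hu, rfl⟩⟩
    have hkey : ∀ z n m : Letter, z.1 ≠ n.1 → m.1 ≠ n.1 → z.1 = m.1 := by decide
    intro z hz
    rcases eq_or_eq_neg (hkey z (w k) (u k) hz hz₀) with e | e
    · rwa [e]
    · rw [e]; exact hne _ hz₀ h₀
  have htwin : ∀ z, ∀ p ∈ slice U k z, ∀ p' ∈ slice U k (neg z), ¬ Same (T.erase k) p p' := by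
    intro z p hp p' hp' hs
    rw [mem_slice] at hp hp'
    exact hUt p hp.1 p' hp'.1 (hs.twin hk (by rw [hp.2, hp'.2]))
  rcases (slice U k (w k)).eq_empty_or_nonempty with he | hn
  · left
    have hbox : ∀ z : Letter, z.1 ≠ (w k).1 →
        (∃ p ∈ slice U k z, Same (T.erase k) p v) ∨ 5 ≤ (slice U k z).card := by
      intro z hz
      refine IH _ v w hU.slice hUt.slice (hUw' z) (not_apart_erase hvw) fun x hx => ?_
      rw [hcase z hz x hx, he]
      simp [Cov]
    have h₁ := hbox (u k) hz₀
    have h₂ := hbox (neg (u k)) hz₀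
    have h₃ := (hnon (u k) hz₀).card_pos
    have h₄ := (hnon (neg (u k)) hz₀).card_pos
    have h₅ := card_slice_add_le (V := U) (k := k) (neg_ne (u k))
    rcases h₁ with ⟨p, hp, hs⟩ | h₁
    · rcases h₂ with ⟨p', hp', hs'⟩ | h₂
      · exact absurd (hs.trans hs'.symm) (htwin _ p hp p' hp')
      · omega
    · omega
  · have hpair : ∀ z : Letter, z.1 ≠ (w k).1 → (slice U k z).card < 2 → 6 ≤ U.card := by
      intro z hz hc
      have h₁ := (hnon z hz).card_pos
      obtain ⟨p, hp⟩ := Finset.card_eq_one.1 (show (slice U k z).card = 1 by omega)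
      have hpm : p ∈ slice U k z := by simp [hp]
      have h₅ := card_slice_add_le (V := U) (k := k) (neg_ne z)
      rcases IH (slice U k (neg z)) p w hU.slice hUt.slice (hUw' _) (hUw' z p hpm)
        (fun x hx => by rw [← hflip z hz x hx, hp]; simp [Cov]) with ⟨p', hp', hs⟩ | h
      · exact absurd hs.symm (htwin z p hpm p' hp')
      · omega
    by_cases h6 : 6 ≤ U.card
    · exact Or.inl h6
    · exact Or.inr ⟨hn, fun z hz => by
        by_contra hc
        exact h6 (hpair z hz (by omega))⟩

theorem same_of_local_subset (hvw : ¬ Apart T w u) (h : ∀ x, In T x w → In T x u → In T x v)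
    (hk : k ∈ T) (hne : v k ≠ w k) : u k = v k := by
  by_contra hne'
  have hkey : ∀ u v w : Letter, u ≠ neg w → v ≠ w → u ≠ v →
      ∃ q, Hits q w ∧ Hits q u ∧ ¬ Hits q v := by decide
  obtain ⟨q, hq, hq', hq''⟩ := hkey (u k) (v k) (w k) (fun e => hvw ⟨k, hk, e⟩) hne hne'
  obtain ⟨x, hxw, hxu⟩ := exists_in_both hvw
  have := h (Function.update x k q) ((in_update hk).2 ⟨hxw.erase, hq⟩)
    ((in_update hk).2 ⟨hxu.erase, hq'⟩)
  exact hq'' ((in_update hk).1 this).2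

theorem coverProp (T : Finset ι) : CoverProp T := by
  induction T using Finset.strongInduction with
  | H T IH =>
    intro U v w hU hUt hUw hvw hcov
    have hsub : ∀ u ∈ U, ∀ x, In T x w → In T x u → In T x v :=
      fun u hu x hxw hxu => (hcov x hxw).2 ⟨u, hu, hxu⟩
    obtain ⟨x, hxw, hxv⟩ := exists_in_both hvw
    obtain ⟨u₀, hu₀, -⟩ := (hcov x hxw).1 hxv
    by_cases hc : ∃ k ∈ T, v k = w k ∧ u₀ k ≠ w k
    · obtain ⟨k, hk, hvk, huk⟩ := hc
      right
      rcases cover_split (IH _ (Finset.erase_ssubset hk)) hk hU hUt hUw hvw hcov hvk hu₀ huk with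
        h | ⟨h₁, h₂⟩
      · omega
      · have hz : ∃ z : Letter, z.1 ≠ (w k).1 := ⟨(!(w k).1, true), by simp⟩
        obtain ⟨z, hz⟩ := hz
        have h₃ := h₂ z hz
        have h₄ := h₂ (neg z) hz
        have h₅ := h₁.card_pos
        have h₆ := card_slices (V := U) (k := k) hz
        omega
    · push Not at hc
      refine Or.inl ⟨u₀, hu₀, fun k hk => ?_⟩
      by_cases hvk : v k = w k
      · rw [hc k hk hvk, hvk]
      · exact same_of_local_subset (hUw u₀ hu₀) (hsub u₀ hu₀) hk hvk

/-- A box that is covered, inside `w`, exactly by a twin-free code either is one of its words or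
needs at least five words. -/
theorem cover (hU : Code T U) (hUt : TwinFree T U) (hvw : ¬ Apart T w v)
    (hcov : ∀ x, In T x w → (In T x v ↔ Cov T U x)) :
    (∃ u ∈ U, Same T u v ∧ ∀ u' ∈ U, ¬ Apart T w u' → u' = u) ∨ 5 ≤ U.card := by
  classical
  set U' := U.filter fun u => ¬ Apart T w u with hU'
  have hs : U' ⊆ U := Finset.filter_subset _ _
  have hcov' : ∀ x, In T x w → (In T x v ↔ Cov T U' x) := by
    intro x hx
    rw [hcov x hx]
    constructor
    · rintro ⟨u, hu, hxu⟩
      exact ⟨u, Finset.mem_filter.2 ⟨hu, not_apart_of_in hx hxu⟩, hxu⟩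
    · rintro ⟨u, hu, hxu⟩
      exact ⟨u, hs hu, hxu⟩
  rcases coverProp T U' v w (hU.mono hs) (hUt.mono hs) (fun u hu => (Finset.mem_filter.1 hu).2)
    hvw hcov' with ⟨u, hu, hsame⟩ | h
  · refine Or.inl ⟨u, hs hu, hsame, fun u' hu' ha => ?_⟩
    obtain ⟨x, hxw, hxu'⟩ := exists_in_both ha
    exact hU.eq_of_in hu' (hs hu) hxu'
      (hsame.in_iff.2 ((hcov x hxw).2 ⟨u', hu', hxu'⟩))
  · exact Or.inr (h.trans (Finset.card_le_card hs))

/-- The words of `V` with letter `l` at `i` contain `x` when position `i` is ignored. -/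
def Shadow (T : Finset ι) (V : Finset (ι → Letter)) (i : ι) (l : Letter) (x : ι → Coord) : Prop :=
  Cov (T.erase i) (slice V i l) x

/-- A twin-free code `V` and a code `W`, equivalent on `T` and without a common word. -/
structure Rival (T : Finset ι) (V W : Finset (ι → Letter)) : Prop where
  codeV : Code T V
  codeW : Code T W
  twinFree : TwinFree T V
  equiv : ∀ x, Cov T V x ↔ Cov T W x
  disj : ∀ v ∈ V, ∀ w ∈ W, ¬ Same T v w

/-- A twin-free code with at most eleven words is determined by its realization. -/
def RigidProp (T : Finset ι) : Prop :=
  ∀ V W : Finset (ι → Letter), Code T V → TwinFree T V → Code T W →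
    (∀ x, Cov T V x ↔ Cov T W x) → V.card ≤ 11 →
    (∀ v ∈ V, ∃ w ∈ W, Same T v w) ∧ ∀ w ∈ W, ∃ v ∈ V, Same T v w

theorem hits_unique {q : Coord} (hl : Hits q l) (hm : Hits q m) (h : l.1 = m.1) : l = m := by
  revert q l m; decide

theorem cov_update {q : Coord} (hi : i ∈ T) (hlm : l.1 ≠ m.1) (hl : Hits q l) (hm : Hits q m) :
    Cov T V (Function.update x i q) ↔ Shadow T V i l x ∨ Shadow T V i m x := by
  have hkind : ∀ l m n : Letter, l.1 ≠ m.1 → n.1 = l.1 ∨ n.1 = m.1 := by decide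
  constructor
  · rintro ⟨v, hv, hx⟩
    rw [in_update hi] at hx
    rcases hkind l m (v i) hlm with e | e
    · exact Or.inl ⟨v, mem_slice.2 ⟨hv, hits_unique hx.2 hl e⟩, hx.1⟩
    · exact Or.inr ⟨v, mem_slice.2 ⟨hv, hits_unique hx.2 hm e⟩, hx.1⟩
  · rintro (⟨v, hv, hx⟩ | ⟨v, hv, hx⟩) <;> rw [mem_slice] at hv <;>
      exact ⟨v, hv.1, (in_update hi).2 ⟨hx, by rw [hv.2]; assumption⟩⟩

theorem exists_hits_cross {l m : Letter} (h : l.1 ≠ m.1) : ∃ q, Hits q l ∧ Hits q m := by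
  revert l m; decide

theorem Rival.shadow_or (h : Rival T V W) (hi : i ∈ T) (hlm : l.1 ≠ m.1) (x : ι → Coord) :
    Shadow T V i l x ∨ Shadow T V i m x ↔ Shadow T W i l x ∨ Shadow T W i m x := by
  obtain ⟨q, hl, hm⟩ := exists_hits_cross hlm
  rw [← cov_update hi hlm hl hm, ← cov_update hi hlm hl hm, h.equiv]

theorem Rival.gain_iff (h : Rival T V W) (hi : i ∈ T) (hlm : l.1 ≠ m.1) (x : ι → Coord) :
    (Shadow T V i l x ∧ ¬ Shadow T W i l x) ↔ (Shadow T W i m x ∧ ¬ Shadow T V i m x) := by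
  have h₁ := h.shadow_or hi hlm x
  have h₂ : Shadow T V i l x → ¬ Shadow T V i m x := h.codeV.cross hlm
  have h₃ : Shadow T W i l x → ¬ Shadow T W i m x := h.codeW.cross hlm
  tauto

theorem exists_cross (l : Letter) : ∃ m : Letter, l.1 ≠ m.1 := ⟨(!l.1, true), by simp⟩

theorem Rival.gain_neg (h : Rival T V W) (hi : i ∈ T) (x : ι → Coord) :
    (Shadow T V i l x ∧ ¬ Shadow T W i l x) ↔
      (Shadow T V i (neg l) x ∧ ¬ Shadow T W i (neg l) x) := by
  obtain ⟨m, hm⟩ := exists_cross l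
  rw [h.gain_iff hi hm, h.gain_iff hi (l := neg l) hm]

theorem code_union [DecidableEq (ι → Letter)] (hU : Code T U) (hV : Code T V)
    (h : ∀ x, Cov T U x → ¬ Cov T V x) : Code T (U ∪ V) := by
  have hUV : ∀ u ∈ U, ∀ v ∈ V, Apart T u v := fun u hu v hv =>
    apart_of_not_in fun x hxu hxv => h x ⟨u, hu, hxu⟩ ⟨v, hv, hxv⟩
  intro u hu v hv hne
  rcases Finset.mem_union.1 hu with hu | hu <;> rcases Finset.mem_union.1 hv with hv | hv
  · exact hU u hu v hv hne
  · exact hUV u hu v hv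
  · exact (hUV v hv u hu).symm
  · exact hV u hu v hv hne

theorem cov_union [DecidableEq (ι → Letter)] : Cov T (U ∪ V) x ↔ Cov T U x ∨ Cov T V x := by
  simp only [Cov, Finset.mem_union, or_and_right, exists_or]

theorem Rival.not_same_neg (h : Rival T V W) (hi : i ∈ T) (hu : u ∈ slice V i l)
    (hv : v ∈ slice V i (neg l)) : ¬ Same (T.erase i) u v := by
  intro hs
  rw [mem_slice] at hu hv
  exact h.twinFree u hu.1 v hv.1 (hs.twin hi (by rw [hu.2, hv.2]))

theorem Rival.not_same_slice (h : Rival T V W) (hv : v ∈ slice V i l) (hw : w ∈ slice W i l) :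
    ¬ Same (T.erase i) v w := by
  intro hs
  rw [mem_slice] at hv hw
  exact h.disj v hv.1 w hw.1 (hs.of_erase (by rw [hv.2, hw.2]))

theorem Rival.slice_nonempty_right (h : Rival T V W) (hi : i ∈ T) (hR : RigidProp (T.erase i))
    (hc : ∀ l, (slice V i l).card ≤ 11) (hl : (slice V i l).Nonempty) :
    (slice W i l).Nonempty := by
  classical
  obtain ⟨v, hv⟩ := hl
  by_contra hne
  rw [Finset.not_nonempty_iff_eq_empty] at hne
  have hQ : ∀ x, ¬ Shadow T W i l x := by simp [Shadow, Cov, hne]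
  have hg := fun x => h.gain_neg (l := l) hi x
  obtain ⟨u, hu, hs⟩ := (hR (slice V i (neg l)) (slice V i l ∪ slice W i (neg l)) h.codeV.slice
    h.twinFree.slice (code_union h.codeV.slice h.codeW.slice fun x hx =>
      ((hg x).1 ⟨hx, hQ x⟩).2) (fun x => by
        rw [cov_union]
        have h₁ := hg x
        have h₂ := hQ x
        change Shadow T V i (neg l) x ↔ Shadow T V i l x ∨ Shadow T W i (neg l) x
        obtain ⟨m, hm⟩ := exists_cross l
        have h₃ := h.shadow_or (l := neg l) hi hm x
        have h₄ := h.shadow_or hi hm x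
        have h₅ : Shadow T W i (neg l) x → ¬ Shadow T W i m x := h.codeW.cross hm
        have h₆ : Shadow T V i l x → ¬ Shadow T V i m x := h.codeV.cross hm
        tauto) (hc _)).2 v (Finset.mem_union_left _ hv)
  exact h.not_same_neg hi hv hu hs.symm

theorem Rival.slice_nonempty_left (h : Rival T V W) (hi : i ∈ T) (hR : RigidProp (T.erase i))
    (hc : ∀ l, (slice V i l).card ≤ 11) (hl : (slice W i l).Nonempty) :
    (slice V i l).Nonempty := by
  classical
  obtain ⟨w, hw⟩ := hl
  by_contra hne
  rw [Finset.not_nonempty_iff_eq_empty] at hne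
  have hP : ∀ x, ¬ Shadow T V i l x := by simp [Shadow, Cov, hne]
  have key : ∀ m : Letter, l.1 ≠ m.1 → ∃ v ∈ slice V i m, Same (T.erase i) v w := by
    intro m hm
    refine (hR (slice V i m) (slice W i l ∪ slice W i m) h.codeV.slice
      h.twinFree.slice (code_union h.codeW.slice h.codeW.slice fun x hx =>
        h.codeW.cross hm hx) (fun x => ?_) (hc _)).2 w (Finset.mem_union_left _ hw)
    rw [cov_union]
    have h₁ := h.shadow_or hi hm x
    have h₂ := hP x
    change Shadow T V i m x ↔ Shadow T W i l x ∨ Shadow T W i m x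
    tauto
  obtain ⟨m, hm⟩ := exists_cross l
  obtain ⟨v, hv, hs⟩ := key m hm
  obtain ⟨v', hv', hs'⟩ := key (neg m) hm
  exact h.not_same_neg hi hv hv' (hs.trans hs'.symm)

theorem Rival.slice_nonempty (h : Rival T V W) (hi : i ∈ T) (hR : RigidProp (T.erase i))
    (hc : ∀ l, (slice V i l).card ≤ 11) (hV : V.Nonempty) (l : Letter) :
    (slice V i l).Nonempty ∧ (slice W i l).Nonempty := by
  have spread : ∀ l m : Letter, l.1 ≠ m.1 → (slice V i l).Nonempty → (slice V i m).Nonempty := by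
    rintro l m hlm ⟨v, hv⟩
    by_contra hm
    have hm' : ¬ (slice W i m).Nonempty := fun hW => hm (h.slice_nonempty_left hi hR hc hW)
    rw [Finset.not_nonempty_iff_eq_empty] at hm hm'
    obtain ⟨w, hw, hs⟩ := (hR (slice V i l) (slice W i l) h.codeV.slice h.twinFree.slice
      h.codeW.slice (fun x => by
        have h₁ := h.shadow_or hi hlm x
        simpa [Shadow, Cov, hm, hm'] using h₁) (hc _)).1 v hv
    exact h.not_same_slice hv hw hs
  have hl : (slice V i l).Nonempty := by
    obtain ⟨v, hv⟩ := hV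
    have hv' : (slice V i (v i)).Nonempty := ⟨v, mem_slice.2 ⟨hv, rfl⟩⟩
    by_cases e : (v i).1 = l.1
    · obtain ⟨m, hm⟩ := exists_cross (v i)
      exact spread m l (e ▸ hm.symm) (spread _ m hm hv')
    · exact spread _ l e hv'
  exact ⟨hl, h.slice_nonempty_right hi hR hc hl⟩

theorem Rival.five_le_of_no_gain (h : Rival T V W) (hi : i ∈ T) (hW : (slice W i m).Nonempty)
    (hlm : l.1 ≠ m.1) (hg : ∀ x, ¬ (Shadow T V i l x ∧ ¬ Shadow T W i l x)) :
    5 ≤ (slice V i m).card := by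
  obtain ⟨w, hw⟩ := hW
  rcases cover (w := w) (v := w) (h.codeV.slice (k := i) (l := m)) h.twinFree.slice not_apart_self
    (fun x hx => iff_of_true hx (by
      have h₁ := h.gain_iff hi hlm x
      have h₂ := hg x
      have h₃ : Shadow T W i m x := ⟨w, hw, hx⟩
      change Shadow T V i m x
      tauto)) with ⟨u, hu, hs, -⟩ | h5
  · exact absurd hs (h.not_same_slice hu hw)
  · exact h5

/-- Inside the shadow of a word of `W` with a crossing letter, the shadows of `l` and `neg l`
coincide and are complementary to the shadow of the crossing letter. -/
theorem Rival.local_iff (h : Rival T V W) (hi : i ∈ T) (hlm : l.1 ≠ m.1) (hw : w ∈ slice W i m)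
    (hx : In (T.erase i) x w) :
    (Shadow T V i l x ↔ Shadow T V i (neg l) x) ∧ (Shadow T V i l x ∨ Shadow T V i m x) := by
  have h₀ : Shadow T W i m x := ⟨w, hw, hx⟩
  have h₁ := h.gain_neg (l := l) hi x
  have h₂ : Shadow T W i l x → ¬ Shadow T W i m x := h.codeW.cross hlm
  have h₃ : Shadow T W i (neg l) x → ¬ Shadow T W i m x := h.codeW.cross hlm
  have h₄ := h.shadow_or hi hlm x
  tauto

theorem Rival.five_le_of_card_eq_one (h : Rival T V W) (hi : i ∈ T) (hlm : l.1 ≠ m.1)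
    (hw : w ∈ slice W i m) (hxw : In (T.erase i) x w) (hx : Shadow T V i l x)
    (h1 : (slice V i l).card = 1) : 5 ≤ (slice V i (neg l)).card := by
  obtain ⟨v, hv⟩ := Finset.card_eq_one.1 h1
  have hvm : v ∈ slice V i l := by simp [hv]
  have hP : ∀ x, Shadow T V i l x ↔ In (T.erase i) x v := by simp [Shadow, Cov, hv]
  rcases cover (w := w) (v := v) (h.codeV.slice (k := i) (l := neg l)) h.twinFree.slice
    (not_apart_of_in hxw ((hP x).1 hx)) (fun x hx => by
      rw [← hP]; exact (h.local_iff hi hlm hw hx).1) with ⟨u, hu, hs, -⟩ | h5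
  · exact absurd hs.symm (h.not_same_neg hi hvm hu)
  · exact h5

/-- The rival code gains at every letter of position `i`. -/
def Gains (T : Finset ι) (V W : Finset (ι → Letter)) (i : ι) : Prop :=
  ∀ l, (slice V i l).Nonempty ∧ ∃ x, Shadow T V i l x ∧ ¬ Shadow T W i l x

theorem Rival.gains (h : Rival T V W) (hi : i ∈ T) (hR : RigidProp (T.erase i))
    (hV : V.Nonempty) (hc : V.card ≤ 11) : Gains T V W i := by
  have hn := h.slice_nonempty hi hR
    (fun l => (Finset.card_le_card slice_subset).trans hc) hV
  refine fun l => ⟨(hn l).1, ?_⟩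
  by_contra hg
  push Not at hg
  obtain ⟨m, hm⟩ := exists_cross l
  have h₁ := h.five_le_of_no_gain hi (hn m).2 hm (fun x hx => hx.2 (hg x hx.1))
  have h₂ := h.five_le_of_no_gain hi (hn (neg m)).2 hm (fun x hx => hx.2 (hg x hx.1))
  have h₃ := (hn l).1.card_pos
  have h₄ := (hn (neg l)).1.card_pos
  have h₅ := card_slices (V := V) (k := i) hm
  omega

theorem Rival.exists_word_of_gain (h : Rival T V W) (hi : i ∈ T) (hlm : l.1 ≠ m.1)
    (hx : Shadow T V i l x ∧ ¬ Shadow T W i l x) :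
    ∃ w ∈ slice W i m, In (T.erase i) x w :=
  ((h.gain_iff hi hlm x).1 hx).1

theorem Rival.pair_card (h : Rival T V W) (hi : i ∈ T) (hg : Gains T V W i) (l : Letter) :
    6 ≤ (slice V i l).card + (slice V i (neg l)).card ∨
      2 ≤ (slice V i l).card ∧ 2 ≤ (slice V i (neg l)).card := by
  have key : ∀ l, (slice V i l).card = 1 → 5 ≤ (slice V i (neg l)).card := by
    intro l h1
    obtain ⟨x, hx⟩ := (hg l).2
    obtain ⟨m, hm⟩ := exists_cross l
    obtain ⟨w, hw, hxw⟩ := h.exists_word_of_gain hi hm hx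
    exact h.five_le_of_card_eq_one hi hm hw hxw hx.1 h1
  have h₁ := key l
  have h₂ := key (neg l)
  rw [neg_neg] at h₂
  have h₃ := (hg l).1.card_pos
  have h₄ := (hg (neg l)).1.card_pos
  omega

/-- The number of words of `V` whose letter at `i` is of the given kind. -/
def kindCard (V : Finset (ι → Letter)) (i : ι) (t : Bool) : ℕ :=
  (V.filter fun v => (v i).1 = t).card

theorem kindCard_eq (l : Letter) :
    kindCard V i l.1 = (slice V i l).card + (slice V i (neg l)).card := by
  have key : ∀ l n : Letter, (if n.1 = l.1 then 1 else 0) =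
      (if n = l then 1 else 0) + (if n = neg l then 1 else 0) := by decide
  simp only [kindCard, slice, Finset.card_filter, ← Finset.sum_add_distrib]
  exact Finset.sum_congr rfl fun v _ => key l (v i)

theorem kindCard_add : kindCard V i true + kindCard V i false = V.card := by
  rw [← card_slices (V := V) (k := i) (l := (true, true)) (m := (false, true)) (by decide),
    ← kindCard_eq (true, true), add_assoc, ← kindCard_eq (false, true)]

theorem Rival.kindCard_le (h : Rival T V W) (hi : i ∈ T) (hg : Gains T V W i)
    (hc : V.card ≤ 11) (t : Bool) : kindCard V i t ≤ 7 := by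
  have key : ∀ t, 4 ≤ kindCard V i t := by
    intro t
    rw [show t = ((t, true) : Letter).1 from rfl, kindCard_eq]
    have := h.pair_card hi hg (t, true)
    omega
  have h₁ := key true
  have h₂ := key false
  have h₃ := kindCard_add (V := V) (i := i)
  cases t <;> omega

theorem Rival.exists_small (h : Rival T V W) (hi : i ∈ T) (hg : Gains T V W i)
    (hc : V.card ≤ 11) : ∃ l, (slice V i l).card = 2 ∧ (slice V i (neg l)).card ≤ 3 := by
  have key : ∀ l, (slice V i l).card + (slice V i (neg l)).card ≤ 5 →
      ∃ l, (slice V i l).card = 2 ∧ (slice V i (neg l)).card ≤ 3 := by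
    intro l hl
    have := h.pair_card hi hg l
    by_cases h2 : (slice V i l).card = 2
    · exact ⟨l, h2, by omega⟩
    · exact ⟨neg l, by omega, by rw [neg_neg]; omega⟩
  have h₁ := card_slices (V := V) (k := i) (l := (true, true)) (m := (false, true)) (by decide)
  by_cases h₂ : (slice V i (true, true)).card + (slice V i (neg (true, true))).card ≤ 5
  · exact key _ h₂
  · exact key (false, true) (by omega)

theorem same_of_local_eq (hu : ¬ Apart T w u) (hv : ¬ Apart T w v)
    (h : ∀ x, In T x w → (In T x u ↔ In T x v)) : Same T u v := by
  intro k hk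
  by_cases hvk : v k = w k
  · by_cases huk : u k = w k
    · rw [huk, hvk]
    · exact (same_of_local_subset hv (fun x hx => (h x hx).2) hk huk).symm
  · exact same_of_local_subset hu (fun x hx => (h x hx).1) hk hvk

theorem eq_of_cross {l m n : Letter} (hl : m ≠ neg l) (hn : m ≠ neg n) (h : l.1 ≠ n.1) :
    m = l ∨ m = n := by revert l m n; decide

theorem fst_ne_of {l m : Letter} (h : l ≠ m) (h' : l ≠ neg m) : l.1 ≠ m.1 := by
  revert l m; decide

theorem two_boxes {c : ι → Letter} (hcu : Apart T c u) (hc : ¬ Apart T w c) (hu : ¬ Apart T w u)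
    (h : ∀ x, In T x w → (In T x v ↔ In T x c ∨ In T x u)) :
    ∃ k ∈ T, v k = w k ∧ (c k).1 ≠ (w k).1 ∧ ∀ j ∈ T, j ≠ k → c j = v j := by
  obtain ⟨k, hk, hcuk⟩ := hcu
  have hck : c k ≠ neg (w k) := fun e => hc ⟨k, hk, e⟩
  have huk : u k ≠ neg (w k) := fun e => hu ⟨k, hk, e⟩
  have hvk : v k = w k := by
    by_contra hne
    have h₁ := same_of_local_subset hc (fun x hx hxc => (h x hx).2 (Or.inl hxc)) hk hne
    have h₂ := same_of_local_subset hu (fun x hx hxu => (h x hx).2 (Or.inr hxu)) hk hne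
    rw [h₁, h₂] at hcuk
    exact neg_ne _ hcuk.symm
  have hcw : (c k).1 ≠ (w k).1 := by
    rw [hcuk] at huk
    exact fst_ne_of (fun e => huk (by rw [e])) hck
  refine ⟨k, hk, hvk, hcw, fun j hj hjk => ?_⟩
  by_cases hvj : v j = w j
  · by_contra hne
    obtain ⟨q, hq, hq'⟩ := exists_hits_not (show w j ≠ c j by rw [← hvj]; exact Ne.symm hne)
    obtain ⟨x, hxw, hxc⟩ := exists_in_both hc
    have hxv := (h x hxw).2 (Or.inl hxc)
    have hx' : In T (Function.update x j q) w := (in_update hj).2 ⟨hxw.erase, hq⟩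
    rcases (h _ hx').1 ((in_update hj).2 ⟨hxv.erase, by rwa [hvj]⟩) with h₁ | h₁
    · exact hq' ((in_update hj).1 h₁).2
    · have := h₁ k hk
      rw [Function.update_of_ne hjk.symm, hcuk, hits_neg] at this
      exact this (hxc k hk)
  · exact same_of_local_subset hc (fun x hx hxc => (h x hx).2 (Or.inl hxc)) hj hvj

/-- The dichotomous words `v₁` and `v₂` cover the same part of `w` as the code `U`, and the
code `X` covers the rest of `w`. -/
structure Fork (T : Finset ι) (U X : Finset (ι → Letter)) (v₁ v₂ w : ι → Letter) : Prop where
  apart : Apart T v₁ v₂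
  not_twin : ¬ Twin T v₁ v₂
  codeU : Code T U
  twinFreeU : TwinFree T U
  card_le : U.card ≤ 3
  not_same₁ : ∀ u ∈ U, ¬ Same T u v₁
  not_same₂ : ∀ u ∈ U, ¬ Same T u v₂
  cov : ∀ x, In T x w → (In T x v₁ ∨ In T x v₂ ↔ Cov T U x)
  meets : ¬ Apart T w v₁ ∨ ¬ Apart T w v₂
  codeX : Code T X
  twinFreeX : TwinFree T X
  apart₁ : ∀ f ∈ X, Apart T f v₁
  apart₂ : ∀ f ∈ X, Apart T f v₂
  cov_or : ∀ x, In T x w → In T x v₁ ∨ In T x v₂ ∨ Cov T X x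

/-- The words cross at `k` and agree elsewhere. -/
def Crossing (T : Finset ι) (k : ι) (u v : ι → Letter) : Prop :=
  k ∈ T ∧ (u k).1 ≠ (v k).1 ∧ Same (T.erase k) u v

theorem Crossing.symm (h : Crossing T k u v) : Crossing T k v u :=
  ⟨h.1, h.2.1.symm, h.2.2.symm⟩

section
variable {X : Finset (ι → Letter)} {v₁ v₂ : ι → Letter} {j : ι}

theorem Fork.symm (h : Fork T U X v₁ v₂ w) : Fork T U X v₂ v₁ w where
  apart := h.apart.symm
  not_twin ht := h.not_twin ht.symm
  codeU := h.codeU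
  twinFreeU := h.twinFreeU
  card_le := h.card_le
  not_same₁ := h.not_same₂
  not_same₂ := h.not_same₁
  cov x hx := by rw [or_comm, h.cov x hx]
  meets := h.meets.symm
  codeX := h.codeX
  twinFreeX := h.twinFreeX
  apart₁ := h.apart₂
  apart₂ := h.apart₁
  cov_or x hx := by have := h.cov_or x hx; tauto

theorem Fork.meets₁ (h : Fork T U X v₁ v₂ w) : ¬ Apart T w v₁ := by
  intro ha
  have h₂ : ¬ Apart T w v₂ := h.meets.resolve_left (not_not.2 ha)
  rcases cover h.codeU h.twinFreeU h₂ (fun x hx => by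
    rw [← h.cov x hx]
    exact (or_iff_right (ha.not_in hx)).symm) with ⟨u, hu, hs, -⟩ | h5
  · exact h.not_same₂ u hu hs
  · have := h.card_le
    omega

theorem Fork.meets₂ (h : Fork T U X v₁ v₂ w) : ¬ Apart T w v₂ := h.symm.meets₁

theorem neg_eq_comm {l m : Letter} (h : m = neg l) : l = neg m := by rw [h, neg_neg]

theorem Fork.cross (h : Fork T U X v₁ v₂ w) (hj : j ∈ T) (hv : v₂ j = neg (v₁ j)) :
    (w j).1 ≠ (v₁ j).1 :=
  fst_ne_of (fun e => h.meets₂ ⟨j, hj, by rw [hv, e]⟩)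
    fun e => h.meets₁ ⟨j, hj, neg_eq_comm e⟩

theorem Fork.local_iff (h : Fork T U X v₁ v₂ w) (hj : j ∈ T) (hv : v₂ j = neg (v₁ j))
    (hx : In (T.erase j) x w) :
    In (T.erase j) x v₁ ↔ Cov (T.erase j) (slice U j (v₁ j)) x ∨
      Cov (T.erase j) (slice U j (w j)) x := by
  have hc := h.cross hj hv
  obtain ⟨q, hqw, hq₁⟩ := exists_hits_cross hc
  have h₁ := h.cov (Function.update x j q) ((in_update hj).2 ⟨hx, hqw⟩)
  rw [in_update hj, in_update hj, cov_update hj hc.symm hq₁ hqw, hv, hits_neg] at h₁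
  unfold Shadow at h₁
  tauto

theorem Fork.card_slices_le (h : Fork T U X v₁ v₂ w) (hj : j ∈ T) (hv : v₂ j = neg (v₁ j)) :
    (slice U j (v₁ j)).card + (slice U j (v₂ j)).card + (slice U j (w j)).card ≤ 3 := by
  have h₁ := card_slices (V := U) (k := j) (h.cross hj hv).symm
  have h₂ := h.card_le
  rw [hv]
  omega

theorem Fork.not_same (h : Fork T U X v₁ v₂ w) (hj : j ∈ T) (hv : v₂ j = neg (v₁ j)) :
    ¬ Same (T.erase j) v₁ v₂ := fun hs => h.not_twin (hs.twin hj hv)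

theorem Fork.exists_common (h : Fork T U X v₁ v₂ w) (hj : j ∈ T) (hv : v₂ j = neg (v₁ j)) :
    ∃ x, In (T.erase j) x w ∧ Cov (T.erase j) (slice U j (w j)) x := by
  by_contra hno
  push Not at hno
  rcases cover (w := w) (v := v₁) (h.codeU.slice (k := j) (l := v₁ j)) h.twinFreeU.slice
    (not_apart_erase h.meets₁) (fun x hx => by
      rw [h.local_iff hj hv hx]
      exact or_iff_left (hno x hx)) with ⟨u, hu, hs, -⟩ | h5
  · rw [mem_slice] at hu
    exact h.not_same₁ u hu.1 (hs.of_erase hu.2)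
  · have := h.card_slices_le hj hv
    omega

/-- If no word of `U` with letter `v₂ j` meets `w`, some word has all other letters of `v₂`. -/
theorem Fork.exists_same (h : Fork T U X v₁ v₂ w) (hj : j ∈ T) (hv : v₂ j = neg (v₁ j))
    (hB : ∀ x, In (T.erase j) x w → ¬ Cov (T.erase j) (slice U j (v₂ j)) x) :
    ∃ c ∈ slice U j (w j), Same (T.erase j) c v₂ := by
  have hloc := fun x hx => h.symm.local_iff (x := x) hj (neg_eq_comm hv) hx
  rcases cover (w := w) (v := v₂) (h.codeU.slice (k := j) (l := w j)) h.twinFreeU.slice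
    (not_apart_erase h.meets₂) (fun x hx => by
      rw [hloc x hx]
      exact or_iff_right (hB x hx)) with ⟨u, hu, hs, -⟩ | h5
  · exact ⟨u, hu, hs⟩
  · have := h.card_slices_le hj hv
    omega

theorem Fork.crossing_of_subset (h : Fork T U X v₁ v₂ w) (hj : j ∈ T) (hv : v₂ j = neg (v₁ j))
    (hB : ∀ x, In (T.erase j) x w → ¬ Cov (T.erase j) (slice U j (v₂ j)) x)
    (hA : (slice U j (v₁ j)).card ≤ 1) : ∃ k, Crossing (T.erase j) k v₁ v₂ := by
  obtain ⟨c, hc, hs⟩ := h.exists_same hj hv hB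
  have hloc := fun x hx => h.local_iff (x := x) hj hv hx
  have hloc' := fun x hx => h.symm.local_iff (x := x) hj (neg_eq_comm hv) hx
  have hA' : ∃ x, In (T.erase j) x w ∧ Cov (T.erase j) (slice U j (v₁ j)) x := by
    by_contra hno
    push Not at hno
    refine h.not_same hj hv (same_of_local_eq (not_apart_erase h.meets₁)
      (not_apart_erase h.meets₂) fun x hx => ?_)
    have h₁ := hloc x hx
    have h₂ := hloc' x hx
    have h₃ := hno x hx
    have h₄ := hB x hx
    tauto
  obtain ⟨x, hxw, u, hu, hxu⟩ := hA'
  have hcw : ¬ Apart (T.erase j) w c := by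
    obtain ⟨y, hyw, hyv⟩ := exists_in_both (not_apart_erase (k := j) h.meets₂)
    exact not_apart_of_in hyw (hs.in_iff.2 hyv)
  obtain ⟨k, hk, hvk, hck, hcv⟩ := two_boxes (T := T.erase j) (v := v₁) (c := c) (u := u) (w := w)
    (apart_of_not_in fun x hxc hxu =>
      h.codeU.cross (k := j) (h.cross hj hv) ⟨c, hc, hxc⟩ ⟨u, hu, hxu⟩)
    hcw (not_apart_of_in hxw hxu) (fun x hx => by
      have h₁ := hloc x hx
      have h₂ := hloc' x hx
      have h₃ := hB x hx
      have h₄ : Cov (T.erase j) (slice U j (v₁ j)) x ↔ In (T.erase j) x u := by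
        refine ⟨?_, fun hxu => ⟨u, hu, hxu⟩⟩
        rintro ⟨u', hu', hxu'⟩
        rwa [Finset.card_le_one.1 hA u hu u' hu']
      rw [hs.in_iff]
      tauto)
  refine ⟨k, hk, ?_, fun n hn => ?_⟩
  · rw [← hs k hk, hvk]
    exact hck.symm
  · rw [← hs n (Finset.mem_of_mem_erase hn),
      hcv n (Finset.mem_of_mem_erase hn) (Finset.ne_of_mem_erase hn)]

theorem Fork.two_le_or_crossing (h : Fork T U X v₁ v₂ w) (hj : j ∈ T) (hv : v₂ j = neg (v₁ j)) :
    2 ≤ (slice U j (v₁ j)).card + (slice U j (v₂ j)).card ∨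
      ∃ k, Crossing (T.erase j) k v₁ v₂ := by
  by_cases hB : (slice U j (v₂ j)).card = 0
  · rw [Finset.card_eq_zero] at hB
    by_cases hA : (slice U j (v₁ j)).card ≤ 1
    · exact Or.inr (h.crossing_of_subset hj hv (by simp [Cov, hB]) hA)
    · omega
  · by_cases hA : (slice U j (v₁ j)).card = 0
    · by_cases hB' : (slice U j (v₂ j)).card ≤ 1
      · rw [Finset.card_eq_zero] at hA
        obtain ⟨k, hk⟩ := h.symm.crossing_of_subset hj (neg_eq_comm hv) (by simp [Cov, hA]) hB'
        exact Or.inr ⟨k, hk.symm⟩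
      · omega
    · omega

theorem Fork.letter_eq (h : Fork T U X v₁ v₂ w) (hk : Crossing (T.erase j) k v₁ v₂) :
    w k = v₁ k ∨ w k = v₂ k :=
  have hkT := Finset.mem_of_mem_erase hk.1
  eq_of_cross (fun e => h.meets₁ ⟨k, hkT, neg_eq_comm e⟩)
    (fun e => h.meets₂ ⟨k, hkT, neg_eq_comm e⟩) hk.2.1

theorem Crossing.in_of_in (hk : Crossing (T.erase j) k v₁ v₂) (hwk : w k = v₁ k)
    (hx : In (T.erase j) x w) (hx₂ : In (T.erase j) x v₂) :
    In (T.erase j) x v₁ := by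
  intro n hn
  by_cases hnk : n = k
  · rw [hnk, ← hwk]
    exact hx k hk.1
  · rw [hk.2.2 n (Finset.mem_erase.2 ⟨hnk, hn⟩)]
    exact hx₂ n hn

theorem Fork.exists_left (h : Fork T U X v₁ v₂ w) (hj : j ∈ T)
    (hv : v₂ j = neg (v₁ j)) (hk : Crossing (T.erase j) k v₁ v₂) (hwk : w k = v₁ k) :
    ∃ x, In (T.erase j) x w ∧ Cov (T.erase j) (slice U j (v₁ j)) x := by
  by_contra hno
  push Not at hno
  refine h.not_same hj hv (same_of_local_eq (not_apart_erase h.meets₁)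
    (not_apart_erase h.meets₂) fun x hx => ?_)
  have h₁ := h.local_iff hj hv hx
  have h₂ := h.symm.local_iff hj (neg_eq_comm hv) hx
  have h₃ := hno x hx
  have h₄ := hk.in_of_in hwk hx
  tauto

theorem Fork.not_right (h : Fork T U X v₁ v₂ w) (hj : j ∈ T)
    (hv : v₂ j = neg (v₁ j)) (hk : Crossing (T.erase j) k v₁ v₂) (hwk : w k = v₁ k)
    (hx : In (T.erase j) x w) :
    ¬ Cov (T.erase j) (slice U j (v₂ j)) x := by
  rintro ⟨b, hb, hxb⟩
  obtain ⟨y, hyw, a, ha, hya⟩ := h.exists_left hj hv hk hwk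
  obtain ⟨z, hzw, c, hc, hzc⟩ := h.exists_common hj hv
  have h₁ := Finset.card_pos.2 ⟨a, ha⟩
  have h₂ := Finset.card_pos.2 ⟨b, hb⟩
  have h₃ := Finset.card_pos.2 ⟨c, hc⟩
  have h₄ := h.card_slices_le hj hv
  have single : ∀ (s : Finset (ι → Letter)) (p : ι → Letter), p ∈ s → s.card = 1 →
      ∀ x, Cov (T.erase j) s x ↔ In (T.erase j) x p := by
    intro s p hp h1 x
    refine ⟨?_, fun hx => ⟨p, hp, hx⟩⟩
    rintro ⟨p', hp', hx⟩
    rwa [Finset.card_le_one.1 h1.le p hp p' hp']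
  have hA := single _ a ha (by omega)
  have hB := single _ b hb (by omega)
  have hC := single _ c hc (by omega)
  have hcw := h.cross hj hv
  obtain ⟨m₁, hm₁, hvm₁, hcm₁, hs₁⟩ := two_boxes (T := T.erase j) (v := v₁) (c := c) (u := a)
    (apart_of_not_in fun x hx hx' => h.codeU.cross (k := j) hcw ⟨c, hc, hx⟩ ⟨a, ha, hx'⟩)
    (not_apart_of_in hzw hzc) (not_apart_of_in hyw hya) (fun x hx => by
      rw [h.local_iff hj hv hx, hA, hC, or_comm])
  obtain ⟨m₂, hm₂, hvm₂, hcm₂, hs₂⟩ := two_boxes (T := T.erase j) (v := v₂) (c := c) (u := b)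
    (apart_of_not_in fun x hx hx' => h.codeU.cross (k := j) (m := v₂ j)
      (by rw [hv]; exact hcw) ⟨c, hc, hx⟩ ⟨b, hb, hx'⟩)
    (not_apart_of_in hzw hzc) (not_apart_of_in hx hxb) (fun x hx => by
      rw [h.symm.local_iff hj (neg_eq_comm hv) hx, hB, hC, or_comm])
  have h₂k : m₂ ≠ k := by
    rintro rfl
    exact hk.2.1 (by rw [hvm₂, hwk])
  have h₁k : m₁ = k := by
    by_contra hne
    exact hk.2.1 (by rw [← hs₁ k hk.1 (Ne.symm hne), ← hs₂ k hk.1 h₂k.symm])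
  refine hcm₂ ?_
  rw [hs₁ m₂ hm₂ (by rw [h₁k]; exact h₂k), hk.2.2 m₂ (Finset.mem_erase.2 ⟨h₂k, hm₂⟩), hvm₂]

theorem Fork.exists_core_common (h : Fork T U X v₁ v₂ w) (hj : j ∈ T)
    (hv : v₂ j = neg (v₁ j)) (hk : Crossing (T.erase j) k v₁ v₂) (hwk : w k = v₁ k) :
    ∃ c ∈ U, c j = w j ∧ Same (T.erase j) c v₂ := by
  obtain ⟨c, hc, hs⟩ := h.exists_same hj hv fun x hx => h.not_right hj hv hk hwk hx
  rw [mem_slice] at hc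
  exact ⟨c, hc.1, hc.2, hs⟩

theorem Fork.exists_core_left (h : Fork T U X v₁ v₂ w) (hj : j ∈ T)
    (hv : v₂ j = neg (v₁ j)) (hk : Crossing (T.erase j) k v₁ v₂) (hwk : w k = v₁ k) :
    ∃ u ∈ U, u j = v₁ j ∧ u k = neg (v₂ k) ∧ Same ((T.erase j).erase k) u v₂ := by
  have hbox : ∀ x, In (T.erase j) x (Function.update v₁ k (neg (v₂ k))) ↔
      In ((T.erase j).erase k) x v₂ ∧ ¬ Hits (x k) (v₂ k) := by
    intro x
    rw [Polybox.in_iff hk.1, Function.update_self, hits_neg]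
    refine and_congr_left' (forall₂_congr fun n hn => ?_)
    rw [Function.update_of_ne (Finset.ne_of_mem_erase hn), hk.2.2 n hn]
  rcases cover (w := w) (v := Function.update v₁ k (neg (v₂ k)))
    (h.codeU.slice (k := j) (l := v₁ j)) h.twinFreeU.slice (by
      rintro ⟨n, hn, e⟩
      by_cases hnk : n = k
      · rw [hnk, Function.update_self, hwk] at e
        refine hk.2.1 ?_
        rw [← neg_fst (v₂ k), e, neg_fst]
      · rw [Function.update_of_ne hnk] at e
        exact h.meets₁ ⟨n, Finset.mem_of_mem_erase hn, e⟩) (fun x hx => by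
      have h₁ := h.local_iff hj hv hx
      have h₂ := h.symm.local_iff hj (neg_eq_comm hv) hx
      have h₃ := h.not_right hj hv hk hwk hx
      have h₄ : In (T.erase j) x v₁ ↔ In ((T.erase j).erase k) x v₂ := by
        rw [Polybox.in_iff hk.1, hk.2.2.in_iff]
        exact and_iff_left (by rw [← hwk]; exact hx k hk.1)
      have h₅ := Polybox.in_iff (x := x) (v := v₂) hk.1
      have h₆ := h.codeU.cross (k := j) (x := x) (h.cross hj hv)
      rw [hbox]
      tauto) with ⟨u, hu, hs, -⟩ | h5
  · rw [mem_slice] at hu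
    refine ⟨u, hu.1, hu.2, ?_, fun n hn => ?_⟩
    · rw [hs k hk.1, Function.update_self]
    · rw [hs n (Finset.mem_of_mem_erase hn), Function.update_of_ne (Finset.ne_of_mem_erase hn),
        hk.2.2 n hn]
  · have := h.card_slices_le hj hv
    omega

theorem Fork.letter_eq_left (h : Fork T U X v₁ v₂ w) (hj : j ∈ T)
    (hv : v₂ j = neg (v₁ j)) (hk : Crossing (T.erase j) k v₁ v₂) (hwk : w k = v₁ k)
    {X' : Finset (ι → Letter)} {w' : ι → Letter}
    (h' : Fork T U X' v₁ v₂ w') : w' k = v₁ k := by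
  refine (h'.letter_eq hk).resolve_right fun hwk' => ?_
  obtain ⟨c, hc, hcj, hcs⟩ := h'.symm.exists_core_common hj (neg_eq_comm hv) hk.symm hwk'
  obtain ⟨u, hu, huj, huk, hus⟩ := h.exists_core_left hj hv hk hwk
  have hcross := h'.cross hj hv
  have hne : c ≠ u := fun e => hcross (by rw [← hcj, e, huj])
  obtain ⟨n, hn, e⟩ := h.codeU c hc u hu hne
  by_cases hnj : n = j
  · subst hnj
    rw [hcj, huj] at e
    exact hcross (by rw [e, neg_fst])
  · have hn' := Finset.mem_erase.2 ⟨hnj, hn⟩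
    by_cases hnk : n = k
    · subst hnk
      rw [hcs n hn', huk] at e
      refine hk.2.1 ?_
      rw [← neg_fst (v₁ n), ← e, neg_fst]
    · have hn'' := Finset.mem_erase.2 ⟨hnk, hn'⟩
      rw [hcs n hn', hus n hn'', hk.2.2 n hn''] at e
      exact neg_ne _ e.symm

theorem eq_of_flip {f : ι → Letter} {q : Coord} {n : Letter} (hj : j ∈ T) (hf : In T x f)
    (hf' : ¬ In T (Function.update x j q) f) (hxz : Hits (x j) z) (hqz : Hits q z)
    (hxn : Hits (x j) n) (hnz : n.1 ≠ z.1) : f j = n := by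
  have hkind : ∀ l m n : Letter, l.1 ≠ m.1 → n.1 = l.1 ∨ n.1 = m.1 := by decide
  rcases hkind n z (f j) hnz with e | e
  · exact hits_unique (hf j hj) hxn e
  · have := hits_unique (hf j hj) hxz e
    exact absurd ((in_update hj).2 ⟨hf.erase, by rwa [this]⟩) hf'

theorem In.update {q : Coord} (h : In T x v) (hq : Hits q (v j)) :
    In T (Function.update x j q) v := by
  intro n hn
  by_cases hnj : n = j
  · rw [hnj, Function.update_self]
    exact hq
  · rw [Function.update_of_ne hnj]
    exact h n hn

theorem Fork.exists_of_left (h : Fork T U X v₁ v₂ w) (hj : j ∈ T) (hv : v₂ j = neg (v₁ j))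
    (hx : In (T.erase j) x w) (hx₁ : In (T.erase j) x v₁) (hx₂ : ¬ In (T.erase j) x v₂) :
    ∃ f ∈ X, f j = v₂ j ∧ In (T.erase j) x f := by
  have hc := h.cross hj hv
  have hc' : (v₂ j).1 ≠ (w j).1 := by rw [hv]; exact hc.symm
  obtain ⟨q, hq₂, hqw⟩ := exists_hits_cross hc'
  obtain ⟨q', hq'w, hq'₁⟩ := exists_hits_cross hc
  rcases h.cov_or (Function.update x j q) ((in_update hj).2 ⟨hx, hqw⟩) with h₁ | h₁ | ⟨f, hf, h₁⟩
  · have := ((in_update hj).1 h₁).2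
    rw [hv, hits_neg] at hq₂
    exact absurd this hq₂
  · exact absurd ((in_update hj).1 h₁).1 hx₂
  · refine ⟨f, hf, eq_of_flip (q := q') hj h₁ (fun h₂ => ?_) (z := w j) ?_ hq'w ?_ hc',
      ((in_update hj).1 h₁).1⟩
    · rw [Function.update_idem] at h₂
      exact (h.apart₁ f hf).not_in h₂ ((in_update hj).2 ⟨hx₁, hq'₁⟩)
    · rwa [Function.update_self]
    · rwa [Function.update_self]

theorem eq_of_kindCard_le_one {t : Bool} (h : kindCard V j t ≤ 1) (hu : u ∈ V) (hv : v ∈ V)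
    (hut : (u j).1 = t) (hvt : (v j).1 = t) : u = v :=
  Finset.card_le_one.1 h u (Finset.mem_filter.2 ⟨hu, hut⟩) v (Finset.mem_filter.2 ⟨hv, hvt⟩)

theorem Fork.crossing_of_kindCard_le_one (h : Fork T U X v₁ v₂ w) (hj : j ∈ T)
    (hv : v₂ j = neg (v₁ j)) (hX : kindCard X j (v₁ j).1 ≤ 1)
    (hsub : ∀ x, In (T.erase j) x w → In (T.erase j) x v₂ → In (T.erase j) x v₁) :
    ∃ k, Crossing (T.erase j) k v₁ v₂ := by
  have hw₁ := not_apart_erase (k := j) h.meets₁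
  have hw₂ := not_apart_erase (k := j) h.meets₂
  have hvt : (v₂ j).1 = (v₁ j).1 := by rw [hv, neg_fst]
  have hex : ∃ x, In (T.erase j) x w ∧ In (T.erase j) x v₁ ∧ ¬ In (T.erase j) x v₂ := by
    by_contra hno
    push Not at hno
    exact h.not_same hj hv (same_of_local_eq hw₁ hw₂ fun x hx => ⟨hno x hx, hsub x hx⟩)
  obtain ⟨x, hxw, hx₁, hx₂⟩ := hex
  obtain ⟨f, hf, hfj, hxf⟩ := h.exists_of_left hj hv hxw hx₁ hx₂
  have hall : ∀ y, In (T.erase j) y w → In (T.erase j) y v₁ → ¬ In (T.erase j) y f →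
      In (T.erase j) y v₂ := by
    intro y hyw hy₁ hyf
    by_contra hy₂
    obtain ⟨f', hf', hfj', hyf'⟩ := h.exists_of_left hj hv hyw hy₁ hy₂
    have := eq_of_kindCard_le_one hX hf hf' (by rw [hfj, hvt]) (by rw [hfj', hvt])
    exact hyf (this ▸ hyf')
  obtain ⟨k, hk, hfk⟩ := (h.apart₂ f hf).erase (i := j) (by rw [hfj]; exact (neg_ne _).symm)
  have hfk' := neg_eq_comm hfk
  obtain ⟨y, hyw, hy₂⟩ := exists_in_both hw₂
  have hy₁ := hsub y hyw hy₂
  refine ⟨k, hk, fst_ne_of (fun e => ?_) (fun e => ?_), ?_⟩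
  · have h₁ := hx₁ k hk
    have h₂ := hxf k hk
    rw [e] at h₁
    rw [hfk', hits_neg] at h₂
    exact h₂ h₁
  · have h₁ := hy₁ k hk
    rw [e, hits_neg] at h₁
    exact h₁ (hy₂ k hk)
  · refine same_of_local_eq (not_apart_erase hw₁) (not_apart_erase hw₂) fun z hz => ?_
    have hz' : In (T.erase j) (Function.update z k (y k)) w := (in_update hk).2 ⟨hz, hyw k hk⟩
    constructor
    · intro hz₁
      refine ((in_update hk).1 (hall _ hz' ((in_update hk).2 ⟨hz₁, hy₁ k hk⟩) fun hzf => ?_)).1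
      have := ((in_update hk).1 hzf).2
      rw [hfk', hits_neg] at this
      exact this (hy₂ k hk)
    · intro hz₂
      exact ((in_update hk).1 (hsub _ hz' ((in_update hk).2 ⟨hz₂, hy₂ k hk⟩))).1

theorem Fork.two_le_kindCard_or_crossing (h : Fork T U X v₁ v₂ w) (hj : j ∈ T)
    (hv : v₂ j = neg (v₁ j)) :
    2 ≤ kindCard X j (v₁ j).1 ∨ ∃ k, Crossing (T.erase j) k v₁ v₂ := by
  by_cases hX : 2 ≤ kindCard X j (v₁ j).1
  · exact Or.inl hX
  replace hX : kindCard X j (v₁ j).1 ≤ 1 := by omega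
  have hvt : (v₂ j).1 = (v₁ j).1 := by rw [hv, neg_fst]
  by_cases h₁ : ∀ x, In (T.erase j) x w → In (T.erase j) x v₂ → In (T.erase j) x v₁
  · exact Or.inr (h.crossing_of_kindCard_le_one hj hv hX h₁)
  by_cases h₂ : ∀ x, In (T.erase j) x w → In (T.erase j) x v₁ → In (T.erase j) x v₂
  · obtain ⟨k, hk⟩ := h.symm.crossing_of_kindCard_le_one hj (neg_eq_comm hv) (by rwa [hvt]) h₂
    exact Or.inr ⟨k, hk.symm⟩
  push Not at h₁ h₂
  obtain ⟨x, hxw, hx₂, hx₁⟩ := h₁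
  obtain ⟨y, hyw, hy₁, hy₂⟩ := h₂
  obtain ⟨f, hf, hfj, -⟩ := h.exists_of_left hj hv hyw hy₁ hy₂
  obtain ⟨f', hf', hfj', -⟩ := h.symm.exists_of_left hj (neg_eq_comm hv) hxw hx₂ hx₁
  have := eq_of_kindCard_le_one hX hf hf' (by rw [hfj, hvt]) (by rw [hfj'])
  rw [this, hfj', hv] at hfj
  exact absurd hfj.symm (neg_ne _)

/-- The word `v` with its letter at `k` complemented. -/
def flip (v : ι → Letter) (k : ι) : ι → Letter := Function.update v k (neg (v k))

theorem flip_self : flip v k k = neg (v k) := Function.update_self ..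

theorem flip_of_ne (h : i ≠ k) : flip v k i = v i := Function.update_of_ne h ..

theorem Crossing.cross_right (hk : Crossing (T.erase j) k v₁ v₂) (hwk : w k = v₁ k) :
    (w k).1 ≠ (v₂ k).1 := by
  rw [hwk]
  exact hk.2.1

theorem Fork.not_apart_flip (h : Fork T U X v₁ v₂ w)
    (hk : Crossing (T.erase j) k v₁ v₂) (hwk : w k = v₁ k) :
    ¬ Apart T w (flip v₂ k) := by
  rintro ⟨n, hn, e⟩
  by_cases hnk : n = k
  · subst hnk
    rw [flip_self] at e
    refine hk.cross_right hwk ?_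
    rw [← neg_fst (v₂ n), e, neg_fst]
  · rw [flip_of_ne hnk] at e
    exact h.meets₂ ⟨n, hn, e⟩

theorem Fork.exists_in_X (h : Fork T U X v₁ v₂ w) (hj : j ∈ T)
    (hv : v₂ j = neg (v₁ j)) (hk : Crossing (T.erase j) k v₁ v₂)
    (hx : In T x w) (hxf : In T x (flip v₂ k)) : Cov T X x := by
  rcases h.cov_or x hx with h₁ | h₁ | h₁
  · have h₂ := hxf j hj
    rw [flip_of_ne (Finset.ne_of_mem_erase hk.1).symm, hv, hits_neg] at h₂
    exact absurd (h₁ j hj) h₂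
  · have h₂ := hxf k (Finset.mem_of_mem_erase hk.1)
    rw [flip_self, hits_neg] at h₂
    exact absurd (h₁ k (Finset.mem_of_mem_erase hk.1)) h₂
  · exact h₁

theorem Fork.letters_of_mem_flip (h : Fork T U X v₁ v₂ w) (hj : j ∈ T)
    (hv : v₂ j = neg (v₁ j)) (hk : Crossing (T.erase j) k v₁ v₂) (hwk : w k = v₁ k)
    {f : ι → Letter} (hf : f ∈ X) (hx : In T x w)
    (hxf : In T x (flip v₂ k)) (hxf' : In T x f) : f j = v₂ j ∧ f k = neg (v₂ k) := by
  have hkT := Finset.mem_of_mem_erase hk.1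
  have hjk := (Finset.ne_of_mem_erase hk.1).symm
  have hc := h.cross hj hv
  have hc' := hk.cross_right hwk
  constructor
  · obtain ⟨q, hqw, hq₁⟩ := exists_hits_cross hc
    refine eq_of_flip (q := q) hj hxf' (fun h₂ => ?_) (hx j hj) hqw ?_
      (by rw [hv]; exact hc.symm)
    · refine (h.apart₁ f hf).not_in h₂ ((in_update hj).2 ⟨?_, hq₁⟩)
      intro n hn
      by_cases hnk : n = k
      · rw [hnk, ← hwk]
        exact hx k hkT
      · have := hxf n (Finset.mem_of_mem_erase hn)
        rwa [flip_of_ne hnk, ← hk.2.2 n (Finset.mem_erase.2 ⟨hnk, hn⟩)] at this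
    · have := hxf j hj
      rwa [flip_of_ne hjk] at this
  · obtain ⟨q, hqw, hq₂⟩ := exists_hits_cross hc'
    refine eq_of_flip (q := q) hkT hxf' (fun h₂ => ?_) (hx k hkT) hqw ?_
      (by rw [neg_fst]; exact hc'.symm)
    · refine (h.apart₂ f hf).not_in h₂ ((in_update hkT).2 ⟨?_, hq₂⟩)
      intro n hn
      have := hxf n (Finset.mem_of_mem_erase hn)
      rwa [flip_of_ne (Finset.ne_of_mem_erase hn)] at this
    · have := hxf k hkT
      rwa [flip_self] at this

theorem Fork.exists_partner (h : Fork T U X v₁ v₂ w) (hj : j ∈ T)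
    (hv : v₂ j = neg (v₁ j)) (hk : Crossing (T.erase j) k v₁ v₂) (hwk : w k = v₁ k) :
    ∃ f ∈ X, f j = v₂ j ∧ f k = neg (v₂ k) := by
  obtain ⟨x, hx, hxf⟩ := exists_in_both (h.not_apart_flip hk hwk)
  obtain ⟨f, hf, hxf'⟩ := h.exists_in_X hj hv hk hx hxf
  exact ⟨f, hf, h.letters_of_mem_flip hj hv hk hwk hf hx hxf hxf'⟩

theorem Fork.exists_special (h : Fork T U X v₁ v₂ w) (hj : j ∈ T)
    (hv : v₂ j = neg (v₁ j)) (hk : Crossing (T.erase j) k v₁ v₂) (hwk : w k = v₁ k) :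
    (∃ f ∈ X, Same T f (flip v₂ k)) ∨ 5 ≤ kindCard X j (v₁ j).1 ∨
      ∃ f ∈ X, ∃ n ∈ T, f n = w n ∧ (w n).1 ≠ (v₂ n).1 ∧ n ≠ j ∧ n ≠ k ∧
        ∃ x, In T x w ∧ In T x (flip v₂ k) ∧ In T x f := by
  classical
  by_cases hex : ∃ f ∈ X, ∃ n ∈ T, f n = w n ∧ (w n).1 ≠ (v₂ n).1 ∧ n ≠ j ∧ n ≠ k ∧
      ∃ x, In T x w ∧ In T x (flip v₂ k) ∧ In T x f
  · exact Or.inr (Or.inr hex)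
  push Not at hex
  set F := X.filter fun f => ∃ x, In T x w ∧ In T x (flip v₂ k) ∧ In T x f with hF
  have hFX : F ⊆ X := Finset.filter_subset _ _
  rcases cover (w := w) (v := flip v₂ k) (h.codeX.mono hFX) (h.twinFreeX.mono hFX)
    (h.not_apart_flip hk hwk) (fun x hx => by
      constructor
      · intro hxf
        obtain ⟨f, hf, hxf'⟩ := h.exists_in_X hj hv hk hx hxf
        exact ⟨f, Finset.mem_filter.2 ⟨hf, x, hx, hxf, hxf'⟩, hxf'⟩
      · rintro ⟨f, hf, hxf⟩ n hn
        obtain ⟨hfX, y, hyw, hyf, hyf'⟩ := Finset.mem_filter.1 hf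
        obtain ⟨h₁, h₂⟩ := h.letters_of_mem_flip hj hv hk hwk hfX hyw hyf hyf'
        by_cases hnk : n = k
        · rw [hnk, flip_self, ← h₂]
          exact hnk ▸ hxf n hn
        rw [flip_of_ne hnk]
        by_cases hnj : n = j
        · rw [hnj, ← h₁]
          exact hnj ▸ hxf n hn
        by_cases hc : (w n).1 = (v₂ n).1
        · rcases eq_or_eq_neg hc with e | e
          · rw [← e]
            exact hx n hn
          · exact absurd ⟨n, hn, neg_eq_comm e⟩ h.meets₂
        · have h₃ : f n ≠ w n := fun e => hex f hfX n hn e hc hnj hnk y hyw hyf hyf'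
          have h₄ : f n = w n ∨ f n = v₂ n := by
            refine eq_of_cross (fun e => ?_) (fun e => ?_) hc
            · exact (not_apart_of_in hyw hyf') ⟨n, hn, e⟩
            · refine (not_apart_of_in hyf hyf') ⟨n, hn, ?_⟩
              rw [e, flip_of_ne hnk]
          rw [← h₄.resolve_left h₃]
          exact hxf n hn) with ⟨f, hf, hs, -⟩ | h5
  · exact Or.inl ⟨f, hFX hf, hs⟩
  · refine Or.inr (Or.inl (h5.trans (Finset.card_le_card fun f hf => ?_)))
    obtain ⟨hfX, y, hyw, hyf, hyf'⟩ := Finset.mem_filter.1 hf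
    refine Finset.mem_filter.2 ⟨hfX, ?_⟩
    rw [(h.letters_of_mem_flip hj hv hk hwk hfX hyw hyf hyf').1, hv, neg_fst]

theorem Fork.exists_extra (h : Fork T U X v₁ v₂ w) (hj : j ∈ T)
    (hv : v₂ j = neg (v₁ j)) (hk : Crossing (T.erase j) k v₁ v₂) (hwk : w k = v₁ k)
    {f : ι → Letter} {n : ι} (hf : f ∈ X) (hn : n ∈ T) (hfn : f n = w n)
    (hwn : (w n).1 ≠ (v₂ n).1) (hnj : n ≠ j) (hnk : n ≠ k) (hx : In T x w)
    (hxf : In T x (flip v₂ k)) (hxf' : In T x f) :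
    (∃ e ∈ X, e n = neg (v₂ n) ∧ e j = v₁ j) ∧
      ∃ e ∈ X, e n = neg (v₂ n) ∧ e k = v₂ k ∧ e j ≠ v₁ j := by
  have hkT := Finset.mem_of_mem_erase hk.1
  have hjk := (Finset.ne_of_mem_erase hk.1).symm
  have hc := h.cross hj hv
  have hc' := hk.cross_right hwk
  obtain ⟨hfj, hfk⟩ := h.letters_of_mem_flip hj hv hk hwk hf hx hxf hxf'
  have hwn' : (w n).1 ≠ (neg (v₂ n)).1 := hwn
  obtain ⟨q, hqw, hqn⟩ := exists_hits_cross hwn'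
  obtain ⟨q₀, hq₀w, hq₀n⟩ := exists_hits_cross hwn
  have hn12 : v₁ n = v₂ n :=
    hk.2.2 n (Finset.mem_erase.2 ⟨hnk, Finset.mem_erase.2 ⟨hnj, hn⟩⟩)
  have hx₁ : ∀ p ∈ T, p ≠ j → Hits (x p) (v₁ p) := by
    intro p hp hpj
    by_cases hpk : p = k
    · rw [hpk, ← hwk]
      exact hx k hkT
    · have := hxf p hp
      rwa [flip_of_ne hpk, ← hk.2.2 p (Finset.mem_erase.2 ⟨hpk, Finset.mem_erase.2 ⟨hpj, hp⟩⟩)]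
        at this
  have hx₂ : ∀ p ∈ T, p ≠ k → Hits (x p) (v₂ p) := by
    intro p hp hpk
    have := hxf p hp
    rwa [flip_of_ne hpk] at this
  have hyw := hx.update hqw
  have hyf : In T (Function.update x n q) f := hxf'.update (by rwa [hfn])
  have hqn' : ¬ Hits q (v₂ n) := hits_neg.1 hqn
  constructor
  · obtain ⟨r, hrw, hr₁⟩ := exists_hits_cross hc
    have hzw := hyw.update hrw
    rcases h.cov_or _ hzw with h₁ | h₁ | ⟨e, he, h₁⟩
    · have := h₁ n hn
      rw [Function.update_of_ne hnj, Function.update_self, hn12] at this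
      exact absurd this hqn'
    · have := h₁ n hn
      rw [Function.update_of_ne hnj, Function.update_self] at this
      exact absurd this hqn'
    · refine ⟨e, he, eq_of_flip (q := q₀) hn h₁ (fun h₂ => ?_) (z := w n) (hzw n hn) hq₀w ?_
        hwn'.symm, eq_of_flip (q := x j) hj h₁ (fun h₂ => ?_) (z := w j) (hzw j hj) (hx j hj) ?_
        hc.symm⟩
      · refine (h.apart₁ e he).not_in h₂ fun p hp => ?_
        by_cases hpn : p = n
        · rw [hpn, Function.update_self, hn12]
          exact hq₀n
        rw [Function.update_of_ne hpn]
        by_cases hpj : p = j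
        · rw [hpj, Function.update_self]
          exact hr₁
        rw [Function.update_of_ne hpj, Function.update_of_ne hpn]
        exact hx₁ p hp hpj
      · rwa [Function.update_of_ne hnj, Function.update_self]
      · rw [Function.update_idem, ← Function.update_of_ne hnj.symm q x,
          Function.update_eq_self] at h₂
        have hef := h.codeX.eq_of_in he hf h₂ hyf
        have := h₁ j hj
        rw [Function.update_self, hef, hfj, hv, hits_neg] at this
        exact this hr₁
      · rwa [Function.update_self]
  · obtain ⟨r, hrw, hr₂⟩ := exists_hits_cross hc'
    have hzw := hyw.update hrw
    rcases h.cov_or _ hzw with h₁ | h₁ | ⟨e, he, h₁⟩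
    · have := h₁ n hn
      rw [Function.update_of_ne hnk, Function.update_self, hn12] at this
      exact absurd this hqn'
    · have := h₁ n hn
      rw [Function.update_of_ne hnk, Function.update_self] at this
      exact absurd this hqn'
    · refine ⟨e, he, eq_of_flip (q := q₀) hn h₁ (fun h₂ => ?_) (z := w n) (hzw n hn) hq₀w ?_
        hwn'.symm, eq_of_flip (q := x k) hkT h₁ (fun h₂ => ?_) (z := w k) (hzw k hkT)
        (hx k hkT) ?_ hc'.symm, fun hej => ?_⟩
      · refine (h.apart₂ e he).not_in h₂ fun p hp => ?_
        by_cases hpn : p = n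
        · rw [hpn, Function.update_self]
          exact hq₀n
        rw [Function.update_of_ne hpn]
        by_cases hpk : p = k
        · rw [hpk, Function.update_self]
          exact hr₂
        rw [Function.update_of_ne hpk, Function.update_of_ne hpn]
        exact hx₂ p hp hpk
      · rwa [Function.update_of_ne hnk, Function.update_self]
      · rw [Function.update_idem, ← Function.update_of_ne hnk.symm q x,
          Function.update_eq_self] at h₂
        have hef := h.codeX.eq_of_in he hf h₂ hyf
        have := h₁ k hkT
        rw [Function.update_self, hef, hfk, hits_neg] at this
        exact this hr₂
      · rwa [Function.update_self]
      · have := h₁ j hj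
        rw [Function.update_of_ne hjk, Function.update_of_ne hnj.symm, hej] at this
        have h₂ := hx₂ j hj hjk
        rw [hv, hits_neg] at h₂
        exact h₂ this

end

theorem Code.apart_cross (hV : Code T V) (hlm : l.1 ≠ m.1) (hu : u ∈ slice V i l)
    (hv : v ∈ slice V i m) : Apart (T.erase i) u v := by
  rw [mem_slice] at hu hv
  refine (hV u hu.1 v hv.1 fun e => hlm ?_).erase fun e => hlm ?_
  · rw [← hu.2, ← hv.2, e]
  · rw [← hu.2, ← hv.2, e, neg_fst]

theorem Rival.fork {v₁ v₂ : ι → Letter} (h : Rival T V W) (hi : i ∈ T) (hlm : l.1 ≠ m.1)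
    (hne : v₁ ≠ v₂) (hl : ∀ v, v ∈ slice V i l ↔ v = v₁ ∨ v = v₂)
    (hc : (slice V i (neg l)).card ≤ 3) (hw : w ∈ slice W i m) (hxw : In (T.erase i) x w)
    (hx : Shadow T V i l x) : Fork (T.erase i) (slice V i (neg l)) (slice V i m) v₁ v₂ w := by
  have hv₁ : v₁ ∈ slice V i l := by simp [hl]
  have hv₂ : v₂ ∈ slice V i l := by simp [hl]
  have hP : ∀ x, Shadow T V i l x ↔ In (T.erase i) x v₁ ∨ In (T.erase i) x v₂ := by
    simp [Shadow, Cov, hl]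
  exact
    { apart := h.codeV.slice v₁ hv₁ v₂ hv₂ hne
      not_twin := h.twinFree.slice v₁ hv₁ v₂ hv₂
      codeU := h.codeV.slice
      twinFreeU := h.twinFree.slice
      card_le := hc
      not_same₁ := fun u hu hs => h.not_same_neg hi hv₁ hu hs.symm
      not_same₂ := fun u hu hs => h.not_same_neg hi hv₂ hu hs.symm
      cov := fun y hy => by
        rw [← hP]
        exact (h.local_iff hi hlm hw hy).1
      meets := ((hP x).1 hx).imp (not_apart_of_in hxw) (not_apart_of_in hxw)
      codeX := h.codeV.slice
      twinFreeX := h.twinFree.slice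
      apart₁ := fun f hf => h.codeV.apart_cross hlm.symm hf hv₁
      apart₂ := fun f hf => h.codeV.apart_cross hlm.symm hf hv₂
      cov_or := fun y hy => by
        rw [← or_assoc, ← hP]
        exact (h.local_iff hi hlm hw hy).2 }

theorem kindCard_slices (hlm : l.1 ≠ m.1) (t : Bool) :
    kindCard (slice V i l) k t + kindCard (slice V i (neg l)) k t + kindCard (slice V i m) k t +
      kindCard (slice V i (neg m)) k t = kindCard V k t := by
  have := card_slices (V := V.filter fun v => (v k).1 = t) (k := i) hlm
  simp only [slice, Finset.filter_comm, kindCard] at this ⊢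
  exact this

theorem card_le_kindCard {t : Bool} (hU : U ⊆ V) (h : ∀ u ∈ U, (u k).1 = t) :
    U.card ≤ kindCard V k t :=
  Finset.card_le_card fun u hu => Finset.mem_filter.2 ⟨hU hu, h u hu⟩

theorem kindCard_add_le [DecidableEq (ι → Letter)] {t : Bool} (hU : U ⊆ V) (hW : W ⊆ V)
    (hd : Disjoint U W) : kindCard U k t + kindCard W k t ≤ kindCard V k t := by
  rw [kindCard, kindCard, ← Finset.card_union_of_disjoint (Finset.disjoint_filter_filter hd),
    ← Finset.filter_union]
  exact Finset.card_le_card (Finset.filter_subset_filter _ (Finset.union_subset hU hW))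

theorem kindCard_insert [DecidableEq (ι → Letter)] {t : Bool} (hu : u ∉ V) (hut : (u k).1 = t) :
    kindCard (insert u V) k t = kindCard V k t + 1 := by
  rw [kindCard, Finset.filter_insert, if_pos hut,
    Finset.card_insert_of_notMem fun h => hu (Finset.mem_filter.1 h).1, kindCard]

/-- The local structure around a coordinate `i`: four words `C` that look like `c` except at `i`,
`j` and `k`, and four further words with letters of the other kind at `i`. -/
structure Core (T : Finset ι) (V C : Finset (ι → Letter)) (c : ι → Letter) (i j k n : ι)
    (p p' e e' : ι → Letter) : Prop where
  mem_i : i ∈ T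
  mem_j : j ∈ T
  mem_k : k ∈ T
  mem_n : n ∈ T
  ne_ji : j ≠ i
  ne_ki : k ≠ i
  ne_kj : k ≠ j
  ne_ni : n ≠ i
  ne_nj : n ≠ j
  ne_nk : n ≠ k
  subset : C ⊆ V
  card_eq : C.card = 4
  kind_i : ∀ u ∈ C, (u i).1 = (c i).1
  kind_jk : ∀ u ∈ C, (u j).1 = (c j).1 ∨ (u k).1 = (c k).1
  const : ∀ u ∈ C, ∀ s ∈ T, s ≠ i → s ≠ j → s ≠ k → u s = c s
  three_j : 3 ≤ kindCard C j (c j).1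
  three_k : 3 ≤ kindCard C k (c k).1
  small : kindCard V i (c i).1 ≤ 5
  mem_p : p ∈ V
  mem_p' : p' ∈ V
  mem_e : e ∈ V
  mem_e' : e' ∈ V
  p_i : (p i).1 ≠ (c i).1
  p'_i : p' i = neg (p i)
  e_i : e i = p i
  e'_i : e' i = p i
  p_j : (p j).1 = (c j).1
  p'_j : (p' j).1 = (c j).1
  e_j : (e j).1 = (c j).1
  p_k : (p k).1 = (c k).1
  p'_k : (p' k).1 = (c k).1
  e'_k : (e' k).1 = (c k).1
  p_n : (p n).1 ≠ (c n).1
  e_n : (e n).1 = (c n).1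
  e'_n : (e' n).1 = (c n).1
  ne_e : e ≠ e'

theorem kind_seven_lt [DecidableEq (ι → Letter)] {C D : Finset (ι → Letter)} {s : ι}
    {e o' : ι → Letter} {t : Bool} (hC : C ⊆ V) (hD : D ⊆ V) (hCD : Disjoint C D)
    (heV : e ∈ V) (hoV : o' ∈ V) (heC : e ∉ C) (heD : e ∉ D) (hoC : o' ∉ C) (heo : e ≠ o')
    (h3 : 3 ≤ kindCard C s t) (het : (e s).1 = t) (hot : (o' s).1 = t)
    (hDt : 4 ≤ kindCard D s t ∨ 3 ≤ kindCard D s t ∧ o' ∉ D) : 7 < kindCard V s t := by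
  rcases hDt with h4 | ⟨h3', hoD⟩
  · have h₁ := kindCard_add_le (k := s) (t := t) hC (Finset.insert_subset heV hD)
      (Finset.disjoint_insert_right.2 ⟨heC, hCD⟩)
    rw [kindCard_insert heD het] at h₁
    omega
  · have h₁ := kindCard_add_le (k := s) (t := t) hC
      (Finset.insert_subset heV (Finset.insert_subset hoV hD))
      (Finset.disjoint_insert_right.2 ⟨heC, Finset.disjoint_insert_right.2 ⟨hoC, hCD⟩⟩)
    rw [kindCard_insert (by simp [heo, heD]) het, kindCard_insert hoD hot] at h₁
    omega

theorem kindCard_of_forall {t : Bool} (h : ∀ u ∈ V, (u k).1 = t) : kindCard V k t = V.card := by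
  rw [kindCard, Finset.filter_true_of_mem h]

section
variable {C D : Finset (ι → Letter)} {c d p p' e e' q q' f f' : ι → Letter} {j n J K N : ι}

theorem Core.e_ne_p (h : Core T V C c i j k n p p' e e') : e ≠ p ∧ e' ≠ p :=
  ⟨fun he => h.p_n (he ▸ h.e_n), fun he => h.p_n (he ▸ h.e'_n)⟩

theorem Core.e_ne_p' (h : Core T V C c i j k n p p' e e') : e ≠ p' ∧ e' ≠ p' :=
  ⟨fun he => neg_ne _ (h.p'_i.symm.trans (he ▸ h.e_i)),
    fun he => neg_ne _ (h.p'_i.symm.trans (he ▸ h.e'_i))⟩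

theorem Core.notMem (h : Core T V C c i j k n p p' e e') : p ∉ C ∧ p' ∉ C ∧ e ∉ C ∧ e' ∉ C := by
  refine ⟨fun hC => h.p_i (h.kind_i _ hC), fun hC => h.p_i ?_, fun hC => h.p_i ?_,
    fun hC => h.p_i ?_⟩
  · rw [← h.kind_i _ hC, h.p'_i, neg_fst]
  · rw [← h.kind_i _ hC, h.e_i]
  · rw [← h.kind_i _ hC, h.e'_i]

theorem Core.false_of_mem [DecidableEq (ι → Letter)] {o o' : ι → Letter}
    (h : Core T V C c i j k n p p' e e') (h' : Core T V D d n J K N q q' f f')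
    (h7 : ∀ s ∈ T, ∀ t, kindCard V s t ≤ 7) (hCD : Disjoint C D) (heD : e ∉ D) (heD' : e' ∉ D)
    (ho : o ∈ D) (hoi : o i ≠ o' i) (hoV : o' ∈ V) (hoC : o' ∉ C) (heo : e ≠ o')
    (heo' : e' ≠ o') (hoj : (o j).1 = (c j).1) (hok : (o k).1 = (c k).1)
    (hoj' : (o' j).1 = (c j).1) (hok' : (o' k).1 = (c k).1) : False := by
  obtain ⟨-, -, heC, heC'⟩ := h.notMem
  have hj := fun hDt => (h7 j h.mem_j (c j).1).not_gt (kind_seven_lt h.subset h'.subset hCD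
    h.mem_e hoV heC heD hoC heo h.three_j h.e_j hoj' hDt)
  have hk := fun hDt => (h7 k h.mem_k (c k).1).not_gt (kind_seven_lt h.subset h'.subset hCD
    h.mem_e' hoV heC' heD' hoC heo' h.three_k h.e'_k hok' hDt)
  have hall : ∀ s ∈ T, s ≠ n → s ≠ J → s ≠ K → ∀ t, (o s).1 = t → 4 ≤ kindCard D s t := by
    intro s hs hsn hsJ hsK t ht
    rw [kindCard_of_forall fun u hu => by
      rw [h'.const u hu s hs hsn hsJ hsK, ← h'.const o ho s hs hsn hsJ hsK, ht], h'.card_eq]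
  by_cases hjJ : j = J ∨ j = K
  · by_cases hkJ : k = J ∨ k = K
    · have hiJK : ∀ s, s = J ∨ s = K → i ≠ s := by
        rintro s hs rfl
        rcases hs with rfl | rfl
        · exact h.ne_kj ((hkJ.resolve_left h.ne_ki).trans (hjJ.resolve_left h.ne_ji).symm)
        · exact h.ne_kj ((hkJ.resolve_right h.ne_ki).trans (hjJ.resolve_right h.ne_ji).symm)
      have hiJ := hiJK J (Or.inl rfl)
      have hiK := hiJK K (Or.inr rfl)
      have hoD : o' ∉ D := fun hoD => hoi (by
        rw [h'.const o ho i h.mem_i h.ne_ni.symm hiJ hiK,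
          h'.const o' hoD i h.mem_i h.ne_ni.symm hiJ hiK])
      have hs : ∀ s, s = J ∨ s = K → (o s).1 = (d s).1 → ∀ t, (o s).1 = t →
          3 ≤ kindCard D s t := by
        rintro s (rfl | rfl) h₁ t rfl <;> rw [h₁]
        · exact h'.three_j
        · exact h'.three_k
      have hmaj : (o j).1 = (d j).1 ∨ (o k).1 = (d k).1 := by
        have := h'.kind_jk o ho
        rcases hjJ with rfl | rfl <;> rcases hkJ with rfl | rfl
        · exact absurd rfl h.ne_kj
        · exact this
        · exact this.symm
        · exact absurd rfl h.ne_kj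
      rcases hmaj with h₁ | h₁
      · exact hj (Or.inr ⟨hs j hjJ h₁ _ hoj, hoD⟩)
      · exact hk (Or.inr ⟨hs k hkJ h₁ _ hok, hoD⟩)
    · push Not at hkJ
      exact hk (Or.inl (hall k h.mem_k h.ne_nk.symm hkJ.1 hkJ.2 _ hok))
  · push Not at hjJ
    exact hj (Or.inl (hall j h.mem_j h.ne_nj.symm hjJ.1 hjJ.2 _ hoj))

theorem Core.false (h : Core T V C c i j k n p p' e e') (h' : Core T V D d n J K N q q' f f')
    (h7 : ∀ s ∈ T, ∀ t, kindCard V s t ≤ 7) (hV : V.card ≤ 11) : False := by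
  classical
  obtain ⟨hpC, hpC', heC, heC'⟩ := h.notMem
  have hCn : ∀ u ∈ C, (u n).1 = (c n).1 := fun u hu => by
    rw [h.const u hu n h.mem_n h.ne_ni h.ne_nj h.ne_nk]
  have hdn : (d n).1 ≠ (c n).1 := by
    intro hd
    have h₁ := h'.small
    rw [hd] at h₁
    have h₂ := card_le_kindCard (V := V) (k := n) (t := (c n).1) h.subset hCn
    have h₃ : kindCard (insert e C) n (c n).1 ≤ kindCard V n (c n).1 :=
      Finset.card_le_card (Finset.filter_subset_filter _ (Finset.insert_subset h.mem_e h.subset))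
    have h₄ : kindCard (insert e' (insert e C)) n (c n).1 ≤ kindCard V n (c n).1 :=
      Finset.card_le_card (Finset.filter_subset_filter _
        (Finset.insert_subset h.mem_e' (Finset.insert_subset h.mem_e h.subset)))
    rw [kindCard_insert (by simp [h.ne_e.symm, heC']) h.e'_n, kindCard_insert heC h.e_n,
      kindCard_of_forall hCn, h.card_eq] at h₄
    omega
  have hDn : ∀ u ∈ D, (u n).1 ≠ (c n).1 := fun u hu => by rwa [h'.kind_i u hu]
  have hCD : Disjoint C D := Finset.disjoint_left.2 fun u hu hu' => hDn u hu' (hCn u hu)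
  have heD : e ∉ D := fun hD => hDn e hD h.e_n
  have heD' : e' ∉ D := fun hD => hDn e' hD h.e'_n
  have hpp : p i ≠ p' i := by rw [h.p'_i]; exact (neg_ne _).symm
  by_cases hpD : p ∈ D
  · exact h.false_of_mem h' h7 hCD heD heD' hpD hpp h.mem_p' hpC' h.e_ne_p'.1 h.e_ne_p'.2
      h.p_j h.p_k h.p'_j h.p'_k
  by_cases hpD' : p' ∈ D
  · exact h.false_of_mem h' h7 hCD heD heD' hpD' hpp.symm h.mem_p hpC h.e_ne_p.1 h.e_ne_p.2
      h.p'_j h.p'_k h.p_j h.p_k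
  have hsub : insert p (insert p' (insert e (insert e' (C ∪ D)))) ⊆ V := by
    simp only [Finset.insert_subset_iff, Finset.union_subset_iff]
    exact ⟨h.mem_p, h.mem_p', h.mem_e, h.mem_e', h.subset, h'.subset⟩
  have hcard := Finset.card_le_card hsub
  have hpp' : p ≠ p' := fun e => hpp (by rw [e])
  rw [Finset.card_insert_of_notMem, Finset.card_insert_of_notMem, Finset.card_insert_of_notMem,
    Finset.card_insert_of_notMem, Finset.card_union_of_disjoint hCD, h.card_eq, h'.card_eq] at hcard
  · omega
  · simp [heC', heD']
  · simp [heC, heD, h.ne_e]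
  · simp [hpC', hpD', h.e_ne_p'.1.symm, h.e_ne_p'.2.symm]
  · simp [hpC, hpD, h.e_ne_p.1.symm, h.e_ne_p.2.symm, hpp']

end

section
variable {v₁ v₂ w' : ι → Letter} {j : ι}

theorem exists_core_of_special (hi : i ∈ T)
    (hlm : l.1 ≠ m.1) (hl : ∀ v, v ∈ slice V i l ↔ v = v₁ ∨ v = v₂)
    (hsmall : kindCard V i l.1 ≤ 5)
    (hF : Fork (T.erase i) (slice V i (neg l)) (slice V i m) v₁ v₂ w)
    (hF' : Fork (T.erase i) (slice V i (neg l)) (slice V i (neg m)) v₁ v₂ w')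
    (hj : j ∈ T.erase i) (hv : v₂ j = neg (v₁ j)) (hk : Crossing ((T.erase i).erase j) k v₁ v₂)
    (hwk : w k = v₁ k)
    (hX : ∃ f ∈ slice V i m, ∃ n ∈ T.erase i, f n = w n ∧ (w n).1 ≠ (v₂ n).1 ∧ n ≠ j ∧ n ≠ k ∧
        ∃ x, In (T.erase i) x w ∧ In (T.erase i) x (flip v₂ k) ∧ In (T.erase i) x f) :
    ∃ C c j k n p p' e e', Core T V C c i j k n p p' e e' := by
  classical
  have hwk' : w' k = v₁ k := hF.letter_eq_left hj hv hk hwk hF'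
  obtain ⟨p, hp, n, hn, hpn, hwn, hnj, hnk, x, hxw, hxf, hxp⟩ := hX
  obtain ⟨⟨e, he, hen, hej⟩, e', he', hen', hek', hej'⟩ :=
    hF.exists_extra hj hv hk hwk hp hn hpn hwn hnj hnk hxw hxf hxp
  obtain ⟨hpj, hpk⟩ := hF.letters_of_mem_flip hj hv hk hwk hp hxw hxf hxp
  obtain ⟨p', hp', hpj', hpk'⟩ := hF'.exists_partner hj hv hk hwk'
  obtain ⟨c, hc, hcj, hcs⟩ := hF.exists_core_common hj hv hk hwk
  obtain ⟨u, hu, huj, huk, hus⟩ := hF.exists_core_left hj hv hk hwk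
  have hv₁ : v₁ ∈ slice V i l := (hl _).2 (Or.inl rfl)
  have hv₂ : v₂ ∈ slice V i l := (hl _).2 (Or.inr rfl)
  have hvt : (v₂ j).1 = (v₁ j).1 := by rw [hv, neg_fst]
  have hck : c k = v₂ k := hcs k hk.1
  rw [mem_slice] at hp he he' hp' hc hu hv₁ hv₂
  have hwc := hF.cross hj hv
  have h12 : v₁ ≠ v₂ := fun e => hk.2.1 (by rw [e])
  have hlc : ∀ a b : ι → Letter, a i = l → b i = neg l → a ≠ b := by
    rintro a b ha hb rfl
    exact neg_ne l (hb.symm.trans ha)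
  have hcu : c ≠ u := by
    rintro rfl
    rw [huj] at hcj
    exact hwc (by rw [hcj])
  have hsub : ({v₁, v₂, c, u} : Finset (ι → Letter)) ⊆ V := by
    simp [Finset.insert_subset_iff, hv₁.1, hv₂.1, hc.1, hu.1]
  have three : ∀ (a b d : ι → Letter) (s : ι) (t : Bool), a ≠ b → a ≠ d → b ≠ d →
      ({a, b, d} : Finset (ι → Letter)) ⊆ {v₁, v₂, c, u} → (a s).1 = t → (b s).1 = t →
      (d s).1 = t → 3 ≤ kindCard {v₁, v₂, c, u} s t := by
    intro a b d s t hab had hbd hs ha hb hd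
    rw [← Finset.card_eq_three.2 ⟨a, b, d, hab, had, hbd, rfl⟩]
    refine card_le_kindCard hs ?_
    simp [ha, hb, hd]
  have hmj := Finset.mem_erase.1 hj
  have hmk := Finset.mem_erase.1 hk.1
  have hmk' := Finset.mem_erase.1 hmk.2
  have hmn := Finset.mem_erase.1 hn
  refine ⟨{v₁, v₂, c, u}, v₂, j, k, n, p, p', e, e', ?_⟩
  exact
    { mem_i := hi
      mem_j := hmj.2
      mem_k := hmk'.2
      mem_n := hmn.2
      ne_ji := hmj.1
      ne_ki := hmk'.1
      ne_kj := hmk.1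
      ne_ni := hmn.1
      ne_nj := hnj
      ne_nk := hnk
      subset := hsub
      card_eq := by
        rw [Finset.card_insert_of_notMem, Finset.card_insert_of_notMem, Finset.card_pair hcu]
        · simp [hlc v₂ c hv₂.2 hc.2, hlc v₂ u hv₂.2 hu.2]
        · simp [h12, hlc v₁ c hv₁.2 hc.2, hlc v₁ u hv₁.2 hu.2]
      kind_i := by simp [hv₁.2, hv₂.2, hc.2, hu.2, neg_fst]
      kind_jk := by simp [hvt, hck, huj]
      const := by
        intro a ha s hs hsi hsj hsk
        have hs' := Finset.mem_erase.2 ⟨hsj, Finset.mem_erase.2 ⟨hsi, hs⟩⟩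
        have hs'' := Finset.mem_erase.2 ⟨hsk, hs'⟩
        simp only [Finset.mem_insert, Finset.mem_singleton] at ha
        rcases ha with rfl | rfl | rfl | rfl
        · exact hk.2.2 s hs''
        · rfl
        · exact hcs s hs'
        · exact hus s hs''
      three_j := three v₁ v₂ u j _ h12 (hlc _ _ hv₁.2 hu.2) (hlc _ _ hv₂.2 hu.2)
        (by simp [Finset.insert_subset_iff]) hvt.symm rfl (by rw [huj, hvt])
      three_k := three v₂ c u k _ (hlc _ _ hv₂.2 hc.2) (hlc _ _ hv₂.2 hu.2) hcu
        (by simp) rfl (by rw [hck]) (by rw [huk, neg_fst])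
      small := by rwa [hv₂.2]
      mem_p := hp.1
      mem_p' := hp'.1
      mem_e := he.1
      mem_e' := he'.1
      p_i := by rw [hp.2, hv₂.2]; exact hlm.symm
      p'_i := by rw [hp.2, hp'.2]
      e_i := by rw [he.2, hp.2]
      e'_i := by rw [he'.2, hp.2]
      p_j := by rw [hpj]
      p'_j := by rw [hpj']
      e_j := by rw [hej, hvt]
      p_k := by rw [hpk, neg_fst]
      p'_k := by rw [hpk', neg_fst]
      e'_k := by rw [hek']
      p_n := by rw [hpn]; exact hwn
      e_n := by rw [hen, neg_fst]
      e'_n := by rw [hen', neg_fst]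
      ne_e := fun hee => hej' (by rw [← hee, hej]) }

theorem Rival.exists_core_of_letter_eq (h : Rival T V W) (hi : i ∈ T)
    (hj7 : ∀ t, kindCard V j t ≤ 7) (hlm : l.1 ≠ m.1) (hl : ∀ v, v ∈ slice V i l ↔ v = v₁ ∨ v = v₂)
    (hsmall : kindCard V i l.1 ≤ 5)
    (hF : Fork (T.erase i) (slice V i (neg l)) (slice V i m) v₁ v₂ w)
    (hF' : Fork (T.erase i) (slice V i (neg l)) (slice V i (neg m)) v₁ v₂ w')
    (hj : j ∈ T.erase i) (hv : v₂ j = neg (v₁ j)) (hk : Crossing ((T.erase i).erase j) k v₁ v₂)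
    (hwk : w k = v₁ k) :
    ∃ C c j k n p p' e e', Core T V C c i j k n p p' e e' := by
  classical
  have hwk' : w' k = v₁ k := hF.letter_eq_left hj hv hk hwk hF'
  obtain ⟨u, hu, huj, -⟩ := hF.exists_core_left hj hv hk hwk
  have hU : 1 ≤ kindCard (slice V i (neg l)) j (v₁ j).1 :=
    Finset.card_pos.2 ⟨u, Finset.mem_filter.2 ⟨hu, by rw [huj]⟩⟩
  have hP : 2 ≤ kindCard (slice V i l) j (v₁ j).1 := by
    have h12 : v₁ ≠ v₂ := fun e => hk.2.1 (by rw [e])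
    rw [← Finset.card_pair h12]
    refine card_le_kindCard ?_ ?_
    · simp [Finset.insert_subset_iff, hl]
    · simp [hv, neg_fst]
  have hsum := kindCard_slices (V := V) (i := i) (k := j) hlm (v₁ j).1
  have h7 := hj7 (v₁ j).1
  rcases hF.exists_special hj hv hk hwk with ⟨f, hf, hs⟩ | h5 | hX
  · rcases hF'.exists_special hj hv hk hwk' with ⟨f', hf', hs'⟩ | h5 | hX
    · exact absurd (hs.trans hs'.symm) (h.not_same_neg hi hf hf')
    · omega
    · exact exists_core_of_special (m := neg m) hi hlm hl hsmall hF' (by rwa [neg_neg]) hj hv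
        hk hwk' hX
  · omega
  · exact exists_core_of_special hi hlm hl hsmall hF hF' hj hv hk hwk hX

theorem Rival.exists_core (h : Rival T V W) (hi : i ∈ T) (hg : ∀ i ∈ T, Gains T V W i)
    (hV : V.card ≤ 11) : ∃ C c j k n p p' e e', Core T V C c i j k n p p' e e' := by
  classical
  obtain ⟨l, hl2, hl3⟩ := h.exists_small hi (hg i hi) hV
  obtain ⟨v₁, v₂, hne, hl⟩ := Finset.card_eq_two.1 hl2
  replace hl : ∀ v, v ∈ slice V i l ↔ v = v₁ ∨ v = v₂ := by simp [hl]
  obtain ⟨x, hx⟩ := (hg i hi l).2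
  obtain ⟨m, hlm⟩ := exists_cross l
  obtain ⟨w, hw, hxw⟩ := h.exists_word_of_gain hi hlm hx
  obtain ⟨w', hw', hxw'⟩ := h.exists_word_of_gain hi (m := neg m) hlm hx
  have hF := h.fork hi hlm hne hl hl3 hw hxw hx.1
  have hF' := h.fork hi (m := neg m) hlm hne hl hl3 hw' hxw' hx.1
  have hsmall : kindCard V i l.1 ≤ 5 := by rw [kindCard_eq]; omega
  obtain ⟨j, hj, hv⟩ := hF.apart
  have hj7 := h.kindCard_le (Finset.mem_of_mem_erase hj) (hg j (Finset.mem_of_mem_erase hj)) hV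
  have hcr : ∃ k, Crossing ((T.erase i).erase j) k v₁ v₂ := by
    rcases hF.two_le_kindCard_or_crossing hj hv with h₁ | h₁
    · rcases hF'.two_le_kindCard_or_crossing hj hv with h₂ | h₂
      · rcases hF.two_le_or_crossing hj hv with h₃ | h₃
        · have hP : 2 ≤ kindCard (slice V i l) j (v₁ j).1 := by
            rw [← Finset.card_pair hne]
            refine card_le_kindCard ?_ ?_
            · simp [Finset.insert_subset_iff, hl]
            · simp [hv, neg_fst]
          have h₄ := kindCard_eq (V := slice V i (neg l)) (i := j) (v₁ j)
          rw [← hv] at h₄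
          have h₅ := kindCard_slices (V := V) (i := i) (k := j) hlm (v₁ j).1
          have h₆ := hj7 (v₁ j).1
          omega
        · exact h₃
      · exact h₂
    · exact h₁
  obtain ⟨k, hk⟩ := hcr
  rcases hF.letter_eq hk with hwk | hwk
  · exact h.exists_core_of_letter_eq hi hj7 hlm hl hsmall hF hF' hj hv hk hwk
  · exact h.exists_core_of_letter_eq hi hj7 hlm (fun v => by rw [hl, or_comm]) hsmall
      hF.symm hF'.symm hj (neg_eq_comm hv) hk.symm hwk

end

theorem Rival.eq_empty (h : Rival T V W) (hR : ∀ i ∈ T, RigidProp (T.erase i))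
    (hV : V.card ≤ 11) : V = ∅ := by
  by_contra hne
  rw [← Finset.not_nonempty_iff_eq_empty, not_not] at hne
  have hg : ∀ i ∈ T, Gains T V W i := fun i hi => h.gains hi (hR i hi) hne hV
  obtain ⟨v, hv⟩ := hne
  rcases T.eq_empty_or_nonempty with rfl | ⟨i, hi⟩
  · obtain ⟨w, hw, -⟩ := (h.equiv fun _ => (true, true)).1 ⟨v, hv, by simp [In]⟩
    exact h.disj v hv w hw (by simp [Same])
  · obtain ⟨C, c, j, k, n, p, p', e, e', hC⟩ := h.exists_core hi hg hV
    obtain ⟨D, d, J, K, N, q, q', f, f', hD⟩ := h.exists_core hC.mem_n hg hV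
    exact hC.false hD (fun s hs => h.kindCard_le hs (hg s hs) hV) hV

theorem rigidProp (T : Finset ι) : RigidProp T := by
  classical
  induction T using Finset.strongInduction with
  | H T IH =>
    intro V W hV hVt hW heq hc
    set V₀ := V.filter fun v => ∀ w ∈ W, ¬ Same T v w with hV₀
    set W₀ := W.filter fun w => ∀ v ∈ V, ¬ Same T v w with hW₀
    have hVs : V₀ ⊆ V := Finset.filter_subset _ _
    have hWs : W₀ ⊆ W := Finset.filter_subset _ _
    have h : Rival T V₀ W₀ :=
      { codeV := hV.mono hVs
        codeW := hW.mono hWs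
        twinFree := hVt.mono hVs
        equiv := fun x => by
          constructor
          · rintro ⟨v, hv, hx⟩
            obtain ⟨hv, hv'⟩ := Finset.mem_filter.1 hv
            obtain ⟨w, hw, hxw⟩ := (heq x).1 ⟨v, hv, hx⟩
            refine ⟨w, Finset.mem_filter.2 ⟨hw, fun u hu hs => ?_⟩, hxw⟩
            exact hv' w hw (hV.eq_of_in hu hv (hs.in_iff.2 hxw) hx ▸ hs)
          · rintro ⟨w, hw, hx⟩
            obtain ⟨hw, hw'⟩ := Finset.mem_filter.1 hw
            obtain ⟨v, hv, hxv⟩ := (heq x).2 ⟨w, hw, hx⟩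
            refine ⟨v, Finset.mem_filter.2 ⟨hv, fun u hu hs => ?_⟩, hxv⟩
            exact hw' v hv (hW.eq_of_in hu hw (hs.in_iff.1 hxv) hx ▸ hs)
        disj := fun v hv w hw => (Finset.mem_filter.1 hv).2 w (hWs hw) }
    have hV0 := h.eq_empty (fun i hi => IH _ (Finset.erase_ssubset hi))
      ((Finset.card_le_card hVs).trans hc)
    have hW0 : W₀ = ∅ := by
      by_contra hne
      rw [← Finset.not_nonempty_iff_eq_empty, not_not] at hne
      obtain ⟨w, hw⟩ := hne
      obtain ⟨x, hx⟩ := exists_in T w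
      obtain ⟨v, hv, -⟩ := (h.equiv x).2 ⟨w, hw, hx⟩
      simp [hV0] at hv
    constructor
    · intro v hv
      by_contra hno
      push Not at hno
      have : v ∈ V₀ := Finset.mem_filter.2 ⟨hv, hno⟩
      simp [hV0] at this
    · intro w hw
      by_contra hno
      push Not at hno
      have : w ∈ W₀ := Finset.mem_filter.2 ⟨hw, hno⟩
      simp [hW0] at this

section
variable {a b : Letter} {α β : ι → Letter}

theorem exists_slice_letter_ne (h : Rival T V W) (hWt : TwinFree T W) (hi : i ∈ T)
    (hα : ∀ v, v ∈ slice V i a ↔ v = α) (hαβ : Apart (T.erase i) α β)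
    (hβ : ∀ w ∈ slice W i a, Same (T.erase i) β w) (hWa : (slice W i a).Nonempty)
    (hk : k ∈ T.erase i) (hβk : β k = neg (α k)) :
    ∃ u ∈ slice V i (neg a), u k ≠ α k := by
  by_contra hno
  push Not at hno
  obtain ⟨wa, hwa⟩ := hWa
  have hP : ∀ x, Shadow T V i a x ↔ In (T.erase i) x α := by
    intro x
    simp [Shadow, Cov, hα]
  have hQ : ∀ x, Shadow T W i a x ↔ In (T.erase i) x β := by
    intro x
    constructor
    · rintro ⟨w, hw, hx⟩
      exact (hβ w hw).in_iff.2 hx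
    · intro hx
      exact ⟨wa, hwa, (hβ wa hwa).in_iff.1 hx⟩
  have hloss : ∀ x, Shadow T W i (neg a) x ∧ ¬ Shadow T V i (neg a) x ↔ In (T.erase i) x β := by
    intro x
    have hr : Rival T W V := ⟨h.codeW, h.codeV, hWt, fun x => (h.equiv x).symm,
      fun w hw v hv hs => h.disj v hv w hw hs.symm⟩
    rw [← hr.gain_neg hi, hP, hQ]
    exact ⟨And.left, fun hβ => ⟨hβ, hαβ.symm.not_in hβ⟩⟩
  have hout : ∀ x, ¬ Hits (x k) (α k) → ¬ Shadow T V i (neg a) x := by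
    rintro x hx ⟨u, hu, hxu⟩
    have := hxu k hk
    rw [hno u hu] at this
    exact hx this
  have hin : ∀ w ∈ slice W i (neg a), ∀ x, In (T.erase i) x w → ¬ Hits (x k) (α k) →
      In (T.erase i) x β :=
    fun w hw x hxw hx => (hloss x).1 ⟨⟨w, hw, hxw⟩, hout x hx⟩
  obtain ⟨x, hx⟩ := exists_in (T.erase i) β
  have hword : ∀ z : Letter, z.1 ≠ (α k).1 →
      ∃ w ∈ slice W i (neg a), w k = z ∧ Same ((T.erase i).erase k) w β := by
    intro z hz
    obtain ⟨q, hqz, hqβ⟩ := exists_hits_cross (l := z) (m := β k) (by rwa [hβk])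
    obtain ⟨⟨w, hw, hxw⟩, -⟩ := (hloss _).2 (hx.update hqβ)
    have hq := ((in_update hk).1 hxw).2
    have hqα : ¬ Hits q (α k) := by
      rw [hβk] at hqβ
      exact hits_neg.1 hqβ
    have hwk : (w k).1 ≠ (α k).1 := by
      intro e
      rcases eq_or_eq_neg e with e | e
      · rw [e] at hq
        exact hqα hq
      · have hs : Same (T.erase i) w β := same_of_subset fun y hy => hin w hw y hy (by
          have := hy k hk
          rwa [e, hits_neg] at this)
        have hsw := hs.trans (hβ wa hwa)
        rw [mem_slice] at hw hwa
        exact hWt wa hwa.1 w hw.1 (hsw.symm.twin hi (by rw [hw.2, hwa.2]))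
    refine ⟨w, hw, hits_unique hq hqz ?_, same_of_subset fun y hy => ?_⟩
    · have hkey : ∀ l m n : Letter, l.1 ≠ n.1 → m.1 ≠ n.1 → l.1 = m.1 := by decide
      exact hkey _ _ _ hwk hz
    · have := hin w hw (Function.update y k q) ((in_update hk).2 ⟨hy, hq⟩)
        (by rwa [Function.update_self])
      exact ((in_update hk).1 this).1
  obtain ⟨z, hz⟩ := exists_cross (α k)
  obtain ⟨w₁, hw₁, hwk₁, hs₁⟩ := hword z hz.symm
  obtain ⟨w₂, hw₂, hwk₂, hs₂⟩ := hword (neg z) hz.symm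
  have ht := (hs₁.trans hs₂.symm).twin hk (by rw [hwk₁, hwk₂])
  rw [mem_slice] at hw₁ hw₂
  exact hWt w₁ hw₁.1 w₂ hw₂.1 (ht.of_erase (by rw [hw₁.2, hw₂.2]))

theorem slice_letter_cards (h : Rival T V W) (hα : α ∈ slice V i a) (hi : i ∈ T)
    (hcov : ∀ x, In (T.erase i) x α → Shadow T V i (neg a) x)
    (hc : (slice V i (neg a)).card = 5) (hk : k ∈ T.erase i)
    (hu : u ∈ slice V i (neg a)) (huk : u k ≠ α k) (hz : z.1 ≠ (α k).1) :
    (slice (slice V i (neg a)) k (α k)).card = 1 ∧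
      (slice (slice V i (neg a)) k (neg (α k))).card = 0 ∧
      (slice (slice V i (neg a)) k z).card = 2 ∧
      (slice (slice V i (neg a)) k (neg z)).card = 2 := by
  have hne : ∀ u ∈ slice V i (neg a), ¬ Same (T.erase i) u α :=
    fun u hu hs => h.not_same_neg hi hα hu hs.symm
  have hmeet : ∀ u ∈ slice V i (neg a), ¬ Apart (T.erase i) α u := by
    classical
    intro u hu ha
    rcases cover (U := (slice V i (neg a)).erase u) (w := α) (v := α)
      (h.codeV.slice.mono (Finset.erase_subset ..)) (h.twinFree.slice.mono (Finset.erase_subset ..))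
      not_apart_self (fun x hx => iff_of_true hx (by
        obtain ⟨u', hu', hxu'⟩ := hcov x hx
        exact ⟨u', Finset.mem_erase.2 ⟨fun e => ha.not_in hx (e ▸ hxu'), hu'⟩, hxu'⟩)) with
      ⟨u', hu', hs, -⟩ | h5
    · exact hne u' (Finset.mem_of_mem_erase hu') hs
    · rw [Finset.card_erase_of_mem hu] at h5
      omega
  rcases cover_split (coverProp _) hk h.codeV.slice h.twinFree.slice hmeet not_apart_self
    (fun x hx => iff_of_true hx (hcov x hx)) rfl hu huk with h6 | ⟨h₁, h₂⟩
  · omega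
  · have h₃ := h₁.card_pos
    have h₄ := h₂ z hz
    have h₅ := h₂ (neg z) hz
    have h₆ := card_slices (V := slice V i (neg a)) (k := k) hz.symm
    omega

theorem card_slice_slices (hlm : l.1 ≠ m.1) :
    (slice (slice V i l) k z).card + (slice (slice V i (neg l)) k z).card +
      (slice (slice V i m) k z).card + (slice (slice V i (neg m)) k z).card =
      (slice V k z).card := by
  have := card_slices (V := slice V k z) (k := i) hlm
  simp only [slice] at this ⊢
  simpa only [Finset.filter_comm] using this

theorem false_of_crossing (h : Rival T V W)
    (hcov : ∀ x, In (T.erase i) x α → Shadow T V i (neg a) x)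
    (hc : (slice V i (neg a)).card = 5) (hu : u ∈ slice V i (neg a))
    (hk : Crossing (T.erase i) k α u) : False := by
  classical
  have hs : ∀ n ∈ T.erase i, n ≠ k → α n = u n := fun n hn hnk =>
    hk.2.2 n (Finset.mem_erase.2 ⟨hnk, hn⟩)
  have hiff : ∀ x, In (T.erase i) x α →
      (In (T.erase i) x (flip u k) ↔ ¬ In (T.erase i) x u) := by
    intro x hx
    rw [Polybox.in_iff hk.1, Polybox.in_iff (v := u) hk.1, flip_self, hits_neg]
    have h₁ : In ((T.erase i).erase k) x u := hk.2.2.in_iff.1 hx.erase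
    have h₂ : In ((T.erase i).erase k) x (flip u k) := fun n hn => by
      rw [flip_of_ne (Finset.ne_of_mem_erase hn)]
      exact h₁ n hn
    tauto
  rcases cover (U := (slice V i (neg a)).erase u) (w := α) (v := flip u k)
      (h.codeV.slice.mono (Finset.erase_subset ..)) (h.twinFree.slice.mono (Finset.erase_subset ..))
      (by
        rintro ⟨n, hn, e⟩
        by_cases hnk : n = k
        · subst hnk
          rw [flip_self] at e
          exact hk.2.1 (by rw [← neg_fst (u n), e, neg_fst])
        · rw [flip_of_ne hnk, hs n hn hnk] at e
          exact neg_ne _ e.symm)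
      (fun x hx => by
        rw [hiff x hx]
        constructor
        · intro hxu
          obtain ⟨u', hu', hxu'⟩ := hcov x hx
          exact ⟨u', Finset.mem_erase.2 ⟨fun e => hxu (e ▸ hxu'), hu'⟩, hxu'⟩
        · rintro ⟨u', hu', hxu'⟩ hxu
          obtain ⟨hne, hu'⟩ := Finset.mem_erase.1 hu'
          exact hne (h.codeV.slice.eq_of_in hu' hu hxu' hxu)) with ⟨u', hu', hsame, -⟩ | h5
  · refine h.twinFree.slice u hu u' (Finset.mem_of_mem_erase hu') ⟨k, hk.1, ?_, fun n hn hnk => ?_⟩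
    · rw [hsame k hk.1, flip_self]
    · rw [hsame n hn, flip_of_ne hnk]
  · rw [Finset.card_erase_of_mem hu] at h5
    omega

theorem Rival.five_le_of_same (h : Rival T V W) (hi : i ∈ T) (hab : a.1 ≠ b.1)
    (hα : α ∈ slice V i a) (hw : w ∈ slice W i b) (hs : Same (T.erase i) α w) :
    (∀ x, In (T.erase i) x α → Shadow T V i (neg a) x) ∧ 5 ≤ (slice V i (neg a)).card := by
  have hcov : ∀ x, In (T.erase i) x α → Shadow T V i (neg a) x := fun x hx =>
    (h.local_iff hi hab hw (hs.in_iff.1 hx)).1.1 ⟨α, hα, hx⟩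
  refine ⟨hcov, ?_⟩
  rcases cover (w := α) (v := α) (h.codeV.slice (k := i) (l := neg a)) h.twinFree.slice
    not_apart_self (fun x hx => iff_of_true hx (hcov x hx)) with ⟨u, hu, hsu, -⟩ | h5
  · exact absurd hsu.symm (h.not_same_neg hi hα hu)
  · exact h5

theorem Rival.twelve_lt (h : Rival T V W) (hWt : TwinFree T W) (hi : i ∈ T) (hlm : l ≠ m)
    (hl : (slice V i l).Nonempty) (hm : (slice V i m).Nonempty) (q : Coord)
    (hq : ∀ u ∈ V, ∀ v ∈ V, Hits q (u i) → Hits q (v i) → ¬ Twin (T.erase i) u v) :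
    12 < V.card := by
  classical
  by_contra hV
  have hVn : V.Nonempty := hl.mono slice_subset
  have hV12 : V.card = 12 := by
    by_contra hne
    obtain ⟨v, hv⟩ := hVn
    obtain ⟨w, hw, hs⟩ := (rigidProp T V W h.codeV h.twinFree h.codeW h.equiv (by omega)).1 v hv
    exact h.disj v hv w hw hs
  have hc : ∀ n, (slice V i n).card ≤ 11 := by
    intro n
    by_cases hn : n = l
    · have := card_slice_add_le (V := V) (k := i) (l₁ := n) (l₂ := m) (by rwa [hn])
      have := hm.card_pos
      omega
    · have := card_slice_add_le (V := V) (k := i) hn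
      have := hl.card_pos
      omega
  have hne := h.slice_nonempty hi (rigidProp _) hc hVn
  set a : Letter := (true, q.2) with ha
  set b : Letter := (false, q.1) with hb
  have hqa : Hits q a := rfl
  have hqb : Hits q b := rfl
  have hab : a.1 ≠ b.1 := by simp [ha, hb]
  have hsum := card_slices (V := V) (k := i) hab
  have hqab : ∀ u ∈ slice V i a ∪ slice V i b, u ∈ V ∧ Hits q (u i) := by
    intro u hu
    rcases Finset.mem_union.1 hu with hu | hu <;> rw [mem_slice] at hu
    · exact ⟨hu.1, hu.2 ▸ hqa⟩
    · exact ⟨hu.1, hu.2 ▸ hqb⟩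
  have hrig := rigidProp (T.erase i) (slice V i a ∪ slice V i b) (slice W i a ∪ slice W i b)
    (code_union h.codeV.slice h.codeV.slice fun x hx => h.codeV.cross hab hx)
    (fun u hu v hv => hq u (hqab u hu).1 v (hqab v hv).1 (hqab u hu).2 (hqab v hv).2)
    (code_union h.codeW.slice h.codeW.slice fun x hx => h.codeW.cross hab hx)
    (fun x => by
      rw [cov_union, cov_union]
      exact h.shadow_or hi hab x) (by
      have h₁ := Finset.card_union_le (slice V i a) (slice V i b)
      have h₂ := (hne (neg a)).1.card_pos
      omega)
  obtain ⟨α, hα⟩ := (hne a).1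
  obtain ⟨β, hβ⟩ := (hne b).1
  have hex : ∀ {a b : Letter}, (∀ v ∈ slice V i a, ∃ w ∈ slice W i a ∪ slice W i b,
      Same (T.erase i) v w) → ∀ v ∈ slice V i a, ∃ w ∈ slice W i b, Same (T.erase i) v w := by
    intro a b hr v hv
    obtain ⟨w, hw, hs⟩ := hr v hv
    rcases Finset.mem_union.1 hw with hw | hw
    · exact absurd hs (h.not_same_slice hv hw)
    · exact ⟨w, hw, hs⟩
  obtain ⟨wα, hwα, hsα⟩ := hex (fun v hv => hrig.1 v (Finset.mem_union_left _ hv)) α hα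
  obtain ⟨wβ, hwβ, hsβ⟩ := hex (fun v hv => by
    rw [Finset.union_comm]
    exact hrig.1 v (Finset.mem_union_right _ hv)) β hβ
  obtain ⟨hcovα, h5α⟩ := h.five_le_of_same hi hab hα hwα hsα
  obtain ⟨hcovβ, h5β⟩ := h.five_le_of_same hi hab.symm hβ hwβ hsβ
  have hpα := Finset.card_pos.2 ⟨α, hα⟩
  have hpβ := Finset.card_pos.2 ⟨β, hβ⟩
  have hα' : ∀ v, v ∈ slice V i a ↔ v = α := fun v =>
    ⟨fun hv => Finset.card_le_one.1 (by omega) v hv α hα, fun e => e ▸ hα⟩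
  have hβ' : ∀ v, v ∈ slice V i b ↔ v = β := fun v =>
    ⟨fun hv => Finset.card_le_one.1 (by omega) v hv β hβ, fun e => e ▸ hβ⟩
  have hWa : ∀ w ∈ slice W i a, Same (T.erase i) β w := by
    intro w hw
    obtain ⟨v, hv, hs⟩ := hrig.2 w (Finset.mem_union_left _ hw)
    rcases Finset.mem_union.1 hv with hv | hv
    · exact absurd hs (h.not_same_slice hv hw)
    · rwa [(hβ' v).1 hv] at hs
  have hWb : ∀ w ∈ slice W i b, Same (T.erase i) α w := by
    intro w hw
    obtain ⟨v, hv, hs⟩ := hrig.2 w (Finset.mem_union_right _ hw)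
    rcases Finset.mem_union.1 hv with hv | hv
    · rwa [(hα' v).1 hv] at hs
    · exact absurd hs (h.not_same_slice hv hw)
  have hαβ : Apart (T.erase i) α β := h.codeV.apart_cross hab hα hβ
  obtain ⟨k, hk, hβk⟩ := hαβ
  obtain ⟨u, hu, huk⟩ := exists_slice_letter_ne h hWt hi hα' ⟨k, hk, hβk⟩ hWa ⟨wβ, hwβ⟩ hk hβk
  obtain ⟨u', hu', huk'⟩ := exists_slice_letter_ne h hWt hi hβ'
    (Apart.symm ⟨k, hk, hβk⟩) hWb ⟨wα, hwα⟩ hk (neg_eq_comm hβk)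
  obtain ⟨z, hz⟩ := exists_cross (α k)
  have hcα := slice_letter_cards h hα hi hcovα (by omega) hk hu huk hz.symm
  have hcβ := slice_letter_cards h hβ hi hcovβ (by omega) hk hu' huk'
    (z := z) (by rw [hβk]; exact hz.symm)
  rw [hβk, neg_neg] at hcβ
  have single : ∀ (U : Finset (ι → Letter)) (p : ι → Letter) (n : Letter), (∀ v, v ∈ U ↔ v = p) →
      (slice U k n).card = if p k = n then 1 else 0 := by
    intro U p n hU
    rw [show U = {p} by ext v; simp [hU], slice, Finset.filter_singleton]
    split_ifs <;> simp
  have hza : α k ≠ z := fun e => hz (by rw [e])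
  have hza' : α k ≠ neg z := fun e => hz (by rw [e, neg_fst])
  have hkT := Finset.mem_of_mem_erase hk
  have hki := Finset.ne_of_mem_erase hk
  have hslice := fun n => card_slice_slices (V := V) (i := i) (k := k) (z := n) hab
  have hy := hslice (α k)
  have hy' := hslice (neg (α k))
  have hzc := hslice z
  rw [single _ _ _ hα', single _ _ _ hβ', hβk] at hy hy' hzc
  rw [if_pos rfl, if_neg (neg_ne _)] at hy
  rw [if_pos rfl, if_neg (neg_ne _).symm] at hy'
  rw [if_neg hza, if_neg (fun e => hz (by rw [← e, neg_fst]))] at hzc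
  have hck : ∀ n, (slice V k n).card ≤ 11 := by
    intro n
    by_cases hn : n = α k
    · rw [hn]; omega
    · have := card_slice_add_le (V := V) (k := k) hn
      omega
  have hnk := h.slice_nonempty hkT (rigidProp _) hck hVn
  have hgain : ∃ x, Shadow T V k (α k) x ∧ ¬ Shadow T W k (α k) x := by
    by_contra hno
    push Not at hno
    have := h.five_le_of_no_gain hkT (hnk z).2 hz (fun x hx => hx.2 (hno x hx.1))
    omega
  obtain ⟨x, hx⟩ := hgain
  obtain ⟨w, hw, hxw⟩ := h.exists_word_of_gain hkT hz hx
  obtain ⟨v, hv⟩ := Finset.card_pos.1 (by rw [hcα.1]; exact one_pos :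
    0 < (slice (slice V i (neg a)) k (α k)).card)
  obtain ⟨hv, hvk⟩ := mem_slice.1 hv
  have hαi := mem_slice.1 hα
  have hvi := mem_slice.1 hv
  have hvα : α ≠ v := fun e => neg_ne a (by rw [← hvi.2, ← e, hαi.2])
  have hpair : ∀ p, p ∈ slice V k (α k) ↔ p = α ∨ p = v := by
    have hsub : ({α, v} : Finset (ι → Letter)) ⊆ slice V k (α k) := by
      simp [Finset.insert_subset_iff, mem_slice, hαi.1, hvi.1, hvk]
    have := Finset.eq_of_subset_of_card_le hsub (by rw [Finset.card_pair hvα]; omega)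
    intro p
    simp [← this]
  have hF := h.fork hkT hz hvα hpair (by omega) hw hxw hx.1
  have hiT : i ∈ T.erase k := Finset.mem_erase.2 ⟨hki.symm, hi⟩
  have hvn : v i = neg (α i) := by rw [hvi.2, hαi.2]
  rcases hF.two_le_or_crossing hiT hvn with h2 | ⟨n, hn⟩
  · obtain ⟨y, -, p, hp, -⟩ := hF.exists_common hiT hvn
    have h₁ := Finset.card_pos.2 ⟨p, hp⟩
    have h₂ := card_slices (V := slice V k (neg (α k))) (k := i) (hF.cross hiT hvn).symm
    rw [hvn] at h2
    omega
  · refine false_of_crossing h hcovα (by omega) hv (k := n) ⟨?_, hn.2.1, ?_⟩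
    · have := hn.1
      rw [Finset.erase_right_comm] at this
      exact Finset.mem_of_mem_erase this
    · have := hn.2.2
      rw [Finset.erase_right_comm, Finset.erase_right_comm (a := k)] at this
      refine Same.of_erase (i := k) ?_ hvk.symm
      convert this using 1
      ext s
      simp only [Finset.mem_erase]
      tauto

end

section
variable {S : Type} {c : S → S} {a b : S}

/-- The letter of the model that corresponds to a letter of the alphabet `{a, c a, b, c b}`. -/
noncomputable def toLetter (c : S → S) (a b : S) (s : S) : Letter :=
  open Classical in (decide (s = a ∨ s = c a), decide (s = a ∨ s = b))

/-- The word of the model that corresponds to a word over the alphabet `{a, c a, b, c b}`. -/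
noncomputable def toWord {d : ℕ} (c : S → S) (a b : S) (v : Fin d → S) : Fin d → Letter :=
  fun k => toLetter c a b (v k)

theorem toLetter_values (hinv : Function.Involutive c) (hfix : ∀ s, c s ≠ s) (hba : b ≠ a)
    (hba' : b ≠ c a) : toLetter c a b a = (true, true) ∧ toLetter c a b (c a) = (true, false) ∧
      toLetter c a b b = (false, true) ∧ toLetter c a b (c b) = (false, false) := by
  have h₁ : c b ≠ a := fun e => hba' (by rw [← e, hinv])
  have h₂ : c b ≠ c a := fun e => hba (hinv.injective e)
  simp [toLetter, hfix, hba, hba', hba'.symm, h₁, h₂]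

theorem toLetter_neg (hinv : Function.Involutive c) (hfix : ∀ s, c s ≠ s) (hba : b ≠ a)
    (hba' : b ≠ c a) (hS : ∀ s : S, s = a ∨ s = c a ∨ s = b ∨ s = c b) (s : S) :
    toLetter c a b (c s) = neg (toLetter c a b s) := by
  obtain ⟨h₁, h₂, h₃, h₄⟩ := toLetter_values hinv hfix hba hba'
  rcases hS s with rfl | rfl | rfl | rfl <;> simp only [hinv _, h₁, h₂, h₃, h₄] <;> rfl

theorem toLetter_injective (hinv : Function.Involutive c) (hfix : ∀ s, c s ≠ s) (hba : b ≠ a)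
    (hba' : b ≠ c a) (hS : ∀ s : S, s = a ∨ s = c a ∨ s = b ∨ s = c b) :
    Function.Injective (toLetter c a b) := by
  obtain ⟨h₁, h₂, h₃, h₄⟩ := toLetter_values hinv hfix hba hba'
  intro s t h
  rcases hS s with hs | hs | hs | hs <;> rcases hS t with ht | ht | ht | ht <;>
    subst hs <;> simp_all

theorem setOf_hits_mem_eSet (hneg : ∀ s, toLetter c a b (c s) = neg (toLetter c a b s))
    (q : Coord) : {s | Hits q (toLetter c a b s)} ∈ ESet c := by
  intro s
  change (Hits q _ ∧ ¬ Hits q _) ∨ (Hits q _ ∧ ¬ Hits q _)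
  rw [hneg, hits_neg]
  tauto

theorem exists_coord (hinv : Function.Involutive c) (hfix : ∀ s, c s ≠ s) (hba : b ≠ a)
    (hba' : b ≠ c a) (hS : ∀ s : S, s = a ∨ s = c a ∨ s = b ∨ s = c b) {B : Set S}
    (hB : B ∈ ESet c) : ∃ q : Coord, ∀ s, s ∈ B ↔ Hits q (toLetter c a b s) := by
  classical
  obtain ⟨h₁, h₂, h₃, h₄⟩ := toLetter_values hinv hfix hba hba'
  have ha : a ∈ B ∧ c a ∉ B ∨ c a ∈ B ∧ a ∉ B := hB a
  have hb : b ∈ B ∧ c b ∉ B ∨ c b ∈ B ∧ b ∉ B := hB b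
  refine ⟨(decide (b ∈ B), decide (a ∈ B)), fun s => ?_⟩
  rcases hS s with hs | hs | hs | hs <;> rw [hs] <;> simp only [h₁, h₂, h₃, h₄, Hits, cond] <;>
    simp only [decide_eq_true_eq, decide_eq_false_iff_not] <;> tauto

end

end Polybox

theorem card_gt_twelve_of_slice_without_twin {d : ℕ} [Fintype S] (c : S → S)
    (hinv : Function.Involutive c) (hfix : ∀ s, c s ≠ s)
    (a b : S) (hba : b ≠ a) (hba' : b ≠ c a)
    (hS : ∀ s : S, s = a ∨ s = c a ∨ s = b ∨ s = c b)
    (V W : Set (Fin d → S))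
    (hV : PolyboxCode c V) (hW : PolyboxCode c W)
    (hdisj : Disjoint V W) (heq : EquivCodes c V W)
    (hVt : NoTwinPair c V) (hWt : NoTwinPair c W)
    (i : Fin d) (l p : S) (hlp : l ≠ p)
    (hl : (Subcode V i l).Nonempty) (hp : (Subcode V i p).Nonempty)
    (x : Set S) (hx : x ∈ ESet c)
    (hslice : ¬ ∃ v ∈ V, ∃ w ∈ V,
      v i ∈ x ∧ w i ∈ x ∧ TwinPairIgnoring c i v w) :
    12 < V.ncard := by
  classical
  open Polybox in
  have hneg := toLetter_neg hinv hfix hba hba' hS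
  have hinj := toLetter_injective hinv hfix hba hba' hS
  have hwinj : Function.Injective (toWord (d := d) c a b) :=
    fun v w h => funext fun k => hinj (congrFun h k)
  have himage : ∀ U : Set (Fin d → S), ∃ F : Finset (Fin d → Letter),
      (∀ v, v ∈ F ↔ ∃ u ∈ U, toWord c a b u = v) ∧ F.card = U.ncard := by
    intro U
    refine ⟨(toWord c a b '' U).toFinset, fun v => by simp, ?_⟩
    rw [← Set.ncard_eq_toFinset_card', Set.ncard_image_of_injective _ hwinj]
  have hcompl : ∀ s t, toLetter c a b t = neg (toLetter c a b s) ↔ t = c s := fun s t => by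
    rw [← hneg, hinj.eq_iff]
  have hcode : ∀ {U : Set (Fin d → S)} {F : Finset (Fin d → Letter)},
      (∀ v, v ∈ F ↔ ∃ u ∈ U, toWord c a b u = v) → PolyboxCode c U → Code Finset.univ F := by
    intro U F hF hU v hv w hw hvw
    obtain ⟨v, hvU, rfl⟩ := (hF _).1 hv
    obtain ⟨w, hwU, rfl⟩ := (hF _).1 hw
    obtain ⟨k, hk⟩ := hU v hvU w hwU fun e => hvw (e ▸ rfl)
    exact ⟨k, Finset.mem_univ k, (hcompl _ _).2 hk⟩
  have htwin : ∀ {U : Set (Fin d → S)} {F : Finset (Fin d → Letter)},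
      (∀ v, v ∈ F ↔ ∃ u ∈ U, toWord c a b u = v) → NoTwinPair c U → TwinFree Finset.univ F := by
    rintro U F hF hU v hv w hw ⟨k, -, hk, hk'⟩
    obtain ⟨v, hvU, rfl⟩ := (hF _).1 hv
    obtain ⟨w, hwU, rfl⟩ := (hF _).1 hw
    exact hU v hvU w hwU ⟨k, (hcompl _ _).1 hk, fun j hj => hinj (hk' j (Finset.mem_univ j) hj)⟩
  have hcov : ∀ {U : Set (Fin d → S)} {F : Finset (Fin d → Letter)},
      (∀ v, v ∈ F ↔ ∃ u ∈ U, toWord c a b u = v) → ∀ y, Cov Finset.univ F y ↔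
        (fun k => {s | Hits (y k) (toLetter c a b s)}) ∈ RealizeSet c U := by
    intro U F hF y
    simp only [RealizeSet, Set.mem_iUnion, exists_prop]
    constructor
    · rintro ⟨v, hv, hy⟩
      obtain ⟨u, hu, rfl⟩ := (hF _).1 hv
      exact ⟨u, hu, fun k => ⟨setOf_hits_mem_eSet hneg _, hy k (Finset.mem_univ k)⟩⟩
    · rintro ⟨u, hu, hy⟩
      exact ⟨_, (hF _).2 ⟨u, hu, rfl⟩, fun k _ => (hy k).2⟩
  obtain ⟨V', hV', hVcard⟩ := himage V
  obtain ⟨W', hW', -⟩ := himage W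
  have hrival : Rival Finset.univ V' W' := by
    refine ⟨hcode hV' hV, hcode hW' hW, htwin hV' hVt, fun y => ?_, fun v hv w hw hs => ?_⟩
    · rw [hcov hV', hcov hW', show RealizeSet c V = RealizeSet c W from heq]
    · obtain ⟨v, hvU, rfl⟩ := (hV' _).1 hv
      obtain ⟨w, hwU, rfl⟩ := (hW' _).1 hw
      have hvw : v = w := hwinj (funext fun k => hs k (Finset.mem_univ k))
      exact Set.disjoint_left.1 hdisj hvU (hvw ▸ hwU)
  have hsub : ∀ {s : S}, (Subcode V i s).Nonempty →
      (slice V' i (toLetter c a b s)).Nonempty := by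
    rintro s ⟨v, hv, hvs⟩
    exact ⟨_, mem_slice.2 ⟨(hV' _).2 ⟨v, hv, rfl⟩, congrArg _ hvs⟩⟩
  obtain ⟨q, hq⟩ := exists_coord hinv hfix hba hba' hS hx
  rw [← hVcard]
  refine hrival.twelve_lt (htwin hW' hWt) (Finset.mem_univ i) (hinj.ne hlp) (hsub hl) (hsub hp) q ?_
  rintro v hv w hw hqv hqw ⟨k, hk, hkc, hk'⟩
  obtain ⟨v, hvU, rfl⟩ := (hV' _).1 hv
  obtain ⟨w, hwU, rfl⟩ := (hV' _).1 hw
  exact hslice ⟨v, hvU, w, hwU, (hq _).2 hqv, (hq _).2 hqw, k, Finset.ne_of_mem_erase hk,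
    (hcompl _ _).1 hkc, fun j hj hjk =>
      hinj (hk' j (Finset.mem_erase.2 ⟨hj, Finset.mem_univ j⟩) hjk)⟩
end

section
/- Let S = {a, a', b, b'} be a four-letter alphabet with the complementation a ↦ a', b ↦ b', let d ≥ 5, and let V, W ⊆ S^d be disjoint equivalent polybox codes without twin pairs with |V| = 12. Then it is not the case that |V^{i,a}| = |V^{i,a'}| = |V^{i,b}| = |V^{i,b'}| = 3 for every i ∈ {1,…,d}. -/
variable {S : Type}

/-- A letter of a word relative to a fixed word: `none` where both agree, `some b` for the two
letters of the other complementary pair. -/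
abbrev Letter := Option Bool

/-- The two letters are complementary. -/
def clash : Letter → Letter → Bool
  | some a, some b => a ^^ b
  | _, _ => false

/-- Every value allowed by the first letter is allowed by the second one. -/
def sub : Letter → Letter → Bool
  | _, none => true
  | some a, some b => !(a ^^ b)
  | none, some _ => false

/-- How a subcube is partitioned by at most three pairwise disjoint subcubes: `one l` if it lies in
the cube `l`, `two l m` if `l` and `m` cut it into halves, `three h l m` if `h` cuts out a half and
`l`, `m` the two quarters of the other half; `non` marks an absent subcube. -/
inductive Pat
  | non
  | one (l : Fin 3)
  | two (l m : Fin 3)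
  | three (h l m : Fin 3)

namespace Pat

/-- The constraint that a partition pattern puts on a single coordinate, where `x` is the letter of
the partitioned cube and `y` are the letters of the partitioning ones. -/
def fit : Pat → Letter → (Fin 3 → Letter) → Bool
  | non, x, _ => x.isNone
  | one l, x, y => sub x (y l)
  | two l m, x, y => (sub x (y l) && sub x (y m)) || (x.isNone && clash (y l) (y m))
  | three h l m, x, y =>
    (sub x (y h) && sub x (y l) && sub x (y m)) ||
    (x.isNone && ((clash (y h) (y l) && clash (y h) (y m)) ||
      ((y h).isNone && clash (y l) (y m))))

/-- The last two cubes of the pattern are separated at this coordinate. -/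
def usesLast : Pat → Letter → (Fin 3 → Letter) → Bool
  | two l m, none, y => clash (y l) (y m)
  | three _ l m, none, y => clash (y l) (y m)
  | _, _, _ => false

/-- The half of the pattern is separated from the quarters at this coordinate. -/
def usesFirst : Pat → Letter → (Fin 3 → Letter) → Bool
  | three h l _, none, y => clash (y h) (y l)
  | _, _, _ => false

/-- All patterns. -/
def all : List Pat :=
  [non, one 0, one 1, one 2, two 0 1, two 0 2, two 1 2, three 0 1 2, three 1 0 2, three 2 0 1]

/-- A linear order on the patterns. -/
def key : Pat → Nat
  | non => 0
  | one l => 1 + l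
  | two l m => 3 + l + m
  | three h _ _ => 7 + h

/-- The pattern of an absent subcube. -/
def isNon : Pat → Bool
  | non => true
  | _ => false

/-- The pattern of a subcube contained in another one. -/
def isOne : Pat → Bool
  | one _ => true
  | _ => false

/-- The cube `j` occurs in the pattern. -/
def has : Pat → Fin 3 → Bool
  | non, _ => false
  | one l, j => l == j
  | two l m, j => l == j || m == j
  | three _ _ _, _ => true

/-- No equal cubes and no twin pairs are forced by the patterns. -/
def good (p : Pat) (q : Fin 3 → Pat) : Bool :=
  match p with
  | non => true
  | one l => !isOne (q l)
  | two l m => !(isOne (q l) && isOne (q m))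
  | three _ l m => !(isOne (q l) && isOne (q m))

/-- The patterns which occur for the cube `j` on one side, given those on the other side. -/
def options (j : Fin 3) (p : Fin 3 → Pat) : List Pat :=
  all.filter fun q =>
    !(has q 0 ^^ has (p 0) j) && !(has q 1 ^^ has (p 1) j) && !(has q 2 ^^ has (p 2) j)

/-- Contribution of a cube to the number of letters `c` at a coordinate. -/
def count (p : Pat) (x c : Letter) : Nat :=
  bif !isNon p && sub x c && sub c x then 1 else 0

/-- The separations made by a pattern at a coordinate, as two binary digits. -/
def digit (p : Pat) (x : Letter) (y : Fin 3 → Letter) : Nat :=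
  bif usesLast p x y then 1 else bif usesFirst p x y then 2 else 0

end Pat

open Pat

/-- The letters of six cubes, three on each side, at one coordinate. -/
abbrev Column := (Fin 3 → Letter) × (Fin 3 → Letter)

/-- All letters. -/
def letters : List Letter := [none, some true, some false]

/-- All triples of letters. -/
def letterTriples : List (Fin 3 → Letter) :=
  letters.flatMap fun a => letters.flatMap fun b => letters.map fun c => ![a, b, c]

/-- All columns. -/
def columns : List Column :=
  letterTriples.flatMap fun s => letterTriples.map fun t => (s, t)

/-- No letter occurs more than three times in the column. -/
def capped (p q : Fin 3 → Pat) (t : Column) : Bool :=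
  letters.all fun c => Nat.ble
    (count (p 0) (t.1 0) c + count (p 1) (t.1 1) c + count (p 2) (t.1 2) c +
      (count (q 0) (t.2 0) c + count (q 1) (t.2 1) c + count (q 2) (t.2 2) c)) 3

/-- All separations made at a column. -/
def mask (p q : Fin 3 → Pat) (t : Column) : Nat :=
  4 * (4 * (4 * (4 * (4 * digit (p 0) (t.1 0) t.2 + digit (p 1) (t.1 1) t.2) +
    digit (p 2) (t.1 2) t.2) + digit (q 0) (t.2 0) t.1) + digit (q 1) (t.2 1) t.1) +
    digit (q 2) (t.2 2) t.1

/-- There are no `n` numbers in the list with pairwise disjoint binary expansions that are also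
disjoint from that of `used`. -/
def noPacking (T : List Nat) : Nat → Nat → Bool
  | 0, _ => false
  | n + 1, used =>
    T.all fun m => bif Nat.beq (Nat.land m used) 0 then noPacking T n (Nat.lor m used) else true

/-- No compatible patterns have four columns with pairwise distinct separations. -/
def noFourColumns : Bool :=
  Pat.all.all fun p₀ =>
  let T₀ := columns.filter fun t => fit p₀ (t.1 0) t.2
  Pat.all.all fun p₁ =>
  !Nat.ble (key p₀) (key p₁) ||
  let T₁ := T₀.filter fun t => fit p₁ (t.1 1) t.2
  Pat.all.all fun p₂ =>
  !Nat.ble (key p₁) (key p₂) ||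
  isNon p₂ ||
  let T₂ := T₁.filter fun t => fit p₂ (t.1 2) t.2
  let p := ![p₀, p₁, p₂]
  (options 0 p).all fun q₀ =>
  let T₃ := T₂.filter fun t => fit q₀ (t.2 0) t.1
  (options 1 p).all fun q₁ =>
  let T₄ := T₃.filter fun t => fit q₁ (t.2 1) t.1
  (options 2 p).all fun q₂ =>
  let q := ![q₀, q₁, q₂]
  !(good p₀ q && good p₁ q && good p₂ q && good q₀ p && good q₁ p && good q₂ p) ||
  let T₅ := T₄.filter fun t => fit q₂ (t.2 2) t.1
  noPacking ((T₅.filter (capped p q)).map (mask p q)) 4 0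

theorem noFourColumns_eq_true : noFourColumns = true := by
  decide +kernel

theorem Pat.mem_all_cases {p : Pat} (hp : p ∈ Pat.all) :
    p = non ∨ (∃ l, p = one l) ∨ (∃ l m, p = two l m ∧ l ≠ m) ∨
      ∃ h l m, p = three h l m ∧ h ≠ l ∧ h ≠ m ∧ l ≠ m := by
  simp only [Pat.all, List.mem_cons, List.not_mem_nil, or_false] at hp
  rcases hp with rfl | rfl | rfl | rfl | rfl | rfl | rfl | rfl | rfl | rfl <;> simp

theorem mem_letterTriples (s : Fin 3 → Letter) : s ∈ letterTriples := by
  have hl : ∀ x : Letter, x ∈ letters := by decide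
  simp only [letterTriples, List.mem_flatMap, List.mem_map]
  refine ⟨s 0, hl _, s 1, hl _, s 2, hl _, ?_⟩
  ext i : 1
  fin_cases i <;> rfl

theorem mem_columns (t : Column) : t ∈ columns := by
  simp only [columns, List.mem_flatMap, List.mem_map]
  exact ⟨t.1, mem_letterTriples _, t.2, mem_letterTriples _, rfl⟩

theorem Pat.mem_options {j : Fin 3} {p : Fin 3 → Pat} {q : Pat} (hq : q ∈ Pat.all)
    (h : ∀ i, has q i = has (p i) j) : q ∈ options j p := by
  simp [options, hq, h]

theorem land_four_mul_add {a b u v : ℕ} (hu : u < 4) (hv : v < 4) (h : a &&& b = 0)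
    (h' : u &&& v = 0) : (4 * a + u) &&& (4 * b + v) = 0 := by
  apply Nat.eq_of_testBit_eq
  intro i
  have h1 := Nat.testBit_two_pow_mul_add a (i := 2) hu i
  have h2 := Nat.testBit_two_pow_mul_add b (i := 2) hv i
  norm_num at h1 h2
  rw [Nat.testBit_and, h1, h2, Nat.zero_testBit]
  split_ifs with hi
  · rw [← Nat.testBit_and, h', Nat.zero_testBit]
  · rw [← Nat.testBit_and, h, Nat.zero_testBit]

theorem Pat.digit_lt (p : Pat) (x : Letter) (y : Fin 3 → Letter) : digit p x y < 4 := by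
  unfold digit
  cases usesLast p x y <;> cases usesFirst p x y <;> simp

theorem Pat.digit_land {p : Pat} {x x' : Letter} {y y' : Fin 3 → Letter}
    (h₁ : ¬ (usesLast p x y ∧ usesLast p x' y'))
    (h₂ : ¬ (usesFirst p x y ∧ usesFirst p x' y')) : digit p x y &&& digit p x' y' = 0 := by
  revert h₁ h₂
  unfold digit
  cases usesLast p x y <;> cases usesFirst p x y <;> cases usesLast p x' y' <;>
    cases usesFirst p x' y' <;> simp

theorem mask_land {p q : Fin 3 → Pat} {t t' : Column}
    (hp : ∀ j, digit (p j) (t.1 j) t.2 &&& digit (p j) (t'.1 j) t'.2 = 0)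
    (hq : ∀ j, digit (q j) (t.2 j) t.1 &&& digit (q j) (t'.2 j) t'.1 = 0) :
    mask p q t &&& mask p q t' = 0 := by
  unfold mask
  have hd := Pat.digit_lt
  exact land_four_mul_add (hd _ _ _) (hd _ _ _) (land_four_mul_add (hd _ _ _) (hd _ _ _)
    (land_four_mul_add (hd _ _ _) (hd _ _ _) (land_four_mul_add (hd _ _ _) (hd _ _ _)
    (land_four_mul_add (hd _ _ _) (hd _ _ _) (hp _) (hp _)) (hp _)) (hq _)) (hq _)) (hq _)

theorem not_noPacking {T : List ℕ} {m : Fin 4 → ℕ} (hm : ∀ i, m i ∈ T)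
    (hd : ∀ i j, i ≠ j → m i &&& m j = 0) : ¬ noPacking T 4 0 = true := by
  intro h
  have step : ∀ n used i, noPacking T (n + 1) used = true → m i &&& used = 0 →
      noPacking T n (m i ||| used) = true := by
    intro n used i h h0
    have := List.all_eq_true.1 h (m i) (hm i)
    have h1 : Nat.land (m i) used = 0 := h0
    rw [h1] at this
    exact this
  have h1 := step _ _ 0 h (by simp)
  have h2 := step _ _ 1 h1 (by rw [Nat.and_or_distrib_left, hd 1 0 (by decide)]; simp)
  have h3 := step _ _ 2 h2 (by
    rw [Nat.and_or_distrib_left, Nat.and_or_distrib_left, hd 2 0 (by decide), hd 2 1 (by decide)]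
    simp)
  have h4 := step _ _ 3 h3 (by
    rw [Nat.and_or_distrib_left, Nat.and_or_distrib_left, Nat.and_or_distrib_left,
      hd 3 0 (by decide), hd 3 1 (by decide), hd 3 2 (by decide)]
    simp)
  simp [noPacking] at h4

theorem not_four_columns {p q : Fin 3 → Pat} (hp : ∀ j, p j ∈ Pat.all) (hq : ∀ j, q j ∈ Pat.all)
    (hs₁ : key (p 0) ≤ key (p 1)) (hs₂ : key (p 1) ≤ key (p 2)) (hne : ∃ j, p j ≠ non)
    (hadj : ∀ j l, has (p j) l = has (q l) j) (hgp : ∀ j, good (p j) q) (hgq : ∀ j, good (q j) p)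
    (t : Fin 4 → Column) (hfp : ∀ i j, fit (p j) ((t i).1 j) (t i).2)
    (hfq : ∀ i j, fit (q j) ((t i).2 j) (t i).1) (hcap : ∀ i, capped p q (t i))
    (hd : ∀ i i', i ≠ i' → mask p q (t i) &&& mask p q (t i') = 0) : False := by
  have hp' : ![p 0, p 1, p 2] = p := by ext i : 1; fin_cases i <;> rfl
  have hq' : ![q 0, q 1, q 2] = q := by ext i : 1; fin_cases i <;> rfl
  have hp2 : isNon (p 2) = false := by
    have key0 : ∀ r : Pat, key r = 0 → r = non := by
      intro r hr
      cases r <;> simp [key] at hr ⊢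
    cases h : p 2 <;> simp only [isNon]
    obtain ⟨j, hj⟩ := hne
    have h2 : key (p 2) = 0 := by rw [h]; rfl
    refine absurd (key0 (p j) ?_) hj
    fin_cases j <;> simp <;> omega
  have h := noFourColumns_eq_true
  unfold noFourColumns at h
  have h := List.all_eq_true.1 h _ (hp 0)
  have h := List.all_eq_true.1 h _ (hp 1)
  rw [Nat.ble_eq_true_of_le hs₁, Bool.not_true, Bool.false_or] at h
  have h := List.all_eq_true.1 h _ (hp 2)
  rw [Nat.ble_eq_true_of_le hs₂, Bool.not_true, Bool.false_or, hp2, Bool.false_or] at h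
  simp only [hp'] at h
  have h := List.all_eq_true.1 h _ (mem_options (hq 0) fun i => (hadj i 0).symm)
  have h := List.all_eq_true.1 h _ (mem_options (hq 1) fun i => (hadj i 1).symm)
  have h := List.all_eq_true.1 h _ (mem_options (hq 2) fun i => (hadj i 2).symm)
  simp only [hq', hgp, hgq, Bool.and_true, Bool.not_true, Bool.false_or] at h
  refine not_noPacking (m := fun i => mask p q (t i)) (fun i => ?_) hd h
  refine List.mem_map_of_mem ?_
  simp only [List.mem_filter, mem_columns, hfp, hfq, hcap, and_self]

/-- The point `y` lies in the cube with letters `s`. -/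
def Hits {ι : Type*} (s : ι → Letter) (y : ι → Bool) : Prop := ∀ k b, s k = some b → y k = b

theorem clash_iff {x y : Letter} : clash x y = true ↔ ∃ b, x = some b ∧ y = some !b := by
  revert x y; decide

theorem clash_comm (x y : Letter) : clash x y = clash y x := by
  revert x y; decide

open Classical in
theorem eq_none_of_halves {ι : Type*} {s t : ι → Letter} (K : Set ι) (z : ι → Bool)
    (hcov : ∀ y : ι → Bool, (∀ k ∈ K, y k = z k) → Hits s y ∨ Hits t y) {k : ι} (hk : k ∉ K)
    {b : Bool} (hs : s k = some b) (ht : t k = some !b) {m : ι} (hm : m ∉ K) (hmk : m ≠ k) :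
    s m = none := by
  by_contra hne
  obtain ⟨e, he⟩ := Option.ne_none_iff_exists'.1 hne
  rcases hcov (fun c => if c = k then b else if c = m then !e else z c) (fun c hc => by
    rw [if_neg (by rintro rfl; exact hk hc), if_neg (by rintro rfl; exact hm hc)]) with h | h
  · simpa [hmk] using h m e he
  · simpa using h k _ ht

theorem exists_pat_two {ι : Type*} {F : Fin 3 → ι → Letter} {l m : Fin 3}
    {k : ι} {b : Bool} (hl : F l k = some b) (hm : F m k = some !b)
    (hcov : ∀ y, Hits (F l) y ∨ Hits (F m) y) :
    (∀ k, fit (two l m) none fun i => F i k) ∧ usesLast (two l m) none (fun i => F i k) ∧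
      ∀ k', usesLast (two l m) none (fun i => F i k') → k' = k := by
  have h1 : ∀ k', k' ≠ k → F l k' = none := fun k' hk' =>
    eq_none_of_halves ∅ (fun _ => true) (fun y _ => hcov y) (Set.notMem_empty k) hl hm
      (Set.notMem_empty k') hk'
  have h2 : ∀ k', k' ≠ k → F m k' = none := fun k' hk' =>
    eq_none_of_halves ∅ (fun _ => true) (fun y _ => (hcov y).symm) (Set.notMem_empty k) hm
      (by rw [hl, Bool.not_not]) (Set.notMem_empty k') hk'
  refine ⟨fun k' => ?_, ?_, fun k' hk' => ?_⟩
  · by_cases hk' : k' = k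
    · subst hk'
      simp [fit, hl, hm, clash]
    · simp [fit, h1 k' hk', h2 k' hk', sub]
  · simp [usesLast, hl, hm, clash]
  · by_contra hne
    simp [usesLast, h1 k' hne, clash] at hk'

theorem exists_pat_three {ι : Type*} {F : Fin 3 → ι → Letter} {h l m : Fin 3}
    (hclash : ∀ i j, i ≠ j → ∃ k b, F i k = some b ∧ F j k = some !b)
    (hlm : l ≠ m) (hhl : h ≠ l) (hhm : h ≠ m)
    (hcov : ∀ y, Hits (F h) y ∨ Hits (F l) y ∨ Hits (F m) y)
    {k : ι} {b : Bool} (hk : F h k = some b) (hk' : ∀ k', k' ≠ k → F h k' = none) :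
    (∀ k, fit (three h l m) none fun i => F i k) ∧
      (∃ k', usesLast (three h l m) none (fun i => F i k')) ∧
      (∀ k₁ k₂, usesLast (three h l m) none (fun i => F i k₁) →
        usesLast (three h l m) none (fun i => F i k₂) → k₁ = k₂) ∧
      ∀ k', usesFirst (three h l m) none (fun i => F i k') → k' = k := by
  have opp : ∀ j, h ≠ j → F j k = some !b := by
    intro j hj
    obtain ⟨c, e, hc, hc'⟩ := hclash h j hj
    obtain rfl : c = k := by
      by_contra hne
      simp [hk' c hne] at hc
    rw [hk, Option.some.injEq] at hc
    rw [hc', hc]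
  obtain ⟨c, e, hlc, hmc⟩ := hclash l m hlm
  have hck : c ≠ k := by
    rintro rfl
    rw [opp l hhl, Option.some.injEq] at hlc
    rw [opp m hhm, hlc] at hmc
    simp at hmc
  have cov : ∀ y : ι → Bool, (∀ k' ∈ ({k} : Set ι), y k' = !b) → Hits (F l) y ∨ Hits (F m) y := by
    intro y hy
    refine (hcov y).resolve_left fun hh => ?_
    have := hh k b hk
    rw [hy k rfl] at this
    simp at this
  have h1 : ∀ k', k' ≠ k → k' ≠ c → F l k' = none := fun k' hk hc =>
    eq_none_of_halves {k} (fun _ => !b) cov hck hlc hmc hk hc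
  have h2 : ∀ k', k' ≠ k → k' ≠ c → F m k' = none := fun k' hk hc =>
    eq_none_of_halves {k} (fun _ => !b) (fun y hy => (cov y hy).symm) hck hmc
      (by rw [hlc, Bool.not_not]) hk hc
  have last : ∀ k', usesLast (three h l m) none (fun i => F i k') → k' = c := by
    intro k' hu
    by_contra hne
    by_cases hkk : k' = k
    · subst hkk
      simp [usesLast, opp l hhl, opp m hhm, clash] at hu
    · simp [usesLast, h1 k' hkk hne, clash] at hu
  refine ⟨fun k' => ?_, ⟨c, ?_⟩, fun k₁ k₂ h₁ h₂ => (last k₁ h₁).trans (last k₂ h₂).symm,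
    fun k' hu => ?_⟩
  · by_cases hkk : k' = k
    · subst hkk
      simp [fit, opp l hhl, opp m hhm, hk, clash]
    · by_cases hkc : k' = c
      · subst hkc
        simp [fit, hk' k' hkk, hlc, hmc, clash]
      · simp [fit, hk' k' hkk, h1 k' hkk hkc, h2 k' hkk hkc, sub]
  · simp [usesLast, hlc, hmc, clash]
  · by_contra hne
    simp [usesFirst, hk' k' hne, clash] at hu

open Classical in
theorem exists_unique_letter {ι : Type*} {F : Fin 3 → ι → Letter}
    (hclash : ∀ i j, i ≠ j → ∃ k b, F i k = some b ∧ F j k = some !b)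
    (hcov : ∀ y, ∃ l, Hits (F l) y) :
    ∃ h k b, F h k = some b ∧ ∀ k', k' ≠ k → F h k' = none := by
  by_contra! hno
  have many : ∀ h k b, F h k = some b → ∃ k' e, k' ≠ k ∧ F h k' = some e := by
    intro h k b hb
    obtain ⟨k', hk', hne⟩ := hno h k b hb
    obtain ⟨e, he⟩ := Option.ne_none_iff_exists'.1 hne
    exact ⟨k', e, hk', he⟩
  obtain ⟨k, b, h0, h1⟩ := hclash 0 1 (by decide)
  obtain ⟨m, e, hmk, hm⟩ := many 0 k b h0
  have cov : ∀ y : ι → Bool, y k = b → y m = !e → Hits (F 2) y := by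
    intro y hyk hym
    obtain ⟨l, hl⟩ := hcov y
    fin_cases l
    · have := hl m e hm
      simp [hym] at this
    · have := hl k _ h1
      simp [hyk] at this
    · exact hl
  have h2 : F 2 k = some b := by
    obtain ⟨c, f, hc, -⟩ := hclash 2 0 (by decide)
    obtain ⟨u, v, huk, hu⟩ : ∃ u v, u ≠ m ∧ F 2 u = some v := by
      by_cases hcm : c = m
      · subst hcm
        exact many 2 c f hc
      · exact ⟨c, f, hcm, hc⟩
    have hy := cov (fun i => if i = k then b else if i = m then !e else !v) (by simp)
      (by simp [hmk]) u v hu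
    by_cases h : u = k
    · subst h
      simp at hy
      rw [hu, hy]
    · simp [h, huk] at hy
  obtain ⟨n, f, hnk, hn⟩ := many 1 k _ h1
  obtain ⟨l, hl⟩ := hcov fun i => if i = k then !b else !f
  fin_cases l
  · simpa using hl k b h0
  · simpa [hnk] using hl n f hn
  · simpa using hl k b h2

/-- The subcubes occurring in the pattern `p` partition the cube with letters `x`. -/
structure Splits {ι : Type*} (p : Pat) (x : ι → Letter) (y : Fin 3 → ι → Letter) : Prop where
  mem_all : p ∈ Pat.all
  fit (k) : fit p (x k) fun i => y i k
  last (k k') : usesLast p (x k) (fun i => y i k) → usesLast p (x k') (fun i => y i k') → k = k'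
  first (k k') : usesFirst p (x k) (fun i => y i k) → usesFirst p (x k') (fun i => y i k') → k = k'
  exists_last : isOne p ∨ ∃ k, usesLast p (x k) fun i => y i k

theorem exists_splits_none {ι : Type*} {F : Fin 3 → ι → Letter} {T : Fin 3 → Prop}
    (hclash : ∀ i j, T i → T j → i ≠ j → ∃ k b, F i k = some b ∧ F j k = some !b)
    (hcov : ∀ y, ∃ l, T l ∧ Hits (F l) y) :
    ∃ p, Splits p (fun _ => none) F ∧ ∀ l, has p l ↔ T l := by
  by_cases hone : ∃ l, T l ∧ ∀ k, F l k = none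
  · obtain ⟨l, hl, hn⟩ := hone
    refine ⟨one l, ⟨?_, fun k => ?_, ?_, ?_, Or.inl rfl⟩, fun m => ?_⟩
    · fin_cases l <;> simp [Pat.all]
    · simp [fit, hn, sub]
    · simp [usesLast]
    · simp [usesFirst]
    · simp only [has, beq_iff_eq]
      refine ⟨fun h => h ▸ hl, fun hm => ?_⟩
      by_contra hne
      obtain ⟨k, b, h, -⟩ := hclash l m hl hm hne
      simp [hn] at h
  by_cases hall : ∀ l, T l
  · obtain ⟨h, k, b, hk, hk'⟩ := exists_unique_letter (fun i j => hclash i j (hall i) (hall j))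
      fun y => (hcov y).imp fun _ => And.right
    obtain ⟨l, m, hmem, hhl, hhm, hlm, hcase⟩ : ∃ l m, three h l m ∈ Pat.all ∧ h ≠ l ∧ h ≠ m ∧
        l ≠ m ∧ ∀ i, i = h ∨ i = l ∨ i = m := by
      fin_cases h
      · exact ⟨1, 2, by simp [Pat.all], by decide⟩
      · exact ⟨0, 2, by simp [Pat.all], by decide⟩
      · exact ⟨0, 1, by simp [Pat.all], by decide⟩
    obtain ⟨h₁, h₂, h₃, h₄⟩ := exists_pat_three (fun i j => hclash i j (hall i) (hall j)) hlm hhl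
      hhm (fun y => by
        obtain ⟨i, -, hi⟩ := hcov y
        rcases hcase i with rfl | rfl | rfl <;> simp [hi]) hk hk'
    exact ⟨three h l m, ⟨hmem, h₁, h₃, fun k₁ k₂ hk₁ hk₂ => (h₄ k₁ hk₁).trans (h₄ k₂ hk₂).symm,
      Or.inr h₂⟩, by simp [has, hall]⟩
  push Not at hall
  obtain ⟨i, hi⟩ := hall
  obtain ⟨l, m, hmem, hlm, hil, him, hcase⟩ : ∃ l m, two l m ∈ Pat.all ∧ l ≠ m ∧ l ≠ i ∧ m ≠ i ∧
      ∀ j, j = i ∨ j = l ∨ j = m := by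
    fin_cases i
    · exact ⟨1, 2, by simp [Pat.all], by decide⟩
    · exact ⟨0, 2, by simp [Pat.all], by decide⟩
    · exact ⟨0, 1, by simp [Pat.all], by decide⟩
  have hcov' : ∀ y, (T l ∧ Hits (F l) y) ∨ (T m ∧ Hits (F m) y) := by
    intro y
    obtain ⟨j, hj, hy⟩ := hcov y
    rcases hcase j with rfl | rfl | rfl
    · exact absurd hj hi
    · exact Or.inl ⟨hj, hy⟩
    · exact Or.inr ⟨hj, hy⟩
  have hmiss : ∀ j, T j → ∃ y, ¬ Hits (F j) y := by
    intro j hj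
    push Not at hone
    obtain ⟨k, hk⟩ := hone j hj
    obtain ⟨b, hb⟩ := Option.ne_none_iff_exists'.1 hk
    exact ⟨fun _ => !b, fun h => by simpa using h k b hb⟩
  have hTl : T l := by
    by_contra hT
    obtain ⟨y, hy⟩ := hmiss m ((hcov' fun _ => true).resolve_left fun h => hT h.1).1
    exact hy ((hcov' y).resolve_left fun h => hT h.1).2
  have hTm : T m := by
    by_contra hT
    obtain ⟨y, hy⟩ := hmiss l hTl
    exact hy ((hcov' y).resolve_right fun h => hT h.1).2
  obtain ⟨k, b, hk, hk'⟩ := hclash l m hTl hTm hlm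
  obtain ⟨h₁, h₂, h₃⟩ := exists_pat_two hk hk' fun y => (hcov' y).imp And.right And.right
  refine ⟨two l m, ⟨hmem, h₁, fun k₁ k₂ hk₁ hk₂ => (h₃ k₁ hk₁).trans (h₃ k₂ hk₂).symm,
    by simp [usesFirst], Or.inr ⟨k, h₂⟩⟩, fun j => ?_⟩
  rcases hcase j with rfl | rfl | rfl <;> simp [has, *]

theorem exists_splits {ι : Type*} {r : ι → Letter} {s : Fin 3 → ι → Letter} {P : Fin 3 → Prop}
    (hclash : ∀ i j, P i → P j → i ≠ j → ∃ k, clash (s i k) (s j k))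
    (hcov : ∀ y, Hits r y → ∃ l, P l ∧ Hits (s l) y) :
    ∃ p, Splits p r s ∧ ∀ l, has p l ↔ P l ∧ ∀ k, ¬ clash (r k) (s l k) := by
  let F : Fin 3 → ι → Letter := fun l k => if r k = none then s l k else none
  have loc : ∀ x y z : Letter, clash y z → ¬ clash x y → ¬ clash x z → x = none := by decide
  obtain ⟨p, hp, hT⟩ := exists_splits_none (F := F) (T := fun l => P l ∧ ∀ k, ¬ clash (r k) (s l k))
    (fun i j hi hj hij => by
      obtain ⟨k, hk⟩ := hclash i j hi.1 hj.1 hij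
      have hr := loc _ _ _ hk (hi.2 k) (hj.2 k)
      obtain ⟨b, h⟩ := clash_iff.1 hk
      exact ⟨k, b, by simpa [F, hr] using h⟩)
    (fun y => by
      obtain ⟨l, hl, h⟩ := hcov (fun k => (r k).getD (y k)) fun k b hb => by simp [hb]
      refine ⟨l, ⟨hl, fun k hk => ?_⟩, fun k b hb => ?_⟩
      · obtain ⟨b, hb, hb'⟩ := clash_iff.1 hk
        have := h k _ hb'
        simp [hb] at this
      · by_cases hr : r k = none
        · simp only [F, hr, if_true] at hb
          simpa [hr] using h k b hb
        · simp [F, hr] at hb)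
  have hF : ∀ k, r k = none → (fun i => F i k) = fun i => s i k := fun k hk => by simp [F, hk]
  have hlast : ∀ k, usesLast p (r k) (fun i => s i k) → usesLast p none fun i => F i k := by
    intro k hk
    cases hr : r k with
    | none => rwa [hF k hr, ← hr]
    | some b =>
      rw [hr] at hk
      cases p <;> simp [usesLast] at hk
  have hfirst : ∀ k, usesFirst p (r k) (fun i => s i k) → usesFirst p none fun i => F i k := by
    intro k hk
    cases hr : r k with
    | none => rwa [hF k hr, ← hr]
    | some b =>
      rw [hr] at hk
      cases p <;> simp [usesFirst] at hk
  refine ⟨p, ⟨hp.mem_all, fun k => ?_, fun k k' hk hk' => hp.last k k' (hlast k hk) (hlast k' hk'),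
    fun k k' hk hk' => hp.first k k' (hfirst k hk) (hfirst k' hk'), hp.exists_last.imp_right ?_⟩, hT⟩
  · cases hr : r k with
    | none =>
      rw [← hF k hr]
      exact hp.fit k
    | some b =>
      have hsub : ∀ l, has p l → sub (some b) (s l k) := by
        intro l hl
        have h := ((hT l).1 hl).2 k
        have : ∀ b y, ¬ clash (some b) y → sub (some b) y := by decide
        exact this _ _ (hr ▸ h)
      rcases Pat.mem_all_cases hp.mem_all with rfl | ⟨l, rfl⟩ | ⟨l, m, rfl, -⟩ | ⟨h, l, m, rfl, -⟩
      · rcases hp.exists_last with h | ⟨k, h⟩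
        · simp [isOne] at h
        · simp [usesLast] at h
      · simpa [Pat.fit] using hsub l (by simp [has])
      · simp [Pat.fit, hsub l (by simp [has]), hsub m (by simp [has])]
      · simp [Pat.fit, hsub h (by simp [has]), hsub l (by simp [has]), hsub m (by simp [has])]
  · rintro ⟨k, hk⟩
    refine ⟨k, ?_⟩
    cases hr : r k with
    | none => rwa [← hF k hr]
    | some b =>
      exfalso
      have hn : ∀ i, F i k = none := fun i => by simp [F, hr]
      cases p <;> simp [usesLast, hn, clash] at hk

/-- The patterns `p` describe how each present cube of `A` is partitioned by those of `B`. -/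
structure Patterns {ι : Type*} (P Q : Fin 3 → Prop) (A B : Fin 3 → ι → Letter)
    (p : Fin 3 → Pat) : Prop where
  mem_all (j) : p j ∈ Pat.all
  fit (j k) : fit (p j) (A j k) fun i => B i k
  last (j k k') : usesLast (p j) (A j k) (fun i => B i k) →
    usesLast (p j) (A j k') (fun i => B i k') → k = k'
  first (j k k') : usesFirst (p j) (A j k) (fun i => B i k) →
    usesFirst (p j) (A j k') (fun i => B i k') → k = k'
  exists_last (j) : p j = non ∨ isOne (p j) ∨ ∃ k, usesLast (p j) (A j k) fun i => B i k
  has_iff (j l) : has (p j) l ↔ P j ∧ Q l ∧ ∀ k, ¬ clash (A j k) (B l k)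
  ne_non_iff (j) : p j ≠ non ↔ P j

theorem exists_patterns {ι : Type*} {P Q : Fin 3 → Prop} {A B : Fin 3 → ι → Letter}
    (hclash : ∀ i j, Q i → Q j → i ≠ j → ∃ k, clash (B i k) (B j k))
    (hnone : ∀ j, ¬ P j → ∀ k, A j k = none)
    (hcov : ∀ j y, P j → Hits (A j) y → ∃ l, Q l ∧ Hits (B l) y) :
    ∃ p, Patterns P Q A B p := by
  have h : ∀ j, ∃ p, (P j → Splits p (A j) B ∧
      ∀ l, has p l ↔ Q l ∧ ∀ k, ¬ clash (A j k) (B l k)) ∧ (¬ P j → p = non) := by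
    intro j
    by_cases hj : P j
    · obtain ⟨p, hp⟩ := exists_splits hclash fun y => hcov j y hj
      exact ⟨p, fun _ => hp, fun h => absurd hj h⟩
    · exact ⟨non, fun h => absurd h hj, fun _ => rfl⟩
  choose p hp hn using h
  refine ⟨p, fun j => ?_, fun j k => ?_, fun j k k' h h' => ?_, fun j k k' h h' => ?_, fun j => ?_,
    fun j l => ?_, fun j => ⟨fun h => ?_, fun hj h => ?_⟩⟩
  · by_cases hj : P j
    · exact (hp j hj).1.mem_all
    · simp [hn j hj, Pat.all]
  · by_cases hj : P j
    · exact (hp j hj).1.fit k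
    · simp [hn j hj, hnone j hj, Pat.fit]
  · by_cases hj : P j
    · exact (hp j hj).1.last k k' h h'
    · simp [hn j hj, usesLast] at h
  · by_cases hj : P j
    · exact (hp j hj).1.first k k' h h'
    · simp [hn j hj, usesFirst] at h
  · by_cases hj : P j
    · exact Or.inr (hp j hj).1.exists_last
    · exact Or.inl (hn j hj)
  · by_cases hj : P j
    · simp [(hp j hj).2, hj]
    · simp [hn j hj, has, hj]
  · by_contra hj
    exact h (hn j hj)
  · rcases (hp j hj).1.exists_last with h' | ⟨k, h'⟩ <;> rw [h] at h'
    · simp [isOne] at h'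
    · simp [usesLast] at h'

theorem Patterns.comp {ι : Type*} {P Q : Fin 3 → Prop} {A B : Fin 3 → ι → Letter}
    {p : Fin 3 → Pat} (h : Patterns P Q A B p) (σ : Fin 3 → Fin 3) :
    Patterns (P ∘ σ) Q (A ∘ σ) B (p ∘ σ) where
  mem_all _ := h.mem_all _
  fit _ := h.fit _
  last _ := h.last _
  first _ := h.first _
  exists_last _ := h.exists_last _
  has_iff _ := h.has_iff _
  ne_non_iff _ := h.ne_non_iff _

theorem Patterns.has_comm {ι : Type*} {P Q : Fin 3 → Prop} {A B : Fin 3 → ι → Letter}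
    {p q : Fin 3 → Pat} (hp : Patterns P Q A B p) (hq : Patterns Q P B A q) (j l : Fin 3) :
    has (p j) l = has (q l) j := by
  rw [Bool.eq_iff_iff, hp.has_iff, hq.has_iff]
  simp only [clash_comm (A j _)]
  tauto

theorem Patterns.sub_of_isOne {ι : Type*} {P Q : Fin 3 → Prop} {A B : Fin 3 → ι → Letter}
    {p : Fin 3 → Pat} (hp : Patterns P Q A B p) {j l : Fin 3} (h : isOne (p j))
    (hl : has (p j) l) (k : ι) : sub (A j k) (B l k) := by
  have hf := hp.fit j k
  cases hpj : p j <;> rw [hpj] at h hl hf <;> simp [isOne, has] at h hl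
  subst hl
  exact hf

theorem eq_of_fit_two {x y z : Letter} (h : (sub x y && sub x z) || (x.isNone && clash y z))
    (hn : ¬ (x = none ∧ clash y z)) (hy : sub y x) (hz : sub z x) : y = z := by
  revert x y z; decide

theorem eq_of_fit_three {x u y z : Letter}
    (h : (sub x u && sub x y && sub x z) || (x.isNone && ((clash u y && clash u z) ||
      (u.isNone && clash y z))))
    (hn : ¬ (x = none ∧ clash y z)) (hy : sub y x) (hz : sub z x) : y = z := by
  revert x u y z; decide

theorem Patterns.good {ι : Type*} {P Q : Fin 3 → Prop} {A B : Fin 3 → ι → Letter}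
    {p q : Fin 3 → Pat} (hp : Patterns P Q A B p) (hq : Patterns Q P B A q)
    (hne : ∀ i j, P i → Q j → A i ≠ B j)
    (htwin : ∀ i j k, Q i → Q j → i ≠ j → clash (B i k) (B j k) → ∃ k', k' ≠ k ∧ B i k' ≠ B j k')
    (j : Fin 3) : Pat.good (p j) q := by
  have hsub : ∀ l, has (p j) l → isOne (q l) → ∀ k, sub (B l k) (A j k) := fun l hl h k =>
    hq.sub_of_isOne h (by rwa [← hp.has_comm hq]) k
  have hQ : ∀ l, has (p j) l → P j ∧ Q l := fun l hl => ⟨((hp.has_iff j l).1 hl).1,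
    ((hp.has_iff j l).1 hl).2.1⟩
  rcases Pat.mem_all_cases (hp.mem_all j) with h | ⟨l, h⟩ | ⟨l, m, h, hlm⟩ | ⟨u, l, m, h, -, -, hlm⟩
  · simp [h, Pat.good]
  · simp only [h, Pat.good, Bool.not_eq_true', Bool.eq_false_iff]
    intro hl
    have hh : has (p j) l := by simp [h, has]
    refine hne j l (hQ l hh).1 (hQ l hh).2 (funext fun k => ?_)
    have h1 := hsub l hh hl k
    have h2 := hp.sub_of_isOne (by simp [h, isOne]) hh k
    have : ∀ x y, sub x y → sub y x → x = y := by decide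
    exact this _ _ h2 h1
  all_goals
    simp only [h, Pat.good, Bool.not_eq_true', Bool.eq_false_iff, ne_eq, Bool.and_eq_true]
    rintro ⟨hl, hm⟩
    have hhl : has (p j) l := by simp [h, has]
    have hhm : has (p j) m := by simp [h, has]
    have hlast : ∀ k, usesLast (p j) (A j k) (fun i => B i k) ↔
        A j k = none ∧ clash (B l k) (B m k) := by
      intro k
      rw [h]
      cases A j k <;> simp [usesLast]
    obtain ⟨k, hk⟩ : ∃ k, usesLast (p j) (A j k) fun i => B i k := by
      rcases hp.exists_last j with h' | h' | h'
      · simp [h] at h'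
      · simp [h, isOne] at h'
      · exact h'
    obtain ⟨k', hk', hB⟩ := htwin l m k (hQ l hhl).2 (hQ m hhm).2 hlm ((hlast k).1 hk).2
    have hf := hp.fit j k'
    rw [h] at hf
    have hn : ¬ (A j k' = none ∧ clash (B l k') (B m k')) := fun hu =>
      hk' (hp.last j k' k ((hlast k').2 hu) hk)
    first
    | exact hB (eq_of_fit_two hf hn (hsub l hhl hl k') (hsub m hhm hm k'))
    | exact hB (eq_of_fit_three hf hn (hsub l hhl hl k') (hsub m hhm hm k'))

open Classical in
theorem Patterns.count_eq {ι : Type*} {P Q : Fin 3 → Prop} {A B : Fin 3 → ι → Letter}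
    {p : Fin 3 → Pat} (hp : Patterns P Q A B p) (j : Fin 3) (k : ι) (c : Letter) :
    count (p j) (A j k) c = if P j ∧ A j k = c then 1 else 0 := by
  have h1 : isNon (p j) = !decide (P j) := by
    have := hp.ne_non_iff j
    cases h : p j <;> simp [h, isNon] at this ⊢ <;> exact this
  have h2 : ∀ x c : Letter, (sub x c && sub c x) = decide (x = c) := by decide
  unfold count
  rw [h1, Bool.and_assoc, h2]
  by_cases hj : P j <;> by_cases hc : A j k = c <;> simp [hj, hc]

theorem Patterns.digit_land {ι : Type*} {P Q : Fin 3 → Prop} {A B : Fin 3 → ι → Letter}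
    {p : Fin 3 → Pat} (hp : Patterns P Q A B p) (j : Fin 3) {k k' : ι} (hk : k ≠ k') :
    digit (p j) (A j k) (fun i => B i k) &&& digit (p j) (A j k') (fun i => B i k') = 0 :=
  Pat.digit_land (fun h => hk (hp.last j k k' h.1 h.2)) fun h => hk (hp.first j k k' h.1 h.2)

open Classical in
/-- Two disjoint twin-free families of at most three cubes with the same union cannot have four
coordinates at which no letter occurs more than three times. -/
theorem no_capped_coordinates {ι : Type*} {P Q : Fin 3 → Prop} {A B : Fin 3 → ι → Letter}
    (hA : ∀ i j, P i → P j → i ≠ j → ∃ k, clash (A i k) (A j k))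
    (hB : ∀ i j, Q i → Q j → i ≠ j → ∃ k, clash (B i k) (B j k))
    (hAt : ∀ i j k, P i → P j → i ≠ j → clash (A i k) (A j k) → ∃ k', k' ≠ k ∧ A i k' ≠ A j k')
    (hBt : ∀ i j k, Q i → Q j → i ≠ j → clash (B i k) (B j k) → ∃ k', k' ≠ k ∧ B i k' ≠ B j k')
    (hne : ∀ i j, P i → Q j → A i ≠ B j)
    (hAn : ∀ j, ¬ P j → ∀ k, A j k = none) (hBn : ∀ j, ¬ Q j → ∀ k, B j k = none)
    (hAB : ∀ j y, P j → Hits (A j) y → ∃ l, Q l ∧ Hits (B l) y)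
    (hBA : ∀ j y, Q j → Hits (B j) y → ∃ l, P l ∧ Hits (A l) y)
    (hex : ∃ j, P j) (K : Fin 4 → ι) (hK : Function.Injective K)
    (hcap : ∀ i c, (∑ j, if P j ∧ A j (K i) = c then 1 else 0) +
      (∑ j, if Q j ∧ B j (K i) = c then 1 else 0) ≤ 3) : False := by
  obtain ⟨p₀, hp₀⟩ := exists_patterns hB hAn hAB
  let σ := Tuple.sort (key ∘ p₀)
  have hσ : Monotone ((key ∘ p₀) ∘ σ) := Tuple.monotone_sort _
  have hp := hp₀.comp σ
  obtain ⟨q, hq⟩ := exists_patterns (P := Q) (Q := P ∘ σ) (A := B) (B := A ∘ σ)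
    (fun i j hi hj hij => hA _ _ hi hj (σ.injective.ne hij)) hBn fun j y hj hy => by
      obtain ⟨l, hl, h⟩ := hBA j y hj hy
      exact ⟨σ.symm l, by simpa using hl, by simpa using h⟩
  refine not_four_columns hp.mem_all hq.mem_all (hσ (by decide : (0 : Fin 3) ≤ 1))
    (hσ (by decide : (1 : Fin 3) ≤ 2)) ?_ (hp.has_comm hq)
    (hp.good hq (fun i j => hne _ _) hBt)
    (hq.good hp (fun i j hi hj => (hne _ _ hj hi).symm)
      fun i j k hi hj hij => hAt _ _ k hi hj (σ.injective.ne hij))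
    (fun i => (fun j => A (σ j) (K i), fun j => B j (K i)))
    (fun i j => hp.fit j (K i)) (fun i j => hq.fit j (K i)) (fun i => ?_) fun i i' h =>
      mask_land (fun j => hp.digit_land j (hK.ne h)) fun j => hq.digit_land j (hK.ne h)
  · obtain ⟨j, hj⟩ := hex
    exact ⟨σ.symm j, (hp.ne_non_iff _).2 (by simpa using hj)⟩
  · refine List.all_eq_true.2 fun c _ => Nat.ble_eq_true_of_le ?_
    refine le_trans (le_of_eq ?_) (hcap i c)
    rw [← Equiv.sum_comp σ, Fin.sum_univ_three, Fin.sum_univ_three, ← hp₀.count_eq,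
      ← hp₀.count_eq, ← hp₀.count_eq, ← hq.count_eq, ← hq.count_eq, ← hq.count_eq]
    rfl

/-- The letters `w` and `o` represent the two complementary pairs of the alphabet. -/
structure Represents (c : S → S) (w o : S) : Prop where
  involutive : Function.Involutive c
  fix_ne (s) : c s ≠ s
  ne : o ≠ w
  ne_compl : o ≠ c w
  cases (s) : s = w ∨ s = c w ∨ s = o ∨ s = c o

open Classical in
/-- The letter `s` relative to `w`, where `o` represents the other complementary pair. -/
noncomputable def relLetter (w o s : S) : Letter := if s = w then none else some (decide (s = o))

/-- The member of `ES` containing `w`, and `o` or its complement according to `b`. -/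
def corner (c : S → S) (w o : S) (b : Bool) : Set S :=
  {s | s = w ∨ s = o ∧ b = true ∨ s = c o ∧ b = false}

namespace Represents

variable {c : S → S} {w o : S}

theorem compl_ne (h : Represents c w o) : c o ≠ w := fun e =>
  h.ne_compl (by rw [← e, h.involutive])

theorem compl_ne_compl (h : Represents c w o) : c o ≠ c w := fun e =>
  h.ne (h.involutive.injective e)

theorem relLetter_self (w o : S) : relLetter w o w = none := by simp [relLetter]

theorem relLetter_other (h : Represents c w o) : relLetter w o o = some true := by
  simp [relLetter, h.ne]

theorem relLetter_compl (h : Represents c w o) : relLetter w o (c o) = some false := by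
  simp [relLetter, h.compl_ne, h.fix_ne]

theorem eq_of_relLetter_eq (h : Represents c w o) {s t : S} (hs : s ≠ c w) (ht : t ≠ c w)
    (hst : relLetter w o s = relLetter w o t) : s = t := by
  have h1 := relLetter_self w o
  have h2 := h.relLetter_other
  have h3 := h.relLetter_compl
  rcases h.cases s with rfl | rfl | rfl | rfl <;> rcases h.cases t with rfl | rfl | rfl | rfl <;>
    simp_all

theorem clash_relLetter (h : Represents c w o) {s t : S} (hs : s ≠ c w) (ht : t ≠ c w) :
    clash (relLetter w o s) (relLetter w o t) ↔ t = c s := by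
  have h1 := relLetter_self w o
  have h2 := h.relLetter_other
  have h3 := h.relLetter_compl
  have h4 := h.compl_ne
  have h5 := h.fix_ne
  have h6 := h.involutive
  have h7 := h.ne
  have h8 := h.compl_ne.symm
  have h9 := fun s => (h.fix_ne s).symm
  have h10 := h.ne.symm
  rcases h.cases s with rfl | rfl | rfl | rfl <;> rcases h.cases t with rfl | rfl | rfl | rfl <;>
    simp_all [clash, h6 _]

theorem corner_mem (h : Represents c w o) (b : Bool) : corner c w o b ∈ ESet c := by
  have h1 := h.compl_ne
  have h2 := h.fix_ne
  have h3 := h.involutive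
  have h4 := h.ne
  have h5 := h.ne_compl
  have h6 := h.compl_ne_compl
  have h7 := h.compl_ne_compl.symm
  have h8 := h.ne.symm
  have h10 := h.ne_compl.symm
  have h9 := fun s => (h.fix_ne s).symm
  intro s
  change Xor (s ∈ corner c w o b) (c s ∈ corner c w o b)
  rcases h.cases s with rfl | rfl | rfl | rfl <;> cases b <;>
    simp_all [corner, Xor, h3 _]

theorem mem_corner (h : Represents c w o) {b : Bool} {s : S} :
    s ∈ corner c w o b ↔ s ≠ c w ∧ ∀ e, relLetter w o s = some e → b = e := by
  have h1 := relLetter_self w o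
  have h2 := h.relLetter_other
  have h3 := h.relLetter_compl
  have h4 := h.compl_ne
  have h5 := h.fix_ne
  have h6 := h.compl_ne_compl
  have h7 := h.ne
  have h8 := h.ne_compl
  rcases h.cases s with rfl | rfl | rfl | rfl <;> simp_all [corner, eq_comm]

end Represents

section Words

variable {d : ℕ} {c : S → S} {V : Set (Fin d → S)} {w o : Fin d → S}

/-- The realization of `v` meets that of `w`. -/
def Present (c : S → S) (w v : Fin d → S) : Prop := ∀ k, v k ≠ c (w k)

/-- The word `v` relative to `w`. -/
noncomputable def relWord (w o v : Fin d → S) (k : Fin d) : Letter := relLetter (w k) (o k) (v k)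

open Classical in
/-- The word `v` relative to `w` with its letter at `i` forgotten, or the empty word if the
realizations of `v` and `w` are disjoint. -/
noncomputable def slice (c : S → S) (w o : Fin d → S) (i : Fin d) (v : Fin d → S) (k : Fin d) :
    Letter :=
  if Present c w v ∧ k ≠ i then relWord w o v k else none

theorem slice_of_present {i k : Fin d} {v : Fin d → S} (hv : Present c w v) (hk : k ≠ i) :
    slice c w o i v k = relWord w o v k := by simp [slice, hv, hk]

theorem corner_mem_realize (h : ∀ k, Represents c (w k) (o k)) {v : Fin d → S} {y : Fin d → Bool} :
    (fun k => corner c (w k) (o k) (y k)) ∈ Realize c v ↔ Present c w v ∧ Hits (relWord w o v) y := by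
  simp only [Realize, ELetter, Set.mem_ofPred_eq, (h _).corner_mem, true_and, (h _).mem_corner,
    Present, Hits, relWord]
  exact forall_and

theorem exists_hits (h : ∀ k, Represents c (w k) (o k)) {W : Set (Fin d → S)}
    (heq : EquivCodes c V W) (hw : w ∈ W) (y : Fin d → Bool) :
    ∃ v ∈ V, Present c w v ∧ Hits (relWord w o v) y := by
  have hy : (fun k => corner c (w k) (o k) (y k)) ∈ RealizeSet c W := by
    refine Set.mem_biUnion hw ((corner_mem_realize h).2 ⟨fun k => ((h k).fix_ne _).symm, ?_⟩)
    intro k b hb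
    simp [relWord, Represents.relLetter_self] at hb
  rw [← heq] at hy
  simpa only [RealizeSet, Set.mem_iUnion, corner_mem_realize h, exists_prop] using hy

theorem eq_of_hits (h : ∀ k, Represents c (w k) (o k)) (hV : PolyboxCode c V) {u v : Fin d → S}
    (hu : u ∈ V) (hv : v ∈ V) (hpu : Present c w u) (hpv : Present c w v) {y : Fin d → Bool}
    (hyu : Hits (relWord w o u) y) (hyv : Hits (relWord w o v) y) : u = v := by
  by_contra hne
  obtain ⟨k, hk⟩ := hV u hu v hv hne
  obtain ⟨b, hb, hb'⟩ := clash_iff.1 (((h k).clash_relLetter (hpu k) (hpv k)).2 hk)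
  have := (hyu k b hb).symm.trans (hyv k _ hb')
  simp at this

theorem exists_clash (h : ∀ k, Represents c (w k) (o k)) (hV : PolyboxCode c V) {u v : Fin d → S}
    (hu : u ∈ V) (hv : v ∈ V) (hpu : Present c w u) (hpv : Present c w v) (hne : u ≠ v) :
    ∃ k, clash (relWord w o u k) (relWord w o v k) := by
  obtain ⟨k, hk⟩ := hV u hu v hv hne
  exact ⟨k, ((h k).clash_relLetter (hpu k) (hpv k)).2 hk⟩

theorem exists_relWord_ne (h : ∀ k, Represents c (w k) (o k)) (hVt : NoTwinPair c V)
    {u v : Fin d → S} (hu : u ∈ V) (hv : v ∈ V) (hpu : Present c w u) (hpv : Present c w v)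
    {k : Fin d} (hk : clash (relWord w o u k) (relWord w o v k)) :
    ∃ k', k' ≠ k ∧ relWord w o u k' ≠ relWord w o v k' := by
  by_contra! hno
  exact hVt u hu v hv ⟨k, ((h k).clash_relLetter (hpu k) (hpv k)).1 hk, fun k' hk' =>
    ((h k').eq_of_relLetter_eq (hpu k') (hpv k') (hno k' hk')).symm⟩

theorem exists_slice_clash (h : ∀ k, Represents c (w k) (o k)) (hV : PolyboxCode c V)
    {u v : Fin d → S} (hu : u ∈ V) (hv : v ∈ V) (hpu : Present c w u) (hpv : Present c w v)
    (hne : u ≠ v) {i : Fin d} (hi : u i = v i) :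
    ∃ k, clash (slice c w o i u k) (slice c w o i v k) := by
  obtain ⟨k, hk⟩ := exists_clash h hV hu hv hpu hpv hne
  have hki : k ≠ i := by
    rintro rfl
    have : ∀ x, ¬ clash x x := by decide
    simp only [relWord, hi] at hk
    exact this _ hk
  exact ⟨k, by rwa [slice_of_present hpu hki, slice_of_present hpv hki]⟩

theorem exists_slice_ne (h : ∀ k, Represents c (w k) (o k)) (hVt : NoTwinPair c V)
    {u v : Fin d → S} (hu : u ∈ V) (hv : v ∈ V) (hpu : Present c w u) (hpv : Present c w v)
    {i : Fin d} (hi : u i = v i) {k : Fin d}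
    (hk : clash (slice c w o i u k) (slice c w o i v k)) :
    ∃ k', k' ≠ k ∧ slice c w o i u k' ≠ slice c w o i v k' := by
  have hki : k ≠ i := by
    rintro rfl
    simp [slice, clash] at hk
  rw [slice_of_present hpu hki, slice_of_present hpv hki] at hk
  obtain ⟨k', hk', hne⟩ := exists_relWord_ne h hVt hu hv hpu hpv hk
  have hki' : k' ≠ i := by
    rintro rfl
    simp [relWord, hi] at hne
  exact ⟨k', hk', by rwa [slice_of_present hpu hki', slice_of_present hpv hki']⟩

theorem slice_ne (h : ∀ k, Represents c (w k) (o k)) (hVt : NoTwinPair c V)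
    {u v : Fin d → S} (hu : u ∈ V) (hv : v ∈ V) (hpu : Present c w u) (hpv : Present c w v)
    {i : Fin d} (hi : v i = c (u i)) : slice c w o i u ≠ slice c w o i v := by
  intro he
  refine hVt u hu v hv ⟨i, hi, fun k hk => ?_⟩
  have := congrFun he k
  rw [slice_of_present hpu hk, slice_of_present hpv hk] at this
  exact ((h k).eq_of_relLetter_eq (hpu k) (hpv k) this).symm

theorem exists_hits_slice (h : ∀ k, Represents c (w k) (o k)) (hV : PolyboxCode c V)
    {W : Set (Fin d → S)} (heq : EquivCodes c V W) (hw : w ∈ W) {u : Fin d → S} (hu : u ∈ V)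
    (hpu : Present c w u) {i : Fin d} {b : Bool} (hb : relWord w o u i = some b)
    {y : Fin d → Bool} (hy : Hits (slice c w o i u) y) :
    ∃ v ∈ V, Present c w v ∧ relWord w o v i = some (!b) ∧ Hits (slice c w o i v) y := by
  obtain ⟨v, hv, hpv, hit⟩ := exists_hits h heq hw (Function.update y i !b)
  refine ⟨v, hv, hpv, ?_, fun k e hk => ?_⟩
  · cases hvi : relWord w o v i with
    | some e => simpa using (hit i e hvi).symm
    | none =>
      have huv : u = v := by
        refine eq_of_hits h hV hu hv hpu hpv (y := Function.update y i b) (fun k e hk => ?_)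
          fun k e hk => ?_
        · by_cases hki : k = i
          · subst hki
            simpa [hb] using hk
          · simpa [hki] using hy k e (by rwa [slice_of_present hpu hki])
        · have hki : k ≠ i := by
            rintro rfl
            simp [hvi] at hk
          simpa [hki] using hit k e hk
      rw [← huv, hb] at hvi
      exact absurd hvi (by simp)
  · have hki : k ≠ i := by
      rintro rfl
      simp [slice] at hk
    rw [slice_of_present hpv hki] at hk
    simpa [hki] using hit k e hk

theorem Set.exists_injective_range_eq {α : Type*} {s : Set α} {n : ℕ} (h : s.ncard = n)
    (hn : n ≠ 0) : ∃ f : Fin n → α, Function.Injective f ∧ Set.range f = s := by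
  have : Finite s := Set.finite_of_ncard_ne_zero (by omega)
  let e := (Finite.equivFinOfCardEq (α := s) h).symm
  refine ⟨fun j => e j, Subtype.val_injective.comp e.injective, ?_⟩
  rw [← Function.comp_def, Set.range_comp, e.range_eq_univ, Set.image_univ, Subtype.range_coe]

open Classical in
theorem sum_slice_le (h : ∀ k, Represents c (w k) (o k)) {f g : Fin 3 → Fin d → S}
    (hf : Function.Injective f) (hg : Function.Injective g) (hfg : ∀ j l, f j ≠ g l)
    (hfV : ∀ j, f j ∈ V) (hgV : ∀ j, g j ∈ V) {i k : Fin d} (hk : k ≠ i)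
    (hcard : ∀ s, (Subcode V k s).ncard = 3) (x : Letter) :
    (∑ j, if Present c w (f j) ∧ slice c w o i (f j) k = x then 1 else 0) +
      (∑ j, if Present c w (g j) ∧ slice c w o i (g j) k = x then 1 else 0) ≤ 3 := by
  obtain ⟨s, hs, hx⟩ : ∃ s, s ≠ c (w k) ∧ relLetter (w k) (o k) s = x := by
    rcases x with _ | _ | _
    · exact ⟨w k, ((h k).fix_ne _).symm, Represents.relLetter_self _ _⟩
    · exact ⟨c (o k), (h k).compl_ne_compl, (h k).relLetter_compl⟩
    · exact ⟨o k, (h k).ne_compl, (h k).relLetter_other⟩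
  have hinj : Function.Injective (Sum.elim f g) := hf.sumElim hg hfg
  have hmem : ∀ z, Sum.elim f g z ∈ V := by rintro (z | z) <;> simp [hfV, hgV]
  have hsum := Fintype.sum_sum_type fun z =>
    if Present c w (Sum.elim f g z) ∧ slice c w o i (Sum.elim f g z) k = x then 1 else 0
  simp only [Sum.elim_inl, Sum.elim_inr] at hsum
  refine (Eq.trans (by congr!) hsum.symm).trans_le ?_
  rw [← Finset.card_filter, ← Finset.card_image_of_injective _ hinj, ← Set.ncard_coe_finset]
  refine le_of_le_of_eq ?_ (hcard s)
  refine Set.ncard_le_ncard (fun v hv => ?_) (Set.finite_of_ncard_ne_zero (by rw [hcard]; decide))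
  simp only [Finset.coe_image, Finset.coe_filter, Finset.mem_univ, true_and, Set.mem_image,
    Set.mem_ofPred_eq] at hv
  obtain ⟨z, ⟨hz, hzx⟩, rfl⟩ := hv
  rw [slice_of_present hz hk, ← hx] at hzx
  exact ⟨hmem z, (h k).eq_of_relLetter_eq (hz k) hs hzx⟩

theorem exists_present_relWord (h : ∀ k, Represents c (w k) (o k)) (hV : PolyboxCode c V)
    (hVt : NoTwinPair c V) {W : Set (Fin d → S)} (hdisj : Disjoint V W) (heq : EquivCodes c V W)
    (hw : w ∈ W) (i : Fin d) (hcard : (Subcode V i (w i)).ncard = 3) :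
    ∃ v ∈ V, Present c w v ∧ relWord w o v i ≠ none := by
  by_contra! hno
  obtain ⟨f, hf, hr⟩ := Set.exists_injective_range_eq hcard (by decide)
  have hfV : ∀ l, f l ∈ V := fun l => (hr ▸ Set.mem_range_self l : f l ∈ Subcode V i (w i)).1
  obtain ⟨p, hp, hhas⟩ := exists_splits (r := fun _ => none) (s := fun l => relWord w o (f l))
    (P := fun l => Present c w (f l))
    (fun l m hl hm hlm => exists_clash h hV (hfV l) (hfV m) hl hm (hf.ne hlm)) fun y _ => by
      obtain ⟨v, hv, hpv, hy⟩ := exists_hits h heq hw y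
      have hvi : v i = w i := (h i).eq_of_relLetter_eq (hpv i) ((h i).fix_ne _).symm
        ((hno v hv hpv).trans (Represents.relLetter_self _ _).symm)
      obtain ⟨l, rfl⟩ : v ∈ Set.range f := hr ▸ ⟨hv, hvi⟩
      exact ⟨l, hpv, hy⟩
  have hfalse : ∀ l m, Present c w (f l) → Present c w (f m) →
      (∀ k, ¬ clash (relWord w o (f l) k) (relWord w o (f m) k) →
        relWord w o (f l) k = relWord w o (f m) k) →
      (∃ k, clash (relWord w o (f l) k) (relWord w o (f m) k) ∧
        ∀ k', clash (relWord w o (f l) k') (relWord w o (f m) k') → k' = k) → False := by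
    rintro l m hl hm heq ⟨k, hk, hk'⟩
    obtain ⟨k', hne, hne'⟩ := exists_relWord_ne h hVt (hfV l) (hfV m) hl hm hk
    exact hne' (heq k' fun hc => hne (hk' k' hc))
  have hP : ∀ l, has p l → Present c w (f l) := fun l hl => ((hhas l).1 hl).1
  rcases Pat.mem_all_cases hp.mem_all with rfl | ⟨l, rfl⟩ | ⟨l, m, rfl, -⟩ | ⟨u, l, m, rfl, -⟩
  · rcases hp.exists_last with h' | ⟨k, h'⟩
    · simp [isOne] at h'
    · simp [usesLast] at h'
  · have hl : f l = w := funext fun k => by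
      refine (h k).eq_of_relLetter_eq (hP l (by simp [has]) k) ((h k).fix_ne _).symm ?_
      have : ∀ x, sub none x → x = none := by decide
      exact (this _ (hp.fit k)).trans (Represents.relLetter_self _ _).symm
    exact Set.disjoint_left.1 hdisj (hfV l) (hl ▸ hw)
  all_goals
    obtain ⟨k, hk⟩ := hp.exists_last.resolve_left (by simp [isOne])
    refine hfalse l m (hP l (by simp [has])) (hP m (by simp [has])) (fun k hk => ?_)
      ⟨k, hk, fun k' hk' => hp.last k' k hk' hk⟩
    first
    | exact eq_of_fit_two (hp.fit k) (fun hc => hk hc.2) rfl rfl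
    | exact eq_of_fit_three (hp.fit k) (fun hc => hk hc.2) rfl rfl

theorem not_forall_ncard_subcode_eq_three (h : ∀ k, Represents c (w k) (o k)) (hd : 5 ≤ d)
    (hV : PolyboxCode c V) (hVt : NoTwinPair c V) {W : Set (Fin d → S)} (hdisj : Disjoint V W)
    (heq : EquivCodes c V W) (hw : w ∈ W) : ¬ ∀ k s, (Subcode V k s).ncard = 3 := by
  intro hcard
  let i : Fin d := ⟨0, by omega⟩
  obtain ⟨f, hf, hfr⟩ := Set.exists_injective_range_eq (hcard i (o i)) (by decide)
  obtain ⟨g, hg, hgr⟩ := Set.exists_injective_range_eq (hcard i (c (o i))) (by decide)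
  have hf' : ∀ l, f l ∈ V ∧ f l i = o i := fun l =>
    (hfr ▸ Set.mem_range_self l : f l ∈ Subcode V i (o i))
  have hg' : ∀ l, g l ∈ V ∧ g l i = c (o i) := fun l =>
    (hgr ▸ Set.mem_range_self l : g l ∈ Subcode V i (c (o i)))
  have hfrel : ∀ l, relWord w o (f l) i = some true := fun l => by
    rw [relWord, (hf' l).2, (h i).relLetter_other]
  have hgrel : ∀ l, relWord w o (g l) i = some false := fun l => by
    rw [relWord, (hg' l).2, (h i).relLetter_compl]
  have hfmem : ∀ v ∈ V, Present c w v → relWord w o v i = some true → ∃ l, f l = v := by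
    intro v hv hpv hvi
    have : v ∈ Subcode V i (o i) :=
      ⟨hv, (h i).eq_of_relLetter_eq (hpv i) (h i).ne_compl (hvi.trans (h i).relLetter_other.symm)⟩
    rwa [← hfr] at this
  have hgmem : ∀ v ∈ V, Present c w v → relWord w o v i = some false → ∃ l, g l = v := by
    intro v hv hpv hvi
    have : v ∈ Subcode V i (c (o i)) := ⟨hv, (h i).eq_of_relLetter_eq (hpv i) (h i).compl_ne_compl
      (hvi.trans (h i).relLetter_compl.symm)⟩
    rwa [← hgr] at this
  have hfg : ∀ j y, Present c w (f j) → Hits (slice c w o i (f j)) y →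
      ∃ l, Present c w (g l) ∧ Hits (slice c w o i (g l)) y := by
    intro j y hj hy
    obtain ⟨v, hv, hpv, hvi, hy'⟩ := exists_hits_slice h hV heq hw (hf' j).1 hj (hfrel j) hy
    obtain ⟨l, rfl⟩ := hgmem v hv hpv hvi
    exact ⟨l, hpv, hy'⟩
  have hgf : ∀ j y, Present c w (g j) → Hits (slice c w o i (g j)) y →
      ∃ l, Present c w (f l) ∧ Hits (slice c w o i (f l)) y := by
    intro j y hj hy
    obtain ⟨v, hv, hpv, hvi, hy'⟩ := exists_hits_slice h hV heq hw (hg' j).1 hj (hgrel j) hy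
    obtain ⟨l, rfl⟩ := hfmem v hv hpv hvi
    exact ⟨l, hpv, hy'⟩
  refine no_capped_coordinates (P := fun j => Present c w (f j)) (Q := fun j => Present c w (g j))
    (A := fun j => slice c w o i (f j)) (B := fun j => slice c w o i (g j))
    (fun j l hj hl hjl => exists_slice_clash h hV (hf' j).1 (hf' l).1 hj hl (hf.ne hjl)
      ((hf' j).2.trans (hf' l).2.symm))
    (fun j l hj hl hjl => exists_slice_clash h hV (hg' j).1 (hg' l).1 hj hl (hg.ne hjl)
      ((hg' j).2.trans (hg' l).2.symm))
    (fun j l k hj hl _ => exists_slice_ne h hVt (hf' j).1 (hf' l).1 hj hl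
      ((hf' j).2.trans (hf' l).2.symm))
    (fun j l k hj hl _ => exists_slice_ne h hVt (hg' j).1 (hg' l).1 hj hl
      ((hg' j).2.trans (hg' l).2.symm))
    (fun j l hj hl => slice_ne h hVt (hf' j).1 (hg' l).1 hj hl (by rw [(hf' j).2, (hg' l).2]))
    (fun j hj k => by simp [slice, hj]) (fun j hj k => by simp [slice, hj]) hfg hgf ?_
    (fun m => ⟨m + 1, by omega⟩) (fun m n hmn => by simpa [Fin.ext_iff] using hmn)
    fun m x => sum_slice_le h hf hg (fun j l hjl => ?_) (fun j => (hf' j).1) (fun j => (hg' j).1)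
      (Fin.ne_of_val_ne (Nat.succ_ne_zero _)) (hcard _) x
  · obtain ⟨v, hv, hpv, hvi⟩ := exists_present_relWord h hV hVt hdisj heq hw i (hcard i (w i))
    obtain ⟨b, hb⟩ := Option.ne_none_iff_exists'.1 hvi
    cases b
    · obtain ⟨l, rfl⟩ := hgmem v hv hpv hb
      obtain ⟨j, hj, -⟩ := hgf l (fun k => (slice c w o i (g l) k).getD true) hpv
        fun k b hb => by simp [hb]
      exact ⟨j, hj⟩
    · obtain ⟨l, rfl⟩ := hfmem v hv hpv hb
      exact ⟨l, hpv⟩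
  · have := hfrel j
    rw [hjl, hgrel] at this
    simp at this

end Words

open Classical in
theorem exists_represents {c : S → S} (hinv : Function.Involutive c) (hfix : ∀ s, c s ≠ s)
    {a b : S} (hba : b ≠ a) (hba' : b ≠ c a) (hS : ∀ s : S, s = a ∨ s = c a ∨ s = b ∨ s = c b)
    (w : S) : ∃ o, Represents c w o := by
  have h1 : c b ≠ a := fun e => hba' (by rw [← e, hinv])
  have h2 : c b ≠ c a := fun e => hba (hinv.injective e)
  rcases hS w with rfl | rfl | rfl | rfl
  · exact ⟨b, hinv, hfix, hba, hba', hS⟩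
  · refine ⟨b, hinv, hfix, hba', by rwa [hinv], fun s => ?_⟩
    rw [hinv]
    have := hS s
    tauto
  · exact ⟨a, hinv, hfix, hba.symm, h1.symm, fun s => by have := hS s; tauto⟩
  · refine ⟨a, hinv, hfix, h1.symm, by rw [hinv]; exact hba.symm, fun s => ?_⟩
    rw [hinv]
    have := hS s
    tauto

theorem no_3_3_3_3_distribution {d : ℕ} [Fintype S] (c : S → S)
    (hinv : Function.Involutive c) (hfix : ∀ s, c s ≠ s)
    (a b : S) (hba : b ≠ a) (hba' : b ≠ c a)
    (hS : ∀ s : S, s = a ∨ s = c a ∨ s = b ∨ s = c b)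
    (hd : 5 ≤ d)
    (V W : Set (Fin d → S))
    (hV : PolyboxCode c V) (hW : PolyboxCode c W)
    (hdisj : Disjoint V W) (heq : EquivCodes c V W)
    (hVt : NoTwinPair c V) (hWt : NoTwinPair c W)
    (hcard : V.ncard = 12) :
    ¬ ∀ i : Fin d,
        (Subcode V i a).ncard = 3 ∧ (Subcode V i (c a)).ncard = 3 ∧
        (Subcode V i b).ncard = 3 ∧ (Subcode V i (c b)).ncard = 3 := by
  intro h
  choose other hother using exists_represents hinv hfix hba hba' hS
  have hall : ∀ k s, (Subcode V k s).ncard = 3 := by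
    intro k s
    obtain ⟨h₁, h₂, h₃, h₄⟩ := h k
    rcases hS s with rfl | rfl | rfl | rfl <;> assumption
  obtain ⟨v, hv⟩ : V.Nonempty := Set.nonempty_of_ncard_ne_zero (by omega)
  obtain ⟨w, hw, -⟩ := exists_hits (w := v) (o := fun k => other (v k)) (fun k => hother _)
    heq.symm hv fun _ => true
  exact not_forall_ncard_subcode_eq_three (o := fun k => other (w k)) (fun k => hother _) hd hV hVt
    hdisj heq hw hall
end
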